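/- Mean value formula for the fractional Laplacian: let Ω ⊆ ℝ^N be open and let u : ℝ^N → ℝ be measurable with ∫_{ℝ^N} |u(y)|/(1+|y|^{N+2s}) dy < ∞ and u ∈ C^{2s+ε}(Ω). Then for every x ∈ Ω and every r > 0 such that the closed ball B̄_r(x) is contained in Ω, there exists a point z ∈ B̄_r(x) such that u(x) = ∫_{ℝ^N∖B_r(x)} η_r(y)·u(x−y) dy + γ(N,s,r)·(−Δ)^s u(z), where γ(N,s,r) = Γ(N/2)·r^{2s}/(4^s·Γ((N+2s)/2)·Γ(1+s)). -/

import Mathlib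

open MeasureTheory Filter

/-- The constant `c(N,s) = Γ(N/2)·sin(πs)/π^{1+N/2}`. -/
noncomputable def cK (N : ℕ) (s : ℝ) : ℝ :=
  Real.Gamma ((N : ℝ) / 2) * Real.sin (Real.pi * s) / Real.pi ^ (1 + (N : ℝ) / 2)

/-- The kernel `η_r(x) = c(N,s)·r^{2s}/(|x|^N·(|x|²−r²)^s)` for `|x| > r`, and `0` for `|x| ≤ r`. -/
noncomputable def eta (N : ℕ) (s r : ℝ) (x : EuclideanSpace ℝ (Fin N)) : ℝ :=
  if r < ‖x‖ then cK N s * r ^ (2 * s) / (‖x‖ ^ N * (‖x‖ ^ 2 - r ^ 2) ^ s) else 0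

/-- The normalizing constant `C_{N,s} = 4^s·Γ(N/2+s)·s/(π^{N/2}·Γ(1−s))`. -/
noncomputable def CNs (N : ℕ) (s : ℝ) : ℝ :=
  (4 : ℝ) ^ s * Real.Gamma ((N : ℝ) / 2 + s) * s /
    (Real.pi ^ ((N : ℝ) / 2) * Real.Gamma (1 - s))

/-- `(−Δ)^s u (x) = L`, in the principal value sense. -/
def HasFracLap (N : ℕ) (s : ℝ) (u : EuclideanSpace ℝ (Fin N) → ℝ)
    (x : EuclideanSpace ℝ (Fin N)) (L : ℝ) : Prop :=
  Tendsto
    (fun ε : ℝ =>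
      CNs N s * ∫ y in (Metric.ball x ε)ᶜ, (u x - u y) / ‖x - y‖ ^ ((N : ℝ) + 2 * s))
    (nhdsWithin 0 (Set.Ioi 0)) (nhds L)

/-- `u ∈ C^{2s+ε}(Ω)`: `u` is continuous on `Ω` and, on each compact `K ⊂ Ω`, for some
`α > 0` with `2s+α < 2`, `u` is Hölder of exponent `2s+α` if `2s+α ≤ 1`, and differentiable
with gradient Hölder of exponent `2s+α−1` if `2s+α > 1`. -/
def MemC2sEps (N : ℕ) (s : ℝ) (Ω : Set (EuclideanSpace ℝ (Fin N)))
    (u : EuclideanSpace ℝ (Fin N) → ℝ) : Prop :=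
  ContinuousOn u Ω ∧
    ∀ K : Set (EuclideanSpace ℝ (Fin N)), K ⊆ Ω → IsCompact K →
      ∃ α : ℝ, 0 < α ∧ 2 * s + α < 2 ∧
        ((2 * s + α ≤ 1 ∧ ∃ C : NNReal, HolderOnWith C (2 * s + α).toNNReal u K) ∨
          (1 < 2 * s + α ∧ (∀ x ∈ K, DifferentiableAt ℝ u x) ∧
            ∃ C : NNReal, HolderOnWith C (2 * s + α - 1).toNNReal (fderiv ℝ u) K))

/-- The constant `γ(N,s,r) = Γ(N/2)·r^{2s}/(4^s·Γ((N+2s)/2)·Γ(1+s))`. -/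
noncomputable def gammaMV (N : ℕ) (s r : ℝ) : ℝ :=
  Real.Gamma ((N : ℝ) / 2) * r ^ (2 * s) /
    ((4 : ℝ) ^ s * Real.Gamma (((N : ℝ) + 2 * s) / 2) * Real.Gamma (1 + s))

namespace FracMV

open Set ENNReal

theorem lintegral_Ioi_rpow_mul_exp {a r : ℝ} (ha : 0 < a) (hr : 0 < r) :
    ∫⁻ t in Ioi (0 : ℝ), ENNReal.ofReal (t ^ (a - 1) * Real.exp (-(r * t))) =
      ENNReal.ofReal ((1 / r) ^ a * Real.Gamma a) := by
  have h := Real.integral_rpow_mul_exp_neg_mul_Ioi ha hr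
  have hpos : 0 < (1 / r) ^ a * Real.Gamma a :=
    mul_pos (Real.rpow_pos_of_pos (by positivity) _) (Real.Gamma_pos_of_pos ha)
  rw [← h, ofReal_integral_eq_lintegral_ofReal]
  · by_contra hcon
    rw [integral_undef hcon] at h
    exact hpos.ne h
  · filter_upwards [ae_restrict_mem measurableSet_Ioi] with t ht
    have : (0 : ℝ) < t := ht
    positivity

theorem lintegral_Ioi_comp_inv (f : ℝ → ℝ≥0∞) :
    ∫⁻ t in Ioi (0 : ℝ), f t =
      ∫⁻ b in Ioi (0 : ℝ), ENNReal.ofReal (1 / (4 * b ^ 2)) * f (1 / (4 * b)) := by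
  have him : (fun b : ℝ => 1 / (4 * b)) '' Ioi 0 = Ioi 0 := by
    ext t
    simp only [mem_image, mem_Ioi]
    constructor
    · rintro ⟨b, hb, rfl⟩; positivity
    · intro ht; exact ⟨1 / (4 * t), by positivity, by field_simp⟩
  conv_lhs => rw [← him]
  rw [lintegral_image_eq_lintegral_abs_deriv_mul (f' := fun b => -(1 / (4 * b ^ 2)))
    measurableSet_Ioi]
  · refine setLIntegral_congr_fun measurableSet_Ioi fun b _ => ?_
    rw [abs_neg, abs_of_nonneg (by positivity)]
  · intro b hb
    have hb' : (b : ℝ) ≠ 0 := (mem_Ioi.1 hb).ne'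
    have h := (hasDerivAt_inv hb').const_mul (1 / 4)
    refine HasDerivAt.hasDerivWithinAt ?_
    have e : (fun b : ℝ => 1 / (4 * b)) = fun b => 1 / 4 * b⁻¹ := by
      ext y; simp [mul_comm]
    rw [e]
    refine h.congr_deriv ?_
    ring
  · intro b hb c hc h
    have hb' : (b : ℝ) ≠ 0 := (mem_Ioi.1 hb).ne'
    have hc' : (c : ℝ) ≠ 0 := (mem_Ioi.1 hc).ne'
    dsimp only at h
    field_simp at h
    linarith

theorem lintegral_Ioi_comp_add (f : ℝ → ℝ≥0∞) (a : ℝ) :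
    ∫⁻ t in Ioi a, f t = ∫⁻ t in Ioi (0 : ℝ), f (t + a) := by
  have h := (measurePreserving_add_right (volume : Measure ℝ) a).setLIntegral_comp_preimage_emb
    (measurableEmbedding_addRight a) f (Ioi a)
  rw [← h]
  simp

theorem lintegral_Ioi_comp_mul (f : ℝ → ℝ≥0∞) {c : ℝ} (hc : 0 < c) :
    ∫⁻ t in Ioi (0 : ℝ), f t = ENNReal.ofReal c * ∫⁻ t in Ioi (0 : ℝ), f (c * t) := by
  have him : (fun b : ℝ => c * b) '' Ioi 0 = Ioi 0 := by
    ext t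
    simp only [mem_image, mem_Ioi]
    constructor
    · rintro ⟨b, hb, rfl⟩; positivity
    · intro ht; exact ⟨t / c, by positivity, by field_simp⟩
  conv_lhs => rw [← him]
  rw [lintegral_image_eq_lintegral_abs_deriv_mul (f' := fun _ => c) measurableSet_Ioi]
  · rw [abs_of_pos hc, lintegral_const_mul' _ _ ENNReal.ofReal_ne_top]
  · intro b hb
    simpa using ((hasDerivAt_id b).const_mul c).hasDerivWithinAt
  · intro b hb d hd h
    exact mul_left_cancel₀ hc.ne' h

theorem lintegral_Ioi_comp_sq (f : ℝ → ℝ≥0∞) :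
    ∫⁻ t in Ioi (0 : ℝ), f t = ∫⁻ t in Ioi (0 : ℝ), ENNReal.ofReal (2 * t) * f (t ^ 2) := by
  have him : (fun b : ℝ => b ^ 2) '' Ioi 0 = Ioi 0 := by
    ext t
    simp only [mem_image, mem_Ioi]
    constructor
    · rintro ⟨b, hb, rfl⟩; positivity
    · intro ht; exact ⟨√t, by positivity, Real.sq_sqrt ht.le⟩
  conv_lhs => rw [← him]
  rw [lintegral_image_eq_lintegral_abs_deriv_mul (f' := fun t => 2 * t) measurableSet_Ioi]
  · refine setLIntegral_congr_fun measurableSet_Ioi fun b hb => ?_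
    have : (0 : ℝ) < b := hb
    rw [abs_of_pos (by positivity)]
  · intro b hb
    simpa using (hasDerivAt_pow 2 b).hasDerivWithinAt
  · intro b hb d hd h
    exact (sq_eq_sq₀ (le_of_lt hb) (le_of_lt hd)).1 h

theorem lintegral_Ioi_eq_Ioo (f : ℝ → ℝ≥0∞) {t : ℝ} (ht : 0 < t) :
    ∫⁻ τ in Ioi (0 : ℝ), f τ =
      ∫⁻ ξ in Ioo (0 : ℝ) 1, ENNReal.ofReal (t / ξ ^ 2) * f (t / ξ - t) := by
  have him : (fun ξ : ℝ => t / ξ - t) '' Ioo 0 1 = Ioi 0 := by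
    ext τ
    simp only [mem_image, mem_Ioi, mem_Ioo]
    constructor
    · rintro ⟨b, ⟨hb, hb1⟩, rfl⟩
      have : t < t / b := by rw [lt_div_iff₀ hb]; nlinarith
      linarith
    · intro hτ
      refine ⟨t / (t + τ), ⟨by positivity, ?_⟩, by field_simp; ring⟩
      rw [div_lt_one (by positivity)]; linarith
  conv_lhs => rw [← him]
  rw [lintegral_image_eq_lintegral_abs_deriv_mul (f' := fun b => -(t / b ^ 2))
    measurableSet_Ioo]
  · refine setLIntegral_congr_fun measurableSet_Ioo fun b _ => ?_
    rw [abs_neg, abs_of_nonneg (by positivity)]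
  · intro b hb
    have hb' : (b : ℝ) ≠ 0 := hb.1.ne'
    have h := ((hasDerivAt_inv hb').const_mul t).sub_const t
    refine HasDerivAt.hasDerivWithinAt (h.congr_deriv ?_)
    ring
  · intro b hb c hc h
    have hb' : (b : ℝ) ≠ 0 := hb.1.ne'
    have hc' : (c : ℝ) ≠ 0 := hc.1.ne'
    dsimp only at h
    field_simp at h
    linarith

theorem lintegral_beta {a b : ℝ} (ha : 0 < a) (hb : 0 < b) :
    ∫⁻ ξ in Ioo (0 : ℝ) 1, ENNReal.ofReal (ξ ^ (a - 1) * (1 - ξ) ^ (b - 1)) =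
      ENNReal.ofReal (Real.Gamma a * Real.Gamma b / Real.Gamma (a + b)) := by
  have h := ProbabilityTheory.lintegral_betaPDF_eq_one ha hb
  have hB := ProbabilityTheory.beta_pos ha hb
  rw [ProbabilityTheory.lintegral_betaPDF] at h
  have : ∀ ξ : ℝ, ENNReal.ofReal (1 / ProbabilityTheory.beta a b * ξ ^ (a - 1) *
      (1 - ξ) ^ (b - 1)) = ENNReal.ofReal (1 / ProbabilityTheory.beta a b) *
      ENNReal.ofReal (ξ ^ (a - 1) * (1 - ξ) ^ (b - 1)) := fun ξ => by
    rw [mul_assoc, ENNReal.ofReal_mul (by positivity)]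
  simp_rw [this] at h
  rw [lintegral_const_mul' _ _ ENNReal.ofReal_ne_top] at h
  have h2 : ENNReal.ofReal (ProbabilityTheory.beta a b) *
      ENNReal.ofReal (1 / ProbabilityTheory.beta a b) = 1 := by
    rw [← ENNReal.ofReal_mul hB.le, mul_one_div_cancel hB.ne', ENNReal.ofReal_one]
  have h3 := congrArg (fun z => ENNReal.ofReal (ProbabilityTheory.beta a b) * z) h
  simp only [← mul_assoc, h2, one_mul, mul_one] at h3
  rw [h3, ProbabilityTheory.beta]

theorem lintegral_Ioi_rpow_div_one_add {s : ℝ} (hs : s ∈ Ioo (0 : ℝ) 1) :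
    ∫⁻ w in Ioi (0 : ℝ), ENNReal.ofReal (w ^ (s - 1) / (1 + w)) =
      ENNReal.ofReal (Real.Gamma s * Real.Gamma (1 - s)) := by
  have h := lintegral_beta (a := 1 - s) (b := s) (by linarith [hs.2]) hs.1
  rw [sub_add_cancel, Real.Gamma_one, div_one, mul_comm (Real.Gamma _)] at h
  rw [lintegral_Ioi_eq_Ioo _ one_pos, ← h]
  refine setLIntegral_congr_fun measurableSet_Ioo fun ξ hξ => ?_
  have h0 := hξ.1
  have h1 : 0 < 1 - ξ := by linarith [hξ.2]
  rw [← ENNReal.ofReal_mul (by positivity)]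
  congr 1
  have e1 : 1 / ξ - 1 = (1 - ξ) / ξ := by field_simp
  have e2 : 1 + (1 - ξ) / ξ = 1 / ξ := by field_simp; ring
  rw [e1, e2, Real.div_rpow h1.le h0.le, Real.rpow_sub_one h0.ne',
    show 1 - s - 1 = -s by ring, Real.rpow_neg h0.le]
  field_simp

theorem lintegral_Ioi_mul_lintegral_Ioi_add {a b g : ℝ → ℝ≥0∞} (ha : Measurable a)
    (hb : Measurable b) (hg : Measurable g) {δ : ℝ} :
    ∫⁻ τ in Ioi (0 : ℝ), a τ * ∫⁻ σ in Ioi δ, b σ * g (τ + σ) =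
      ∫⁻ T in Ioi δ, (∫⁻ σ in Ioo δ T, a (T - σ) * b σ) * g T := by
  have e1 : ∀ σ, ∫⁻ τ in Ioi (0 : ℝ), a τ * (b σ * g (τ + σ)) =
      ∫⁻ T in Ioi σ, a (T - σ) * b σ * g T := fun σ => by
    rw [lintegral_Ioi_comp_add _ σ]
    simp [mul_assoc]
  have e2 : ∀ T, (∫⁻ σ in Ioo δ T, a (T - σ) * b σ) * g T =
      ∫⁻ σ in Ioo δ T, a (T - σ) * b σ * g T := fun T => by
    rw [lintegral_mul_const _ (by fun_prop)]
  simp_rw [e2]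
  have e3 : ∀ τ, a τ * ∫⁻ σ in Ioi δ, b σ * g (τ + σ) =
      ∫⁻ σ in Ioi δ, a τ * (b σ * g (τ + σ)) := fun τ => by
    rw [lintegral_const_mul _ (by fun_prop)]
  simp_rw [e3]
  rw [lintegral_lintegral_swap (by fun_prop)]
  simp_rw [e1]
  have e4 : ∀ σ, ∫⁻ T in Ioi σ, a (T - σ) * b σ * g T =
      ∫⁻ T, (Ioi 0).indicator (fun x => a x) (T - σ) * b σ * g T := fun σ => by
    rw [← lintegral_indicator measurableSet_Ioi]
    congr 1; ext T
    simp only [indicator, mem_Ioi, sub_pos]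
    split_ifs <;> simp
  simp_rw [e4]
  have hai : Measurable ((Ioi (0:ℝ)).indicator (fun x => a x)) := ha.indicator measurableSet_Ioi
  rw [lintegral_lintegral_swap (by fun_prop), ← lintegral_indicator measurableSet_Ioi]
  congr 1; ext T
  simp only [indicator, mem_Ioi]
  split_ifs with h
  · rw [← lintegral_indicator measurableSet_Ioi, ← lintegral_indicator measurableSet_Ioo]
    congr 1; ext σ
    simp only [indicator, mem_Ioi, mem_Ioo, sub_pos]
    split_ifs with h1 h2 h3 h4 h5 <;> simp_all
  · rw [setLIntegral_congr_fun (g := fun _ => 0) measurableSet_Ioi, lintegral_zero]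
    intro σ hσ
    have : ¬ 0 < T - σ := by have : δ < σ := hσ; linarith
    simp [this]

/-- The Euclidean space of dimension `N`. -/
abbrev Eu (N : ℕ) := EuclideanSpace ℝ (Fin N)

/-- The heat kernel at time `t`. -/
noncomputable def hk (N : ℕ) (t : ℝ) (y : Eu N) : ℝ≥0∞ :=
  ENNReal.ofReal ((4 * Real.pi * t) ^ (-((N : ℝ) / 2)) * Real.exp (-(‖y‖ ^ 2 / (4 * t))))

@[fun_prop]
theorem measurable_hk {N : ℕ} {α : Type*} [MeasurableSpace α] {a : α → ℝ} {b : α → Eu N}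
    (ha : Measurable a) (hb : Measurable b) : Measurable fun x => hk N (a x) (b x) := by
  unfold hk
  fun_prop

/-- Convolution of nonnegative functions. -/
noncomputable def cv {N : ℕ} (k f : Eu N → ℝ≥0∞) (x : Eu N) : ℝ≥0∞ := ∫⁻ y, k (x - y) * f y

/-- A superposition of heat kernels. -/
noncomputable def mix (N : ℕ) (S : Set ℝ) (a : ℝ → ℝ≥0∞) (y : Eu N) : ℝ≥0∞ :=
  ∫⁻ τ in S, a τ * hk N τ y

theorem measurable_mix {N : ℕ} {S : Set ℝ} {a : ℝ → ℝ≥0∞} (ha : Measurable a) :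
    Measurable (mix N S a) := by
  unfold mix
  exact Measurable.lintegral_prod_right' (f := fun q : Eu N × ℝ => a q.2 * hk N q.2 q.1)
    (by fun_prop)

theorem measurable_cv {N : ℕ} {k f : Eu N → ℝ≥0∞} (hk : Measurable k) (hf : Measurable f) :
    Measurable (cv k f) := by
  unfold cv
  exact Measurable.lintegral_prod_right' (f := fun q : Eu N × Eu N => k (q.1 - q.2) * f q.2)
    (by fun_prop)

theorem measurable_cv_hk {N : ℕ} {f : Eu N → ℝ≥0∞} (hf : Measurable f) (x : Eu N) :
    Measurable fun t => cv (hk N t) f x := by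
  unfold cv
  exact Measurable.lintegral_prod_right' (f := fun q : ℝ × Eu N => hk N q.1 (x - q.2) * f q.2)
    (by fun_prop)

theorem cv_cv {N : ℕ} {k l f : Eu N → ℝ≥0∞} (hk : Measurable k) (hl : Measurable l)
    (hf : Measurable f) (x : Eu N) : cv k (cv l f) x = cv (cv k l) f x := by
  unfold cv
  have e1 : ∀ y, k (x - y) * ∫⁻ z, l (y - z) * f z = ∫⁻ z, k (x - y) * (l (y - z) * f z) :=
    fun y => by rw [lintegral_const_mul _ (by fun_prop)]
  have e2 : ∀ z, (∫⁻ y, k (x - z - y) * l y) * f z = ∫⁻ y, k (x - y) * (l (y - z) * f z) :=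
    fun z => by
      rw [← lintegral_mul_const _ (by fun_prop),
        ← lintegral_sub_right_eq_self (fun y => k (x - z - y) * l y * f z) z]
      refine lintegral_congr fun y => ?_
      rw [sub_sub_sub_cancel_right, mul_assoc]
  simp_rw [e1, e2]
  exact lintegral_lintegral_swap (by fun_prop)

theorem cv_mix {N : ℕ} {S : Set ℝ} {a : ℝ → ℝ≥0∞} (ha : Measurable a) {f : Eu N → ℝ≥0∞}
    (hf : Measurable f) (x : Eu N) :
    cv (mix N S a) f x = ∫⁻ τ in S, a τ * cv (hk N τ) f x := by
  unfold cv mix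
  have e1 : ∀ y, (∫⁻ τ in S, a τ * hk N τ (x - y)) * f y =
      ∫⁻ τ in S, a τ * (hk N τ (x - y) * f y) := fun y => by
    rw [← lintegral_mul_const _ (by fun_prop)]
    simp_rw [mul_assoc]
  have e2 : ∀ τ, a τ * (∫⁻ y, hk N τ (x - y) * f y) = ∫⁻ y, a τ * (hk N τ (x - y) * f y) :=
    fun τ => by rw [lintegral_const_mul _ (by fun_prop)]
  simp_rw [e1, e2]
  exact lintegral_lintegral_swap (by fun_prop)

theorem cv_comm {N : ℕ} (k f : Eu N → ℝ≥0∞) (x : Eu N) : cv k f x = cv f k x := by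
  unfold cv
  rw [← lintegral_sub_left_eq_self _ x]
  simp [mul_comm]

theorem lintegral_exp_sq {N : ℕ} {b : ℝ} (hb : 0 < b) (c : Eu N) :
    ∫⁻ y : Eu N, ENNReal.ofReal (Real.exp (-(b * ‖y - c‖ ^ 2))) =
      ENNReal.ofReal ((Real.pi / b) ^ ((N : ℝ) / 2)) := by
  rw [lintegral_sub_right_eq_self (fun y => ENNReal.ofReal (Real.exp (-(b * ‖y‖ ^ 2)))) c]
  have h := GaussianFourier.integral_rexp_neg_mul_sq_norm (V := Eu N) hb
  simp only [finrank_euclideanSpace, Fintype.card_fin, neg_mul] at h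
  rw [← h, ofReal_integral_eq_lintegral_ofReal]
  · by_contra hcon
    rw [integral_undef hcon] at h
    exact (Real.rpow_pos_of_pos (by positivity) _).ne h
  · exact Eventually.of_forall fun _ => (Real.exp_pos _).le

theorem lintegral_hk {N : ℕ} {t : ℝ} (ht : 0 < t) : ∫⁻ y : Eu N, hk N t y = 1 := by
  unfold hk
  have h := lintegral_exp_sq (b := 1 / (4 * t)) (by positivity) (0 : Eu N)
  simp_rw [ENNReal.ofReal_mul (show 0 ≤ (4 * Real.pi * t) ^ (-((N : ℝ) / 2)) by positivity)]
  rw [lintegral_const_mul' _ _ ENNReal.ofReal_ne_top]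
  have e : ∀ y : Eu N, ‖y‖ ^ 2 / (4 * t) = 1 / (4 * t) * ‖y - 0‖ ^ 2 := fun y => by
    rw [sub_zero]; ring
  simp_rw [e]
  rw [h, ← ENNReal.ofReal_mul (by positivity), Real.rpow_neg (by positivity),
    show Real.pi / (1 / (4 * t)) = 4 * Real.pi * t by field_simp,
    inv_mul_cancel₀ (Real.rpow_pos_of_pos (by positivity) _).ne', ENNReal.ofReal_one]

theorem cv_hk_hk {N : ℕ} {t s : ℝ} (ht : 0 < t) (hs : 0 < s) (x : Eu N) :
    cv (hk N t) (hk N s) x = hk N (t + s) x := by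
  unfold cv hk
  set A := (4 * Real.pi * t) ^ (-((N : ℝ) / 2)) * (4 * Real.pi * s) ^ (-((N : ℝ) / 2)) *
    Real.exp (-(‖x‖ ^ 2 / (4 * (t + s)))) with hA
  have hA0 : 0 ≤ A := by positivity
  have e : ∀ y : Eu N,
      ENNReal.ofReal ((4 * Real.pi * t) ^ (-((N : ℝ) / 2)) *
        Real.exp (-(‖x - y‖ ^ 2 / (4 * t)))) *
      ENNReal.ofReal ((4 * Real.pi * s) ^ (-((N : ℝ) / 2)) * Real.exp (-(‖y‖ ^ 2 / (4 * s)))) =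
      ENNReal.ofReal A * ENNReal.ofReal
        (Real.exp (-((t + s) / (4 * t * s) * ‖y - (s / (t + s)) • x‖ ^ 2))) := fun y => by
    rw [← ENNReal.ofReal_mul (by positivity), ← ENNReal.ofReal_mul hA0, hA]
    congr 1
    have : Real.exp (-(‖x - y‖ ^ 2 / (4 * t))) * Real.exp (-(‖y‖ ^ 2 / (4 * s))) =
        Real.exp (-(‖x‖ ^ 2 / (4 * (t + s)))) *
        Real.exp (-((t + s) / (4 * t * s) * ‖y - (s / (t + s)) • x‖ ^ 2)) := by
      rw [← Real.exp_add, ← Real.exp_add]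
      congr 1
      rw [norm_sub_sq_real, norm_sub_sq_real, inner_smul_right, norm_smul, mul_pow,
        Real.norm_eq_abs, sq_abs, real_inner_comm]
      field_simp
      ring
    linear_combination (4 * Real.pi * t) ^ (-((N : ℝ) / 2)) *
      (4 * Real.pi * s) ^ (-((N : ℝ) / 2)) * this
  simp_rw [e]
  rw [lintegral_const_mul' _ _ ENNReal.ofReal_ne_top, lintegral_exp_sq (by positivity),
    ← ENNReal.ofReal_mul hA0, hA]
  congr 1
  rw [mul_right_comm, ← Real.mul_rpow (by positivity) (by positivity),
    Real.rpow_neg (by positivity), Real.rpow_neg (by positivity), ← Real.inv_rpow (by positivity),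
    ← Real.mul_rpow (by positivity) (by positivity), ← Real.inv_rpow (by positivity)]
  congr 2
  field_simp

theorem lintegral_norm_sq {N : ℕ} (hN : 2 ≤ N) {f : ℝ → ℝ≥0∞} (hf : Measurable f) :
    ∫⁻ y : Eu N, f (‖y‖ ^ 2) = ENNReal.ofReal (Real.pi ^ ((N : ℝ) / 2) / Real.Gamma ((N : ℝ) / 2)) *
      ∫⁻ v in Ioi (0 : ℝ), ENNReal.ofReal (v ^ ((N : ℝ) / 2 - 1)) * f v := by
  have : Nontrivial (Eu N) := by
    have : Nonempty (Fin N) := ⟨⟨0, by omega⟩⟩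
    infer_instance
  have hN0 : (0 : ℝ) < N := by positivity
  have step1 : ∫⁻ y : Eu N, f (‖y‖ ^ 2) =
      (volume : Measure (Eu N)).toSphere univ *
        ∫⁻ ρ in Ioi (0 : ℝ), ENNReal.ofReal (ρ ^ (N - 1)) * f (ρ ^ 2) := by
    calc ∫⁻ y : Eu N, f (‖y‖ ^ 2)
        = ∫⁻ y : ({(0)}ᶜ : Set (Eu N)), f (‖y.1‖ ^ 2) ∂(volume.comap
            (Subtype.val : ({(0)}ᶜ : Set (Eu N)) → Eu N)) := by
          rw [lintegral_subtype_comap (measurableSet_singleton _).compl fun x => f (‖x‖ ^ 2),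
            Measure.restrict_eq_self_of_ae_mem (by simp [ae_iff])]
      _ = ∫⁻ q : Metric.sphere (0 : Eu N) 1 × Ioi (0 : ℝ), f (q.2.1 ^ 2)
          ∂((volume : Measure (Eu N)).toSphere.prod
            (.volumeIoiPow (Module.finrank ℝ (Eu N) - 1))) := by
          have := ((volume :
            Measure (Eu N)).measurePreserving_homeomorphUnitSphereProd).lintegral_comp_emb
            (Homeomorph.measurableEmbedding _)
            (fun q : Metric.sphere (0 : Eu N) 1 × Ioi (0 : ℝ) => f (q.2.1 ^ 2))
          simpa using this
      _ = _ := by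
          rw [lintegral_prod _ (by fun_prop)]
          dsimp only
          rw [lintegral_const, mul_comm]
          congr 1
          rw [Measure.volumeIoiPow, lintegral_withDensity_eq_lintegral_mul _ (by fun_prop)
            (by fun_prop)]
          simp only [Pi.mul_apply, finrank_euclideanSpace, Fintype.card_fin]
          exact lintegral_subtype_comap measurableSet_Ioi
            (fun ρ => ENNReal.ofReal (ρ ^ (N - 1)) * f (ρ ^ 2))
  have hS : (volume : Measure (Eu N)).toSphere univ =
      ENNReal.ofReal (2 * (Real.pi ^ ((N : ℝ) / 2) / Real.Gamma ((N : ℝ) / 2))) := by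
    have : Nonempty (Fin N) := ⟨⟨0, by omega⟩⟩
    rw [Measure.toSphere_apply_univ, EuclideanSpace.volume_ball]
    simp only [finrank_euclideanSpace, Fintype.card_fin, ENNReal.ofReal_one, one_pow, one_mul]
    rw [← ENNReal.ofReal_natCast, ← ENNReal.ofReal_mul (by positivity),
      Real.Gamma_add_one (by positivity), Real.sqrt_eq_rpow, ← Real.rpow_natCast,
      ← Real.rpow_mul Real.pi_pos.le]
    congr 1
    have : Real.Gamma ((N : ℝ) / 2) ≠ 0 := (Real.Gamma_pos_of_pos (by positivity)).ne'
    rw [show (1 / 2 : ℝ) * N = N / 2 by ring]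
    field_simp
  rw [step1, hS,
    lintegral_Ioi_comp_sq (fun v => ENNReal.ofReal (v ^ ((N : ℝ) / 2 - 1)) * f v),
    ENNReal.ofReal_mul two_pos.le, mul_comm (ENNReal.ofReal 2),
    mul_assoc]
  congr 1
  rw [← lintegral_const_mul' _ _ ENNReal.ofReal_ne_top]
  refine setLIntegral_congr_fun measurableSet_Ioi fun ρ hρ => ?_
  have h0 : (0 : ℝ) < ρ := hρ
  rw [← mul_assoc, ← mul_assoc, ← ENNReal.ofReal_mul (by positivity),
    ← ENNReal.ofReal_mul (by positivity)]
  congr 2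
  rw [← Real.rpow_natCast ρ 2, ← Real.rpow_mul h0.le, mul_assoc, ← Real.rpow_one_add' h0.le,
    ← Real.rpow_natCast]
  · congr 2
    push_cast [show 1 ≤ N by omega]
    ring
  · have : (2 : ℝ) ≤ N := by exact_mod_cast hN
    push_cast
    linarith

/-- The time weight whose heat superposition is the Riesz kernel. -/
noncomputable def rieszW (s τ : ℝ) : ℝ≥0∞ := ENNReal.ofReal (τ ^ (s - 1) / Real.Gamma s)

/-- The time weight whose heat superposition is the kernel of the fractional Laplacian. -/
noncomputable def levyW (s τ : ℝ) : ℝ≥0∞ :=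
  ENNReal.ofReal (s / Real.Gamma (1 - s) * τ ^ (-1 - s))

/-- The time weight of the approximate identity attached to the truncated kernel. -/
noncomputable def thetaW (s δ T : ℝ) : ℝ≥0∞ :=
  ENNReal.ofReal (δ ^ (-s) / (Real.Gamma s * Real.Gamma (1 - s)) *
    ((T ^ s - (max (T - δ) 0) ^ s) / T))

@[fun_prop]
theorem measurable_rieszW (s : ℝ) : Measurable (rieszW s) := by
  unfold rieszW; fun_prop

@[fun_prop]
theorem measurable_levyW (s : ℝ) : Measurable (levyW s) := by
  unfold levyW; fun_prop

@[fun_prop]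
theorem measurable_thetaW (s δ : ℝ) : Measurable (thetaW s δ) := by
  unfold thetaW; fun_prop

theorem lintegral_levyW {s : ℝ} (hs : s ∈ Ioo (0 : ℝ) 1) {δ : ℝ} (hδ : 0 < δ) :
    ∫⁻ τ in Ioi δ, levyW s τ = ENNReal.ofReal (δ ^ (-s) / Real.Gamma (1 - s)) := by
  have hG : 0 < Real.Gamma (1 - s) := Real.Gamma_pos_of_pos (by linarith [hs.2])
  have hlt : -1 - s < -1 := by linarith [hs.1]
  unfold levyW
  rw [← ofReal_integral_eq_lintegral_ofReal]
  · rw [integral_const_mul, integral_Ioi_rpow_of_lt hlt hδ]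
    congr 1
    rw [show -1 - s + 1 = -s by ring]
    have := hs.1.ne'
    field_simp
  · exact (integrableOn_Ioi_rpow_of_lt hlt hδ).const_mul _
  · filter_upwards [ae_restrict_mem measurableSet_Ioi] with τ hτ
    have : 0 < τ := hδ.trans hτ
    have := hs.1
    positivity

theorem lintegral_rpow_mul_rpow {s : ℝ} (hs : s ∈ Ioo (0 : ℝ) 1) {δ T : ℝ} (hδ : 0 < δ)
    (hT : δ < T) :
    ∫⁻ σ in Ioo δ T, ENNReal.ofReal ((T - σ) ^ (s - 1) * σ ^ (-1 - s)) =
      ENNReal.ofReal (δ ^ (-s) * (T - δ) ^ s / (s * T)) := by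
  have hT0 : 0 < T := hδ.trans hT
  have hs0 := hs.1
  set F : ℝ → ℝ := fun σ => -((T - σ) ^ s * σ ^ (-s) / (s * T)) with hF
  have hcont : ContinuousOn F (Icc δ T) := by
    intro σ hσ
    have hσ0 : σ ≠ 0 := (hδ.trans_le hσ.1).ne'
    apply ContinuousAt.continuousWithinAt
    refine (ContinuousAt.div_const (ContinuousAt.mul ?_ ?_) _).neg
    · exact ContinuousAt.rpow_const (by fun_prop) (Or.inr hs0.le)
    · exact ContinuousAt.rpow_const (by fun_prop) (Or.inl hσ0)
  have hderiv : ∀ σ ∈ Ioo δ T, HasDerivAt F ((T - σ) ^ (s - 1) * σ ^ (-1 - s)) σ := by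
    intro σ hσ
    have hσ0 : 0 < σ := hδ.trans hσ.1
    have hTσ : 0 < T - σ := by linarith [hσ.2]
    have d1 : HasDerivAt (fun σ => (T - σ) ^ s) ((-1) * s * (T - σ) ^ (s - 1)) σ :=
      ((hasDerivAt_id σ).const_sub T).rpow_const (Or.inl hTσ.ne')
    have d2 : HasDerivAt (fun σ : ℝ => σ ^ (-s)) (1 * -s * σ ^ (-s - 1)) σ :=
      (hasDerivAt_id σ).rpow_const (Or.inl hσ0.ne')
    refine ((d1.mul d2).div_const (s * T)).neg.congr_deriv ?_
    have e1 : (T - σ) ^ s = (T - σ) ^ (s - 1) * (T - σ) := by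
      rw [← Real.rpow_add_one hTσ.ne']; ring_nf
    have e2 : σ ^ (-s) = σ ^ (-1 - s) * σ := by
      rw [← Real.rpow_add_one hσ0.ne']; ring_nf
    rw [e1, e2, show -s - 1 = -1 - s by ring]
    field_simp
    ring
  have hpos : ∀ σ ∈ Ioo δ T, 0 ≤ (T - σ) ^ (s - 1) * σ ^ (-1 - s) := by
    intro σ hσ
    have hσ0 : 0 < σ := hδ.trans hσ.1
    have hTσ : 0 < T - σ := by linarith [hσ.2]
    positivity
  have hint := intervalIntegral.integrableOn_deriv_of_nonneg hcont hderiv hpos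
  rw [← ofReal_integral_eq_lintegral_ofReal (hint.mono_set Ioo_subset_Ioc_self)
    ((ae_restrict_mem measurableSet_Ioo).mono hpos), ← integral_Ioc_eq_integral_Ioo,
    ← intervalIntegral.integral_of_le hT.le,
    intervalIntegral.integral_eq_sub_of_hasDerivAt_of_le hT.le hcont hderiv
      ((intervalIntegrable_iff_integrableOn_Ioc_of_le hT.le).2 hint)]
  congr 1
  simp only [hF, sub_self, Real.zero_rpow hs0.ne']
  ring

theorem cv_rieszW_levyW {N : ℕ} {s : ℝ} (hs : s ∈ Ioo (0 : ℝ) 1) {δ : ℝ} (hδ : 0 < δ)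
    {f : Eu N → ℝ≥0∞} (hf : Measurable f) (x : Eu N) :
    cv (mix N (Ioi 0) (rieszW s)) (cv (mix N (Ioi δ) (levyW s)) f) x +
        cv (mix N (Ioi 0) (thetaW s δ)) f x =
      ENNReal.ofReal (δ ^ (-s) / Real.Gamma (1 - s)) *
        cv (mix N (Ioi 0) (rieszW s)) f x := by
  have hG1 : 0 < Real.Gamma (1 - s) := Real.Gamma_pos_of_pos (by linarith [hs.2])
  have hG : 0 < Real.Gamma s := Real.Gamma_pos_of_pos hs.1
  have hs0 := hs.1
  have mk := measurable_mix (N := N) (S := Ioi δ) (measurable_levyW s)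
  have mh : ∀ t, Measurable (hk N t) := fun t => by fun_prop
  set g : ℝ → ℝ≥0∞ := fun t => cv (hk N t) f x with hg
  have mg : Measurable g := measurable_cv_hk hf x
  have e1 : cv (mix N (Ioi 0) (rieszW s)) (cv (mix N (Ioi δ) (levyW s)) f) x =
      ∫⁻ τ in Ioi 0, rieszW s τ * ∫⁻ σ in Ioi δ, levyW s σ * g (τ + σ) := by
    rw [cv_mix (by fun_prop) (measurable_cv mk hf)]
    refine setLIntegral_congr_fun measurableSet_Ioi fun τ hτ => ?_
    congr 1
    rw [cv_cv (mh τ) mk hf, funext (cv_comm (hk N τ) (mix N (Ioi δ) (levyW s))),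
      ← cv_cv mk (mh τ) hf, cv_mix (by fun_prop) (measurable_cv (mh τ) hf)]
    refine setLIntegral_congr_fun measurableSet_Ioi fun σ hσ => ?_
    rw [cv_cv (mh σ) (mh τ) hf, funext (cv_hk_hk (hδ.trans hσ) hτ), hg, add_comm σ τ]
  have e2 : ∀ T ∈ Ioi δ, (∫⁻ σ in Ioo δ T, rieszW s (T - σ) * levyW s σ) =
      ENNReal.ofReal (δ ^ (-s) / (Real.Gamma s * Real.Gamma (1 - s)) * ((T - δ) ^ s / T)) := by
    intro T hT
    have hT' : δ < T := hT
    have hT0 : 0 < T := hδ.trans hT'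
    have : ∀ σ ∈ Ioo δ T, rieszW s (T - σ) * levyW s σ =
        ENNReal.ofReal (s / (Real.Gamma s * Real.Gamma (1 - s))) *
          ENNReal.ofReal ((T - σ) ^ (s - 1) * σ ^ (-1 - s)) := by
      intro σ hσ
      have : 0 < T - σ := by linarith [hσ.2]
      unfold rieszW levyW
      rw [← ENNReal.ofReal_mul (by positivity), ← ENNReal.ofReal_mul (by positivity)]
      congr 1
      field_simp
    rw [setLIntegral_congr_fun measurableSet_Ioo this, lintegral_const_mul' _ _ ofReal_ne_top,
      lintegral_rpow_mul_rpow hs hδ hT', ← ENNReal.ofReal_mul (by positivity)]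
    congr 1
    field_simp
  rw [e1, lintegral_Ioi_mul_lintegral_Ioi_add (by fun_prop) (by fun_prop) mg,
    cv_mix (by fun_prop) hf, cv_mix (by fun_prop) hf,
    setLIntegral_congr_fun measurableSet_Ioi (fun T hT => by rw [e2 T hT])]
  rw [← lintegral_const_mul' _ _ ofReal_ne_top]
  have hsub : Ioi δ ⊆ Ioi (0 : ℝ) := Ioi_subset_Ioi hδ.le
  have e3 : ∫⁻ T in Ioi δ, ENNReal.ofReal
        (δ ^ (-s) / (Real.Gamma s * Real.Gamma (1 - s)) * ((T - δ) ^ s / T)) * g T =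
      ∫⁻ T in Ioi 0, ENNReal.ofReal
        (δ ^ (-s) / (Real.Gamma s * Real.Gamma (1 - s)) * ((max (T - δ) 0) ^ s / T)) * g T := by
    have : ∀ T ∈ Ioi δ, ENNReal.ofReal
        (δ ^ (-s) / (Real.Gamma s * Real.Gamma (1 - s)) * ((T - δ) ^ s / T)) * g T =
        ENNReal.ofReal
        (δ ^ (-s) / (Real.Gamma s * Real.Gamma (1 - s)) * ((max (T - δ) 0) ^ s / T)) * g T := by
      intro T hT
      rw [max_eq_left (sub_nonneg.2 (le_of_lt hT))]
    rw [setLIntegral_congr_fun measurableSet_Ioi this]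
    rw [← lintegral_indicator measurableSet_Ioi, ← lintegral_indicator measurableSet_Ioi]
    congr 1
    ext T
    by_cases hT : δ < T
    · rw [indicator_of_mem (show T ∈ Ioi δ from hT),
        indicator_of_mem (show T ∈ Ioi (0 : ℝ) from hsub hT)]
    · rw [indicator_of_notMem (show T ∉ Ioi δ from hT)]
      by_cases hT0 : 0 < T
      · rw [indicator_of_mem (show T ∈ Ioi (0 : ℝ) from hT0),
          max_eq_right (by linarith [not_lt.1 hT]), Real.zero_rpow hs0.ne']
        simp
      · rw [indicator_of_notMem (show T ∉ Ioi (0 : ℝ) from hT0)]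
  rw [e3, ← lintegral_add_left (by fun_prop)]
  refine setLIntegral_congr_fun measurableSet_Ioi fun T hT => ?_
  have hT0 : (0 : ℝ) < T := hT
  have hmono : (max (T - δ) 0) ^ s ≤ T ^ s :=
    Real.rpow_le_rpow (le_max_right _ _) (max_le (by linarith) hT0.le) hs0.le
  have hmax : 0 ≤ max (T - δ) 0 := le_max_right _ _
  dsimp only [rieszW, thetaW]
  rw [← add_mul, ← ENNReal.ofReal_add (by positivity)
    (mul_nonneg (by positivity) (div_nonneg (by linarith) hT0.le)), ← mul_assoc,
    ← ENNReal.ofReal_mul (by positivity)]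
  congr 2
  rw [Real.rpow_sub_one hT0.ne']
  field_simp
  ring

theorem lintegral_thetaW {s : ℝ} (hs : s ∈ Ioo (0 : ℝ) 1) {δ : ℝ} (hδ : 0 < δ) :
    ∫⁻ T in Ioi 0, thetaW s δ T = 1 := by
  have hG1 : 0 < Real.Gamma (1 - s) := Real.Gamma_pos_of_pos (by linarith [hs.2])
  have hG : 0 < Real.Gamma s := Real.Gamma_pos_of_pos hs.1
  have hs0 := hs.1
  set φ : ℝ → ℝ≥0∞ := (Ioo 0 δ).indicator 1 with hφ
  have mφ : Measurable φ := measurable_one.indicator measurableSet_Ioo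
  have e1 : ∀ T ∈ Ioi (0 : ℝ), thetaW s δ T =
      ENNReal.ofReal (s * δ ^ (-s) / (Real.Gamma s * Real.Gamma (1 - s))) *
      ∫⁻ b in Ioi 0, φ (T - b) * ENNReal.ofReal (b ^ (s - 1) / T) := by
    intro T hT
    have hT0 : (0 : ℝ) < T := hT
    set m := max (T - δ) 0 with hm
    have hm0 : 0 ≤ m := le_max_right _ _
    have hmT : m ≤ T := max_le (by linarith) hT0.le
    have e : ∫⁻ b in Ioi 0, φ (T - b) * ENNReal.ofReal (b ^ (s - 1) / T) =
        ∫⁻ b in Ioo m T, ENNReal.ofReal (b ^ (s - 1) / T) := by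
      rw [← lintegral_indicator measurableSet_Ioi, ← lintegral_indicator measurableSet_Ioo]
      congr 1
      ext b
      have : b ∈ Ioo m T ↔ b ∈ Ioi (0 : ℝ) ∧ T - b ∈ Ioo 0 δ := by
        simp only [mem_Ioo, hm, max_lt_iff, mem_Ioi]
        constructor
        · rintro ⟨⟨h1, h2⟩, h3⟩
          exact ⟨h2, by linarith, by linarith⟩
        · rintro ⟨h1, h2, h3⟩
          exact ⟨⟨by linarith, h1⟩, by linarith⟩
      by_cases hb : b ∈ Ioo m T
      · obtain ⟨h1, h2⟩ := this.1 hb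
        rw [indicator_of_mem h1, indicator_of_mem hb, hφ, indicator_of_mem h2]
        simp
      · rw [indicator_of_notMem hb]
        by_cases h1 : b ∈ Ioi (0 : ℝ)
        · rw [indicator_of_mem h1, hφ, indicator_of_notMem fun h2 => hb (this.2 ⟨h1, h2⟩)]
          simp
        · rw [indicator_of_notMem h1]
    have hi : IntervalIntegrable (fun b : ℝ => b ^ (s - 1)) volume m T :=
      intervalIntegral.intervalIntegrable_rpow' (by linarith)
    rw [e, ← ofReal_integral_eq_lintegral_ofReal, ← ENNReal.ofReal_mul (by positivity)]
    · rw [← integral_Ioc_eq_integral_Ioo, ← intervalIntegral.integral_of_le hmT,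
        intervalIntegral.integral_div, integral_rpow (Or.inl (by linarith)), thetaW,
        sub_add_cancel]
      congr 1
      field_simp
      rw [hm]
    · exact (((intervalIntegrable_iff_integrableOn_Ioc_of_le hmT).1 hi).mono_set
        Ioo_subset_Ioc_self).div_const _
    · filter_upwards [ae_restrict_mem measurableSet_Ioo] with b hb
      have : 0 < b := hm0.trans_lt hb.1
      positivity
  have e2 : ∀ b ∈ Ioi (0 : ℝ),
      ∫⁻ T in Ioi 0, φ (T - b) * ENNReal.ofReal (b ^ (s - 1) / T) =
        ∫⁻ a in Ioo 0 δ, ENNReal.ofReal (b ^ (s - 1) / (a + b)) := by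
    intro b hb
    have hb0 : (0 : ℝ) < b := hb
    calc ∫⁻ T in Ioi 0, φ (T - b) * ENNReal.ofReal (b ^ (s - 1) / T)
        = ∫⁻ T, φ (T - b) * ENNReal.ofReal (b ^ (s - 1) / T) := by
          rw [← lintegral_indicator measurableSet_Ioi]
          congr 1
          ext T
          by_cases hT : T ∈ Ioi (0 : ℝ)
          · rw [indicator_of_mem hT]
          · rw [indicator_of_notMem hT, hφ, indicator_of_notMem, zero_mul]
            intro h
            exact hT (by linarith [h.1] : (0 : ℝ) < T)
      _ = ∫⁻ a, φ a * ENNReal.ofReal (b ^ (s - 1) / (a + b)) := by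
          rw [← lintegral_sub_right_eq_self
            (fun a => φ a * ENNReal.ofReal (b ^ (s - 1) / (a + b))) b]
          simp
      _ = _ := by
          rw [← lintegral_indicator measurableSet_Ioo]
          congr 1
          ext a
          by_cases ha : a ∈ Ioo 0 δ
          · simp [hφ, ha]
          · simp [hφ, ha]
  have e3 : ∀ a ∈ Ioo (0 : ℝ) δ, ∫⁻ b in Ioi 0, ENNReal.ofReal (b ^ (s - 1) / (a + b)) =
      ENNReal.ofReal (Real.Gamma s * Real.Gamma (1 - s)) * ENNReal.ofReal (a ^ (s - 1)) := by
    intro a ha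
    have ha0 := ha.1
    rw [lintegral_Ioi_comp_mul _ ha.1, ← lintegral_Ioi_rpow_div_one_add hs,
      mul_comm _ (ENNReal.ofReal (a ^ (s - 1))),
      ← lintegral_const_mul' _ _ ofReal_ne_top, ← lintegral_const_mul' _ _ ofReal_ne_top]
    refine setLIntegral_congr_fun measurableSet_Ioi fun w hw => ?_
    have hw0 : (0 : ℝ) < w := hw
    rw [← ENNReal.ofReal_mul (by positivity), ← ENNReal.ofReal_mul (by positivity),
      Real.mul_rpow ha0.le hw0.le]
    congr 1
    field_simp
  have e4 : ∫⁻ a in Ioo 0 δ, ENNReal.ofReal (a ^ (s - 1)) = ENNReal.ofReal (δ ^ s / s) := by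
    have hi : IntervalIntegrable (fun b : ℝ => b ^ (s - 1)) volume 0 δ :=
      intervalIntegral.intervalIntegrable_rpow' (by linarith)
    rw [← ofReal_integral_eq_lintegral_ofReal]
    · rw [← integral_Ioc_eq_integral_Ioo, ← intervalIntegral.integral_of_le hδ.le,
        integral_rpow (Or.inl (by linarith)), sub_add_cancel, Real.zero_rpow hs0.ne', sub_zero]
    · exact ((intervalIntegrable_iff_integrableOn_Ioc_of_le hδ.le).1 hi).mono_set
        Ioo_subset_Ioc_self
    · filter_upwards [ae_restrict_mem measurableSet_Ioo] with b hb
      have : 0 < b := hb.1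
      positivity
  rw [setLIntegral_congr_fun measurableSet_Ioi e1, lintegral_const_mul' _ _ ofReal_ne_top,
    lintegral_lintegral_swap (by fun_prop), setLIntegral_congr_fun measurableSet_Ioi e2,
    lintegral_lintegral_swap (by fun_prop), setLIntegral_congr_fun measurableSet_Ioo e3,
    lintegral_const_mul' _ _ ofReal_ne_top, e4, ← ENNReal.ofReal_mul (by positivity),
    ← ENNReal.ofReal_mul (by positivity), ← ENNReal.ofReal_one, Real.rpow_neg hδ.le]
  congr 1
  have := (Real.rpow_pos_of_pos hδ s).ne'
  field_simp

/-- The exterior kernel `eta` with values in `[0,∞]`. -/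
noncomputable def etaE (N : ℕ) (s r : ℝ) (y : Eu N) : ℝ≥0∞ := ENNReal.ofReal (eta N s r y)

/-- The Green function of the ball of radius `r` with pole at the centre. -/
noncomputable def green (N : ℕ) (s r : ℝ) (y : Eu N) : ℝ≥0∞ :=
  ENNReal.ofReal (Real.Gamma ((N : ℝ) / 2) /
      (4 ^ s * Real.pi ^ ((N : ℝ) / 2) * Real.Gamma s ^ 2)) *
    ∫⁻ v in Ioo (‖y‖ ^ 2) (r ^ 2),
      ENNReal.ofReal (v ^ (-((N : ℝ) / 2)) * (v - ‖y‖ ^ 2) ^ (s - 1))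

theorem lintegral_Ioo_comp_mul (f : ℝ → ℝ≥0∞) {c : ℝ} (hc : 0 < c) :
    ∫⁻ t in Ioo 0 c, f t = ENNReal.ofReal c * ∫⁻ t in Ioo 0 1, f (c * t) := by
  have h := lintegral_Ioi_comp_mul ((Ioo 0 c).indicator f) hc
  have e : ∀ t, (Ioo 0 c).indicator f (c * t) = (Ioo 0 1).indicator (fun t => f (c * t)) t := by
    intro t
    have : c * t ∈ Ioo 0 c ↔ t ∈ Ioo (0 : ℝ) 1 := by
      simp [mem_Ioo, mul_pos_iff_of_pos_left hc, mul_lt_iff_lt_one_right hc]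
    by_cases ht : t ∈ Ioo (0 : ℝ) 1
    · rw [indicator_of_mem ht, indicator_of_mem (this.2 ht)]
    · rw [indicator_of_notMem ht, indicator_of_notMem (fun h => ht (this.1 h))]
  simp_rw [e] at h
  rwa [setLIntegral_indicator measurableSet_Ioo, setLIntegral_indicator measurableSet_Ioo,
    inter_eq_left.2 Ioo_subset_Ioi_self, inter_eq_left.2 Ioo_subset_Ioi_self] at h

theorem lintegral_Ioi_comp_mul' (f : ℝ → ℝ≥0∞) {c : ℝ} (hc : 0 < c) {a : ℝ} (ha : 0 ≤ a) :
    ∫⁻ t in Ioi (c * a), f t = ENNReal.ofReal c * ∫⁻ t in Ioi a, f (c * t) := by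
  have h := lintegral_Ioi_comp_mul ((Ioi (c * a)).indicator f) hc
  have e : ∀ t, (Ioi (c * a)).indicator f (c * t) = (Ioi a).indicator (fun t => f (c * t)) t := by
    intro t
    have : c * t ∈ Ioi (c * a) ↔ t ∈ Ioi a := by
      simp [mem_Ioi, mul_lt_mul_iff_right₀ hc]
    by_cases ht : t ∈ Ioi a
    · rw [indicator_of_mem ht, indicator_of_mem (this.2 ht)]
    · rw [indicator_of_notMem ht, indicator_of_notMem (fun h => ht (this.1 h))]
  simp_rw [e] at h
  rwa [setLIntegral_indicator measurableSet_Ioi, setLIntegral_indicator measurableSet_Ioi,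
    inter_eq_left.2 (Ioi_subset_Ioi (by positivity)), inter_eq_left.2 (Ioi_subset_Ioi ha)] at h

theorem lintegral_Ioi_exp {a v : ℝ} (hv : 0 < v) :
    ∫⁻ b in Ioi a, ENNReal.ofReal (Real.exp (-(b * v))) =
      ENNReal.ofReal (v⁻¹ * Real.exp (-(a * v))) := by
  have h : IntegrableOn (fun b : ℝ => Real.exp (-v * b)) (Ioi a) :=
    integrableOn_exp_mul_Ioi (by linarith) a
  have e : ∀ b : ℝ, Real.exp (-(b * v)) = Real.exp (-v * b) := fun b => by ring_nf
  simp_rw [e]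
  rw [← ofReal_integral_eq_lintegral_ofReal h (Eventually.of_forall fun _ => (Real.exp_pos _).le),
    integral_exp_mul_Ioi (by linarith)]
  congr 1
  field_simp

theorem pi_rpow_div_Gamma_mul_cK {N : ℕ} (hN : 2 ≤ N) (s : ℝ) :
    Real.pi ^ ((N : ℝ) / 2) / Real.Gamma ((N : ℝ) / 2) * cK N s =
      1 / (Real.Gamma s * Real.Gamma (1 - s)) := by
  have hN0 : (0 : ℝ) < N := by positivity
  have h1 := (Real.Gamma_pos_of_pos (half_pos hN0)).ne'
  have h2 := (Real.rpow_pos_of_pos Real.pi_pos ((N : ℝ) / 2)).ne'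
  rw [Real.Gamma_mul_Gamma_one_sub, cK, Real.rpow_add Real.pi_pos, Real.rpow_one, one_div_div]
  field_simp

theorem lintegral_etaE_mul_exp {N : ℕ} (hN : 2 ≤ N) {s : ℝ} (hs : s ∈ Ioo (0 : ℝ) 1) {r : ℝ}
    (hr : 0 < r) {a : ℝ} (ha : 0 ≤ a) :
    ∫⁻ y : Eu N, etaE N s r y * ENNReal.ofReal (Real.exp (-(a * ‖y‖ ^ 2))) =
      ENNReal.ofReal (r ^ (2 * s) / Real.Gamma s) *
        ∫⁻ b in Ioi a, ENNReal.ofReal (b ^ (s - 1) * Real.exp (-(r ^ 2 * b))) := by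
  have hG1 : 0 < Real.Gamma (1 - s) := Real.Gamma_pos_of_pos (by linarith [hs.2])
  have hG : 0 < Real.Gamma s := Real.Gamma_pos_of_pos hs.1
  have hs0 := hs.1
  have hN0 : (0 : ℝ) < N := by positivity
  have hr2 : 0 < r ^ 2 := by positivity
  have hsin : 0 ≤ cK N s := by
    unfold cK
    have : 0 ≤ Real.sin (Real.pi * s) := Real.sin_nonneg_of_nonneg_of_le_pi (by positivity)
      (by nlinarith [Real.pi_pos, hs.2])
    have := (Real.Gamma_pos_of_pos (half_pos hN0)).le
    positivity
  set f : ℝ → ℝ≥0∞ := (Ioi (r ^ 2)).indicator fun v =>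
    ENNReal.ofReal (cK N s * r ^ (2 * s) * (v ^ (-((N : ℝ) / 2)) * ((v - r ^ 2) ^ (-s) *
      Real.exp (-(a * v))))) with hf
  have mf : Measurable f := Measurable.indicator (by fun_prop) measurableSet_Ioi
  have e1 : ∀ y : Eu N, etaE N s r y * ENNReal.ofReal (Real.exp (-(a * ‖y‖ ^ 2))) =
      f (‖y‖ ^ 2) := by
    intro y
    unfold etaE eta
    by_cases hy : r < ‖y‖
    · have hy0 : 0 < ‖y‖ := hr.trans hy
      have hy2 : r ^ 2 < ‖y‖ ^ 2 := by gcongr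
      have hy3 : 0 < ‖y‖ ^ 2 - r ^ 2 := by linarith
      rw [if_pos hy, hf, indicator_of_mem (show ‖y‖ ^ 2 ∈ Ioi (r ^ 2) from hy2),
        ← ENNReal.ofReal_mul (by positivity)]
      congr 1
      rw [Real.rpow_neg (by positivity), Real.rpow_neg hy3.le, ← Real.rpow_natCast (‖y‖) 2,
        ← Real.rpow_mul hy0.le]
      simp only [Nat.cast_ofNat]
      rw [mul_div_cancel₀ _ two_ne_zero, Real.rpow_natCast]
      field_simp
    · rw [if_neg hy, hf, indicator_of_notMem, ENNReal.ofReal_zero, zero_mul]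
      simpa using (pow_le_pow_left₀ (norm_nonneg y) (not_lt.1 hy) 2)
  have e2 : ∀ v ∈ Ioi (r ^ 2), ENNReal.ofReal (v ^ ((N : ℝ) / 2 - 1)) *
      ENNReal.ofReal (cK N s * r ^ (2 * s) * (v ^ (-((N : ℝ) / 2)) * ((v - r ^ 2) ^ (-s) *
      Real.exp (-(a * v))))) = ENNReal.ofReal (cK N s * r ^ (2 * s)) *
        ∫⁻ b in Ioi a, ENNReal.ofReal ((v - r ^ 2) ^ (-s) * Real.exp (-(b * v))) := by
    intro v hv
    have hv' : r ^ 2 < v := hv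
    have hv0 : 0 < v := hr2.trans hv'
    have hv1 : 0 < v - r ^ 2 := by linarith
    simp_rw [ENNReal.ofReal_mul (show 0 ≤ (v - r ^ 2) ^ (-s) by positivity)]
    rw [lintegral_const_mul' _ _ ofReal_ne_top, lintegral_Ioi_exp hv0,
      ← ENNReal.ofReal_mul (by positivity), ← ENNReal.ofReal_mul (by positivity),
      ← ENNReal.ofReal_mul (by positivity)]
    congr 1
    rw [Real.rpow_sub_one hv0.ne', Real.rpow_neg hv0.le]
    have := (Real.rpow_pos_of_pos hv0 ((N : ℝ) / 2)).ne'
    field_simp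
  have e3 : ∀ b ∈ Ioi a, ∫⁻ v in Ioi (r ^ 2),
      ENNReal.ofReal ((v - r ^ 2) ^ (-s) * Real.exp (-(b * v))) =
      ENNReal.ofReal (Real.Gamma (1 - s)) *
        ENNReal.ofReal (b ^ (s - 1) * Real.exp (-(r ^ 2 * b))) := by
    intro b hb
    have hb0 : 0 < b := lt_of_le_of_lt ha hb
    rw [lintegral_Ioi_comp_add]
    have : ∀ w ∈ Ioi (0 : ℝ), ENNReal.ofReal ((w + r ^ 2 - r ^ 2) ^ (-s) *
        Real.exp (-(b * (w + r ^ 2)))) = ENNReal.ofReal (Real.exp (-(r ^ 2 * b))) *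
        ENNReal.ofReal (w ^ ((1 - s) - 1) * Real.exp (-(b * w))) := by
      intro w hw
      have hw0 : (0 : ℝ) < w := hw
      rw [← ENNReal.ofReal_mul (by positivity), add_sub_cancel_right, mul_add, neg_add,
        Real.exp_add, show (1 - s) - 1 = -s by ring]
      congr 1
      rw [mul_comm b (r ^ 2)]
      ring
    rw [setLIntegral_congr_fun measurableSet_Ioi this, lintegral_const_mul' _ _ ofReal_ne_top,
      lintegral_Ioi_rpow_mul_exp (by linarith [hs.2]) hb0, ← ENNReal.ofReal_mul (by positivity),
      ← ENNReal.ofReal_mul hG1.le]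
    congr 1
    rw [one_div, Real.inv_rpow hb0.le, ← Real.rpow_neg hb0.le, neg_sub]
    ring
  simp_rw [e1]
  rw [lintegral_norm_sq hN mf]
  have e4 : ∀ v, ENNReal.ofReal (v ^ ((N : ℝ) / 2 - 1)) * f v =
      (Ioi (r ^ 2)).indicator (fun v => ENNReal.ofReal (v ^ ((N : ℝ) / 2 - 1)) *
      ENNReal.ofReal (cK N s * r ^ (2 * s) * (v ^ (-((N : ℝ) / 2)) * ((v - r ^ 2) ^ (-s) *
      Real.exp (-(a * v)))))) v := by
    intro v
    by_cases hv : v ∈ Ioi (r ^ 2)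
    · rw [hf, indicator_of_mem hv, indicator_of_mem hv]
    · rw [hf, indicator_of_notMem hv, indicator_of_notMem hv, mul_zero]
  simp_rw [e4]
  rw [setLIntegral_indicator measurableSet_Ioi, inter_eq_left.2 (Ioi_subset_Ioi hr2.le),
    setLIntegral_congr_fun measurableSet_Ioi e2, lintegral_const_mul' _ _ ofReal_ne_top,
    lintegral_lintegral_swap (by fun_prop), setLIntegral_congr_fun measurableSet_Ioi e3,
    lintegral_const_mul' _ _ ofReal_ne_top, ← mul_assoc, ← mul_assoc]
  congr 1
  have hGN : 0 < Real.Gamma ((N : ℝ) / 2) := Real.Gamma_pos_of_pos (half_pos hN0)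
  rw [← ENNReal.ofReal_mul (by positivity), ← ENNReal.ofReal_mul (by positivity)]
  congr 1
  rw [← mul_assoc, pi_rpow_div_Gamma_mul_cK hN s]
  field_simp

theorem lintegral_etaE {N : ℕ} (hN : 2 ≤ N) {s : ℝ} (hs : s ∈ Ioo (0 : ℝ) 1) {r : ℝ}
    (hr : 0 < r) : ∫⁻ y : Eu N, etaE N s r y = 1 := by
  have h := lintegral_etaE_mul_exp hN hs hr le_rfl
  have hG : 0 < Real.Gamma s := Real.Gamma_pos_of_pos hs.1
  rw [lintegral_Ioi_rpow_mul_exp hs.1 (by positivity), ← ENNReal.ofReal_mul (by positivity)] at h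
  simp only [zero_mul, neg_zero, Real.exp_zero, ENNReal.ofReal_one, mul_one] at h
  rw [h, ← ENNReal.ofReal_one, one_div, Real.inv_rpow (by positivity), ← Real.rpow_natCast,
    ← Real.rpow_mul hr.le]
  congr 1
  have := (Real.rpow_pos_of_pos hr (2 * s)).ne'
  push_cast
  field_simp

/-- The deficit of the exterior kernel when tested against a heat kernel. -/
noncomputable def defect (N : ℕ) (s r T : ℝ) : ℝ≥0∞ :=
  ENNReal.ofReal ((4 * Real.pi * T) ^ (-((N : ℝ) / 2)) * (4 * T) ^ (-s) / Real.Gamma s) *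
    ∫⁻ v in Ioo 0 (r ^ 2), ENNReal.ofReal (v ^ (s - 1) * Real.exp (-(v / (4 * T))))

theorem lintegral_etaE_mul_hk_add {N : ℕ} (hN : 2 ≤ N) {s : ℝ} (hs : s ∈ Ioo (0 : ℝ) 1) {r : ℝ}
    (hr : 0 < r) {T : ℝ} (hT : 0 < T) :
    (∫⁻ y : Eu N, etaE N s r y * hk N T y) + defect N s r T = hk N T 0 := by
  have hG : 0 < Real.Gamma s := Real.Gamma_pos_of_pos hs.1
  have hr2 : 0 < r ^ 2 := by positivity
  set a := 1 / (4 * T) with ha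
  have ha0 : 0 < a := by positivity
  have e1 : ∀ y : Eu N, etaE N s r y * hk N T y =
      ENNReal.ofReal ((4 * Real.pi * T) ^ (-((N : ℝ) / 2))) *
        (etaE N s r y * ENNReal.ofReal (Real.exp (-(a * ‖y‖ ^ 2)))) := by
    intro y
    rw [hk, ENNReal.ofReal_mul (by positivity), show ‖y‖ ^ 2 / (4 * T) = a * ‖y‖ ^ 2 by
      rw [ha]; ring]
    ring
  simp_rw [e1]
  rw [lintegral_const_mul' _ _ ofReal_ne_top, lintegral_etaE_mul_exp hN hs hr ha0.le]
  have e2 : ENNReal.ofReal (r ^ (2 * s) / Real.Gamma s) *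
        ∫⁻ b in Ioi a, ENNReal.ofReal (b ^ (s - 1) * Real.exp (-(r ^ 2 * b))) =
      ENNReal.ofReal ((4 * T) ^ (-s) / Real.Gamma s) *
        ∫⁻ v in Ioi (r ^ 2), ENNReal.ofReal (v ^ (s - 1) * Real.exp (-(a * v))) := by
    have hc : 0 < a / r ^ 2 := by positivity
    have h := lintegral_Ioi_comp_mul'
      (fun b => ENNReal.ofReal (b ^ (s - 1) * Real.exp (-(r ^ 2 * b)))) hc hr2.le
    rw [div_mul_cancel₀ _ hr2.ne'] at h
    rw [h, ← mul_assoc, ← lintegral_const_mul' _ _ (by finiteness),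
      ← lintegral_const_mul' _ _ (by finiteness)]
    refine setLIntegral_congr_fun measurableSet_Ioi fun v hv => ?_
    have hv0 : 0 < v := hr2.trans hv
    rw [← ENNReal.ofReal_mul (by positivity), ← ENNReal.ofReal_mul (by positivity),
      ← ENNReal.ofReal_mul (by positivity)]
    congr 1
    rw [Real.mul_rpow hc.le hv0.le, Real.div_rpow ha0.le hr2.le, Real.rpow_sub_one ha0.ne',
      Real.rpow_sub_one hr2.ne', ← Real.rpow_natCast r 2, ← Real.rpow_mul hr.le, Nat.cast_ofNat,
      show (4 * T) ^ (-s) = a ^ s by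
        rw [ha, one_div, Real.inv_rpow (by positivity), Real.rpow_neg (by positivity)]]
    have := (Real.rpow_pos_of_pos hr (2 * s)).ne'
    have h3 := (Real.rpow_pos_of_pos hr 2).ne'
    rw [show r ^ (2 : ℝ) * (a / r ^ (2 : ℝ) * v) = a * v by field_simp]
    field_simp
  have e3 : ∀ v : ℝ, v / (4 * T) = a * v := fun v => by rw [ha]; ring
  have e4 : (∫⁻ v in Ioi (r ^ 2), ENNReal.ofReal (v ^ (s - 1) * Real.exp (-(a * v)))) +
      ∫⁻ v in Ioo 0 (r ^ 2), ENNReal.ofReal (v ^ (s - 1) * Real.exp (-(a * v))) =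
      ENNReal.ofReal ((1 / a) ^ s * Real.Gamma s) := by
    rw [← lintegral_Ioi_rpow_mul_exp hs.1 ha0, restrict_Ioo_eq_restrict_Ioc, add_comm,
      ← lintegral_union measurableSet_Ioi Ioc_disjoint_Ioi_same, Ioc_union_Ioi_eq_Ioi hr2.le]
  unfold defect hk
  simp_rw [e3]
  rw [e2, mul_div_assoc, ENNReal.ofReal_mul (by positivity), mul_assoc (ENNReal.ofReal _),
    ← mul_add, ← mul_add, e4,
    ← ENNReal.ofReal_mul (by positivity), ← ENNReal.ofReal_mul (by positivity)]
  congr 1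
  rw [ha, one_div_one_div, Real.rpow_neg (show 0 ≤ 4 * T by positivity)]
  have := (Real.rpow_pos_of_pos (show 0 < 4 * T by positivity) s).ne'
  simp
  field_simp

theorem lintegral_green_mul {N : ℕ} (hN : 2 ≤ N) {s : ℝ} (hs : s ∈ Ioo (0 : ℝ) 1) (r : ℝ)
    {f : ℝ → ℝ≥0∞} (hf : Measurable f) :
    ∫⁻ y : Eu N, green N s r y * f (‖y‖ ^ 2) =
      ENNReal.ofReal (1 / (4 ^ s * Real.Gamma s ^ 2)) *
        ∫⁻ v in Ioo 0 (r ^ 2), ENNReal.ofReal (v ^ (s - 1)) * ∫⁻ ξ in Ioo 0 1,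
          ENNReal.ofReal (ξ ^ ((N : ℝ) / 2 - 1) * (1 - ξ) ^ (s - 1)) * f (v * ξ) := by
  have hG : 0 < Real.Gamma s := Real.Gamma_pos_of_pos hs.1
  have hN0 : (0 : ℝ) < N := by positivity
  have hGN : 0 < Real.Gamma ((N : ℝ) / 2) := Real.Gamma_pos_of_pos (half_pos hN0)
  set κ := Real.Gamma ((N : ℝ) / 2) / (4 ^ s * Real.pi ^ ((N : ℝ) / 2) * Real.Gamma s ^ 2) with hκ
  set g : ℝ × ℝ → ℝ≥0∞ := {p : ℝ × ℝ | p.2 < p.1}.indicator fun p =>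
    ENNReal.ofReal (p.1 ^ (-((N : ℝ) / 2)) * (p.1 - p.2) ^ (s - 1)) with hg
  have mg : Measurable g :=
    Measurable.indicator (by fun_prop) (measurableSet_lt measurable_snd measurable_fst)
  set F : ℝ → ℝ≥0∞ := fun ω => ∫⁻ v in Ioo 0 (r ^ 2), g (v, ω) with hF
  have mF : Measurable F := mg.lintegral_prod_left'
  have e1 : ∀ y : Eu N, green N s r y * f (‖y‖ ^ 2) =
      ENNReal.ofReal κ * (F (‖y‖ ^ 2) * f (‖y‖ ^ 2)) := by
    intro y
    rw [green, ← hκ, mul_assoc]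
    congr 2
    rw [hF, ← lintegral_indicator measurableSet_Ioo]
    dsimp only
    rw [← lintegral_indicator measurableSet_Ioo]
    congr 1
    ext v
    by_cases h1 : ‖y‖ ^ 2 < v
    · have h0 : 0 < v := lt_of_le_of_lt (by positivity) h1
      by_cases h2 : v < r ^ 2
      · rw [indicator_of_mem (show v ∈ Ioo (‖y‖ ^ 2) (r ^ 2) from ⟨h1, h2⟩),
          indicator_of_mem (show v ∈ Ioo 0 (r ^ 2) from ⟨h0, h2⟩), hg,
          indicator_of_mem (by exact h1)]
      · rw [indicator_of_notMem (fun h => h2 h.2), indicator_of_notMem (fun h => h2 h.2)]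
    · rw [indicator_of_notMem (fun h => h1 h.1)]
      by_cases h2 : v ∈ Ioo 0 (r ^ 2)
      · rw [indicator_of_mem h2, hg, indicator_of_notMem (by exact h1)]
      · rw [indicator_of_notMem h2]
  simp_rw [e1]
  rw [lintegral_const_mul' _ _ ofReal_ne_top,
    lintegral_norm_sq hN (f := fun ω => F ω * f ω) (by fun_prop), ← mul_assoc,
    ← ENNReal.ofReal_mul (by positivity)]
  congr 1
  · congr 1
    rw [hκ]
    have := (Real.rpow_pos_of_pos Real.pi_pos ((N : ℝ) / 2)).ne'
    field_simp
  have e2 : ∀ ω, ENNReal.ofReal (ω ^ ((N : ℝ) / 2 - 1)) * (F ω * f ω) =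
      ∫⁻ v in Ioo 0 (r ^ 2), ENNReal.ofReal (ω ^ ((N : ℝ) / 2 - 1)) * (g (v, ω) * f ω) := by
    intro ω
    rw [lintegral_const_mul _ (by fun_prop), lintegral_mul_const _ (by fun_prop)]
  simp_rw [e2]
  rw [lintegral_lintegral_swap (by fun_prop)]
  refine setLIntegral_congr_fun measurableSet_Ioo fun v hv => ?_
  have hv0 : 0 < v := hv.1
  have e3 : ∫⁻ ω in Ioi 0, ENNReal.ofReal (ω ^ ((N : ℝ) / 2 - 1)) * (g (v, ω) * f ω) =
      ∫⁻ ω in Ioo 0 v, ENNReal.ofReal (ω ^ ((N : ℝ) / 2 - 1)) *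
        (ENNReal.ofReal (v ^ (-((N : ℝ) / 2)) * (v - ω) ^ (s - 1)) * f ω) := by
    rw [← lintegral_indicator measurableSet_Ioi, ← lintegral_indicator measurableSet_Ioo]
    congr 1
    ext ω
    by_cases h1 : 0 < ω
    · rw [indicator_of_mem (show ω ∈ Ioi (0 : ℝ) from h1)]
      by_cases h2 : ω < v
      · rw [indicator_of_mem (show ω ∈ Ioo 0 v from ⟨h1, h2⟩), hg, indicator_of_mem (by exact h2)]
      · rw [indicator_of_notMem (fun h => h2 h.2), hg, indicator_of_notMem (by exact h2)]
        simp
    · rw [indicator_of_notMem (by exact h1), indicator_of_notMem (fun h => h1 h.1)]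
  rw [e3, lintegral_Ioo_comp_mul _ hv0, ← lintegral_const_mul' _ _ ofReal_ne_top,
    ← lintegral_const_mul' _ _ ofReal_ne_top]
  refine setLIntegral_congr_fun measurableSet_Ioo fun ξ hξ => ?_
  have h0 := hξ.1
  have h1 : 0 < 1 - ξ := by linarith [hξ.2]
  rw [← mul_assoc, ← mul_assoc, ← mul_assoc, ← ENNReal.ofReal_mul (by positivity),
    ← ENNReal.ofReal_mul (by positivity), ← ENNReal.ofReal_mul (by positivity)]
  congr 2
  rw [show v - v * ξ = v * (1 - ξ) by ring, Real.mul_rpow hv0.le h1.le, Real.mul_rpow hv0.le h0.le,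
    Real.rpow_sub_one hv0.ne' ((N : ℝ) / 2), Real.rpow_neg hv0.le]
  have := (Real.rpow_pos_of_pos hv0 ((N : ℝ) / 2)).ne'
  field_simp

theorem lintegral_green {N : ℕ} (hN : 2 ≤ N) {s : ℝ} (hs : s ∈ Ioo (0 : ℝ) 1) {r : ℝ}
    (hr : 0 < r) : ∫⁻ y : Eu N, green N s r y = ENNReal.ofReal (gammaMV N s r) := by
  have h := lintegral_green_mul hN hs r (f := 1) measurable_one
  have hs0 := hs.1
  have hG : 0 < Real.Gamma s := Real.Gamma_pos_of_pos hs.1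
  have hN0 : (0 : ℝ) < N := by positivity
  have hGN : 0 < Real.Gamma ((N : ℝ) / 2) := Real.Gamma_pos_of_pos (half_pos hN0)
  have hGs : 0 < Real.Gamma ((N : ℝ) / 2 + s) := Real.Gamma_pos_of_pos (by positivity)
  have hr2 : 0 < r ^ 2 := by positivity
  simp only [Pi.one_apply, mul_one] at h
  have e4 : ∫⁻ a in Ioo 0 (r ^ 2), ENNReal.ofReal (a ^ (s - 1)) =
      ENNReal.ofReal ((r ^ 2) ^ s / s) := by
    have hi : IntervalIntegrable (fun b : ℝ => b ^ (s - 1)) volume 0 (r ^ 2) :=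
      intervalIntegral.intervalIntegrable_rpow' (by linarith)
    rw [← ofReal_integral_eq_lintegral_ofReal]
    · rw [← integral_Ioc_eq_integral_Ioo, ← intervalIntegral.integral_of_le hr2.le,
        integral_rpow (Or.inl (by linarith)), sub_add_cancel, Real.zero_rpow hs0.ne', sub_zero]
    · exact ((intervalIntegrable_iff_integrableOn_Ioc_of_le hr2.le).1 hi).mono_set
        Ioo_subset_Ioc_self
    · filter_upwards [ae_restrict_mem measurableSet_Ioo] with b hb
      have : 0 < b := hb.1
      positivity
  rw [h, lintegral_beta (half_pos hN0) hs0, lintegral_mul_const' _ _ ofReal_ne_top, e4,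
    ← ENNReal.ofReal_mul (by positivity), ← ENNReal.ofReal_mul (by positivity), gammaMV]
  congr 1
  rw [show ((N : ℝ) + 2 * s) / 2 = N / 2 + s by ring, add_comm 1 s, Real.Gamma_add_one hs0.ne',
    ← Real.rpow_natCast r 2, ← Real.rpow_mul hr.le]
  push_cast
  field_simp

theorem lintegral_green_mul_hk {N : ℕ} (hN : 2 ≤ N) {s : ℝ} (hs : s ∈ Ioo (0 : ℝ) 1) (r : ℝ)
    {t : ℝ} (ht : 0 < t) :
    ∫⁻ y : Eu N, green N s r y * hk N t y =
      ∫⁻ τ in Ioi 0, rieszW s τ * defect N s r (τ + t) := by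
  have hG : 0 < Real.Gamma s := Real.Gamma_pos_of_pos hs.1
  have h := lintegral_green_mul hN hs r (f := fun ω => ENNReal.ofReal
    ((4 * Real.pi * t) ^ (-((N : ℝ) / 2)) * Real.exp (-(ω / (4 * t))))) (by fun_prop)
  have e0 : ∀ T, Measurable fun v : ℝ =>
    ENNReal.ofReal (v ^ (s - 1) * Real.exp (-(v / (4 * T)))) := fun T => by fun_prop
  unfold hk
  rw [h, lintegral_Ioi_eq_Ioo _ ht, ← lintegral_const_mul' _ _ ofReal_ne_top]
  simp_rw [← lintegral_const_mul' _ _ ofReal_ne_top]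
  rw [lintegral_lintegral_swap (by fun_prop)]
  refine setLIntegral_congr_fun measurableSet_Ioo fun ξ hξ => ?_
  have h0 := hξ.1
  have h1 : 0 < 1 - ξ := by linarith [hξ.2]
  rw [defect, sub_add_cancel, rieszW, ← mul_assoc, ← mul_assoc,
    ← ENNReal.ofReal_mul (by positivity)]
  have hp : 0 < t / ξ - t := by
    rw [show t / ξ - t = t * (1 - ξ) / ξ by field_simp]
    positivity
  rw [← ENNReal.ofReal_mul (by positivity), ← lintegral_const_mul' _ _ ofReal_ne_top]
  refine setLIntegral_congr_fun measurableSet_Ioo fun v hv => ?_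
  have hv0 : 0 < v := hv.1
  rw [← ENNReal.ofReal_mul (by positivity), ← ENNReal.ofReal_mul (by positivity),
    ← ENNReal.ofReal_mul (by positivity), ← ENNReal.ofReal_mul (by positivity)]
  congr 1
  rw [show v / (4 * (t / ξ)) = v * ξ / (4 * t) by field_simp,
    show t / ξ - t = t * (1 - ξ) / ξ by field_simp,
      show 4 * Real.pi * (t / ξ) = 4 * Real.pi * t / ξ by ring,
    show 4 * (t / ξ) = 4 * t / ξ by ring, Real.div_rpow (by positivity) h0.le,
    Real.div_rpow (by positivity) h0.le, Real.div_rpow (by positivity) h0.le,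
    Real.mul_rpow ht.le h1.le, Real.mul_rpow (x := 4) (by positivity) ht.le,
    Real.rpow_sub_one h0.ne' ((N : ℝ) / 2), Real.rpow_sub_one h0.ne' s,
    Real.rpow_sub_one ht.ne' s, Real.rpow_neg h0.le, Real.rpow_neg h0.le,
    Real.rpow_neg (x := 4) (by positivity), Real.rpow_neg ht.le]
  have := (Real.rpow_pos_of_pos h0 ((N : ℝ) / 2)).ne'
  have := (Real.rpow_pos_of_pos h0 s).ne'
  have := (Real.rpow_pos_of_pos ht s).ne'
  field_simp

@[fun_prop]
theorem measurable_green (N : ℕ) (s r : ℝ) : Measurable (green N s r) := by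
  unfold green
  have mg : Measurable ({p : Eu N × ℝ | ‖p.1‖ ^ 2 < p.2}.indicator fun p =>
      ENNReal.ofReal (p.2 ^ (-((N : ℝ) / 2)) * (p.2 - ‖p.1‖ ^ 2) ^ (s - 1))) :=
    Measurable.indicator (by fun_prop) (measurableSet_lt (by fun_prop) measurable_snd)
  have := mg.lintegral_prod_right' (ν := volume.restrict (Iio (r ^ 2)))
  refine Measurable.const_mul ?_ _
  convert this using 2 with y
  rw [← lintegral_indicator measurableSet_Ioo, ← lintegral_indicator measurableSet_Iio]
  congr 1
  ext v
  by_cases h1 : ‖y‖ ^ 2 < v <;> by_cases h2 : v < r ^ 2 <;> simp [indicator, h1, h2]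

@[fun_prop]
theorem measurable_eta (N : ℕ) (s r : ℝ) : Measurable (eta N s r) := by
  unfold eta
  exact Measurable.ite (measurableSet_lt measurable_const (by fun_prop)) (by fun_prop)
    measurable_const

@[fun_prop]
theorem measurable_etaE (N : ℕ) (s r : ℝ) : Measurable (etaE N s r) := by
  unfold etaE
  fun_prop

theorem green_eq_zero {N : ℕ} {s r : ℝ} (hr : 0 ≤ r) {y : Eu N} (hy : r ≤ ‖y‖) :
    green N s r y = 0 := by
  have : r ^ 2 ≤ ‖y‖ ^ 2 := by gcongr
  rw [green, Ioo_eq_empty (not_lt.2 this)]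
  simp

theorem hk_neg {N : ℕ} (t : ℝ) (y : Eu N) : hk N t (-y) = hk N t y := by
  simp [hk]

theorem mix_neg {N : ℕ} (S : Set ℝ) (a : ℝ → ℝ≥0∞) (y : Eu N) : mix N S a (-y) = mix N S a y := by
  simp [mix, hk_neg]

theorem cv_zero {N : ℕ} {k : Eu N → ℝ≥0∞} (hk : ∀ y, k (-y) = k y) (f : Eu N → ℝ≥0∞) :
    cv k f 0 = ∫⁻ y, k y * f y := by
  simp [cv, hk]

theorem lintegral_cv_mul {N : ℕ} {k f g : Eu N → ℝ≥0∞} (hk : ∀ y, k (-y) = k y)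
    (mk : Measurable k) (mf : Measurable f) (mg : Measurable g) :
    ∫⁻ y, cv k g y * f y = ∫⁻ y, g y * cv k f y := by
  unfold cv
  have e1 : ∀ y, (∫⁻ z, k (y - z) * g z) * f y = ∫⁻ z, g z * (k (z - y) * f y) := fun y => by
    rw [← lintegral_mul_const _ (by fun_prop)]
    refine lintegral_congr fun z => ?_
    rw [← neg_sub, hk]
    ring
  have e2 : ∀ z, g z * (∫⁻ y, k (z - y) * f y) = ∫⁻ y, g z * (k (z - y) * f y) := fun z => by
    rw [← lintegral_const_mul _ (by fun_prop)]
  simp_rw [e1, e2]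
  exact lintegral_lintegral_swap (by fun_prop)

theorem lintegral_rieszW_lt_top {s : ℝ} (hs : s ∈ Ioo (0 : ℝ) 1) {g : ℝ → ℝ≥0∞} {A : ℝ≥0∞} {B : ℝ}
    (hA : A ≠ ⊤) (h1 : ∀ τ, 0 < τ → g τ ≤ A) (h2 : ∀ τ, 1 < τ → g τ ≤ ENNReal.ofReal (B * τ⁻¹)) :
    ∫⁻ τ in Ioi 0, rieszW s τ * g τ < ⊤ := by
  have hG : 0 < Real.Gamma s := Real.Gamma_pos_of_pos hs.1
  have hs0 := hs.1
  rw [← Ioc_union_Ioi_eq_Ioi zero_le_one]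
  refine (lintegral_union_le _ _ _).trans_lt (ENNReal.add_lt_top.2 ⟨?_, ?_⟩)
  · have hi : IntegrableOn (fun τ : ℝ => τ ^ (s - 1) / Real.Gamma s) (Ioc 0 1) :=
      ((intervalIntegrable_iff_integrableOn_Ioc_of_le zero_le_one).1
        (intervalIntegral.intervalIntegrable_rpow' (by linarith))).div_const _
    calc ∫⁻ τ in Ioc 0 1, rieszW s τ * g τ ≤ ∫⁻ τ in Ioc 0 1, rieszW s τ * A :=
          setLIntegral_mono (by fun_prop) fun τ hτ => by gcongr; exact h1 τ hτ.1
      _ = (∫⁻ τ in Ioc 0 1, rieszW s τ) * A := lintegral_mul_const' _ _ hA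
      _ < ⊤ := ENNReal.mul_lt_top hi.lintegral_lt_top hA.lt_top
  · have hi : IntegrableOn (fun τ : ℝ => τ ^ (s - 2) * (B / Real.Gamma s)) (Ioi 1) :=
      (integrableOn_Ioi_rpow_of_lt (by linarith [hs.2]) one_pos).mul_const _
    refine lt_of_le_of_lt (setLIntegral_mono (by fun_prop) fun τ hτ => ?_) hi.lintegral_lt_top
    have hτ1 : (1 : ℝ) < τ := hτ
    have hτ0 : 0 < τ := by linarith
    calc rieszW s τ * g τ ≤ rieszW s τ * ENNReal.ofReal (B * τ⁻¹) := by gcongr; exact h2 τ hτ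
      _ = _ := by
        rw [rieszW, ← ENNReal.ofReal_mul (by positivity)]
        congr 1
        rw [show s - 2 = s - 1 - 1 by ring, Real.rpow_sub_one hτ0.ne' (s - 1)]
        field_simp

theorem hk_le {N : ℕ} (t : ℝ) (ht : 0 < t) (y : Eu N) :
    hk N t y ≤ ENNReal.ofReal ((4 * Real.pi * t) ^ (-((N : ℝ) / 2))) := by
  unfold hk
  gcongr
  refine mul_le_of_le_one_right (by positivity) (Real.exp_le_one_iff.2 ?_)
  rw [neg_nonpos]
  positivity

theorem rpow_le_inv {N : ℕ} (hN : 2 ≤ N) {t : ℝ} (ht : 1 < t) :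
    (4 * Real.pi * t) ^ (-((N : ℝ) / 2)) ≤ 1 * t⁻¹ := by
  have h2 : (2 : ℝ) ≤ N := by exact_mod_cast hN
  have hpi := Real.pi_gt_three
  calc (4 * Real.pi * t) ^ (-((N : ℝ) / 2)) ≤ (4 * Real.pi * t) ^ (-1 : ℝ) := by
        apply Real.rpow_le_rpow_of_exponent_le
        · nlinarith
        · linarith
    _ = (4 * Real.pi * t)⁻¹ := Real.rpow_neg_one _
    _ ≤ 1 * t⁻¹ := by
        rw [one_mul]
        gcongr
        nlinarith

theorem cv_riesz_hk {N : ℕ} (s : ℝ) {t : ℝ} (ht : 0 < t) (x : Eu N) :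
    cv (mix N (Ioi 0) (rieszW s)) (hk N t) x = ∫⁻ τ in Ioi 0, rieszW s τ * hk N (τ + t) x := by
  rw [cv_mix (by fun_prop) (by fun_prop)]
  refine setLIntegral_congr_fun measurableSet_Ioi fun τ hτ => ?_
  rw [cv_hk_hk hτ ht]

theorem lintegral_riesz_mul_hk_lt_top {N : ℕ} (hN : 2 ≤ N) {s : ℝ} (hs : s ∈ Ioo (0 : ℝ) 1)
    {t : ℝ} (ht : 0 < t) : ∫⁻ y : Eu N, mix N (Ioi 0) (rieszW s) y * hk N t y < ⊤ := by
  rw [← cv_zero (mix_neg _ _), cv_riesz_hk s ht]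
  refine lintegral_rieszW_lt_top hs (A := ENNReal.ofReal ((4 * Real.pi * t) ^ (-((N : ℝ) / 2))))
    (B := 1) ofReal_ne_top (fun τ hτ => ?_) fun τ hτ => ?_
  · refine (hk_le _ (by positivity) _).trans (ENNReal.ofReal_le_ofReal ?_)
    apply Real.rpow_le_rpow_of_nonpos (by positivity)
    · have := Real.pi_pos
      gcongr
      linarith
    · rw [neg_nonpos]; positivity
  · refine (hk_le _ (by linarith) _).trans (ENNReal.ofReal_le_ofReal ?_)
    refine (rpow_le_inv hN (by linarith)).trans ?_
    rw [one_mul, one_mul]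
    gcongr
    linarith

theorem lintegral_green_add_mul_hk {N : ℕ} (hN : 2 ≤ N) {s : ℝ} (hs : s ∈ Ioo (0 : ℝ) 1) {r : ℝ}
    (hr : 0 < r) {t : ℝ} (ht : 0 < t) :
    ∫⁻ y : Eu N, (green N s r y + cv (mix N (Ioi 0) (rieszW s)) (etaE N s r) y) * hk N t y =
      ∫⁻ y : Eu N, mix N (Ioi 0) (rieszW s) y * hk N t y := by
  have mΦ := measurable_mix (N := N) (S := Ioi 0) (measurable_rieszW s)
  simp_rw [add_mul]
  rw [lintegral_add_left (by fun_prop), lintegral_green_mul_hk hN hs r ht,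
    lintegral_cv_mul (mix_neg _ _) mΦ (by fun_prop) (by fun_prop), ← cv_zero (mix_neg _ _),
    cv_riesz_hk s ht]
  have e : ∫⁻ y, etaE N s r y * cv (mix N (Ioi 0) (rieszW s)) (hk N t) y =
      ∫⁻ τ in Ioi 0, rieszW s τ * ∫⁻ y, etaE N s r y * hk N (τ + t) y := by
    simp_rw [cv_riesz_hk s ht]
    have e1 : ∀ y, etaE N s r y * (∫⁻ τ in Ioi 0, rieszW s τ * hk N (τ + t) y) =
        ∫⁻ τ in Ioi 0, rieszW s τ * (etaE N s r y * hk N (τ + t) y) := fun y => by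
      rw [← lintegral_const_mul _ (by fun_prop)]
      refine lintegral_congr fun τ => by ring
    have e2 : ∀ τ, rieszW s τ * (∫⁻ y, etaE N s r y * hk N (τ + t) y) =
        ∫⁻ y, rieszW s τ * (etaE N s r y * hk N (τ + t) y) := fun τ => by
      rw [← lintegral_const_mul _ (by fun_prop)]
    simp_rw [e1, e2]
    exact lintegral_lintegral_swap (by fun_prop)
  have m2 : Measurable fun τ => rieszW s τ * ∫⁻ y : Eu N, etaE N s r y * hk N (τ + t) y := by
    have : Measurable fun τ => ∫⁻ y : Eu N, etaE N s r y * hk N (τ + t) y :=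
      Measurable.lintegral_prod_right'
        (f := fun q : ℝ × Eu N => etaE N s r q.2 * hk N (q.1 + t) q.2) (by fun_prop)
    fun_prop
  rw [e, ← lintegral_add_right _ m2]
  refine setLIntegral_congr_fun measurableSet_Ioi fun τ hτ => ?_
  have : 0 < τ + t := by
    have : (0 : ℝ) < τ := hτ
    linarith
  rw [← mul_add, add_comm (defect N s r (τ + t)), lintegral_etaE_mul_hk_add hN hs hr this]

theorem measure_ext_of_moments {μ ν : Measure ℝ} [IsFiniteMeasure μ] [IsFiniteMeasure ν]
    (hμ : ∀ᵐ x ∂μ, x ∈ Icc (0 : ℝ) 1) (hν : ∀ᵐ x ∂ν, x ∈ Icc (0 : ℝ) 1)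
    (h : ∀ n : ℕ, ∫ x, x ^ n ∂μ = ∫ x, x ^ n ∂ν) : μ = ν := by
  have hpow : ∀ (ρ : Measure ℝ) [IsFiniteMeasure ρ], (∀ᵐ x ∂ρ, x ∈ Icc (0 : ℝ) 1) →
      ∀ n : ℕ, Integrable (fun x : ℝ => x ^ n) ρ := by
    intro ρ _ hρ n
    refine Integrable.mono' (integrable_const (1 : ℝ)) (by fun_prop) ?_
    filter_upwards [hρ] with x hx
    rw [Real.norm_eq_abs, abs_of_nonneg (pow_nonneg hx.1 n)]
    exact pow_le_one₀ hx.1 hx.2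
  have hpoly : ∀ (ρ : Measure ℝ) [IsFiniteMeasure ρ], (∀ᵐ x ∂ρ, x ∈ Icc (0 : ℝ) 1) →
      ∀ p : Polynomial ℝ, Integrable (fun x : ℝ => p.eval x) ρ ∧
        ∫ x, p.eval x ∂ρ = ∑ i ∈ p.support, p.coeff i * ∫ x, x ^ i ∂ρ := by
    intro ρ _ hρ p
    simp_rw [Polynomial.eval_eq_sum, Polynomial.sum]
    refine ⟨integrable_finsetSum _ fun i _ => (hpow ρ hρ i).const_mul _, ?_⟩
    rw [integral_finsetSum _ fun i _ => (hpow ρ hρ i).const_mul _]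
    simp_rw [integral_const_mul]
  refine ext_of_forall_integral_eq_of_IsFiniteMeasure fun f => ?_
  refine eq_of_abs_sub_le_all fun ε hε => ?_
  set M := μ.real univ + ν.real univ with hM
  have hM0 : 0 ≤ M := by positivity
  obtain ⟨p, hp⟩ := exists_polynomial_near_of_continuousOn 0 1 f f.continuous.continuousOn
    (ε / (M + 1)) (by positivity)
  have key : ∀ (ρ : Measure ℝ) [IsFiniteMeasure ρ], (∀ᵐ x ∂ρ, x ∈ Icc (0 : ℝ) 1) →
      |∫ x, p.eval x ∂ρ - ∫ x, f x ∂ρ| ≤ ε / (M + 1) * ρ.real univ := by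
    intro ρ _ hρ
    rw [← integral_sub (hpoly ρ hρ p).1 (f.integrable ρ), ← Real.norm_eq_abs]
    refine norm_integral_le_of_norm_le_const ?_
    filter_upwards [hρ] with x hx
    exact (hp x hx).le
  have k1 := key μ hμ
  have k2 := key ν hν
  have k3 : ∫ x, p.eval x ∂μ = ∫ x, p.eval x ∂ν := by
    rw [(hpoly μ hμ p).2, (hpoly ν hν p).2]
    simp_rw [h]
  have k4 : ε / (M + 1) * μ.real univ + ε / (M + 1) * ν.real univ ≤ ε := by
    rw [← mul_add, ← hM, div_mul_eq_mul_div, div_le_iff₀ (by positivity)]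
    nlinarith
  rw [k3] at k1
  rw [abs_le] at *
  constructor <;> linarith [k1.1, k1.2, k2.1, k2.2]

theorem ae_eq_of_radial {N : ℕ} (hN : 2 ≤ N) {D₁ D₂ : Eu N → ℝ≥0∞} (m₁ : Measurable D₁)
    (m₂ : Measurable D₂) (r₁ : ∀ x y, ‖x‖ = ‖y‖ → D₁ x = D₁ y)
    (r₂ : ∀ x y, ‖x‖ = ‖y‖ → D₂ x = D₂ y)
    (hfin : ∫⁻ y, D₁ y * ENNReal.ofReal (Real.exp (-‖y‖ ^ 2)) ≠ ⊤)
    (h : ∀ n : ℕ, ∫⁻ y, D₁ y * ENNReal.ofReal (Real.exp (-‖y‖ ^ 2) ^ (n + 1)) =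
      ∫⁻ y, D₂ y * ENNReal.ofReal (Real.exp (-‖y‖ ^ 2) ^ (n + 1))) : D₁ =ᵐ[volume] D₂ := by
  set p : Eu N → ℝ := fun y => Real.exp (-‖y‖ ^ 2) with hp
  have mp : Measurable p := by fun_prop
  have p0 : ∀ y, 0 < p y := fun y => Real.exp_pos _
  have p1 : ∀ y, p y ≤ 1 := fun y => Real.exp_le_one_iff.2 (by simp)
  set M : (Eu N → ℝ≥0∞) → Measure ℝ := fun D =>
    (volume.withDensity fun y => D y * ENNReal.ofReal (p y)).map p with hM
  have hMl : ∀ D : Eu N → ℝ≥0∞, Measurable D → ∀ B, MeasurableSet B →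
      M D B = ∫⁻ y in p ⁻¹' B, D y * ENNReal.ofReal (p y) := by
    intro D mD B hB
    rw [hM]
    dsimp only
    rw [Measure.map_apply mp hB, withDensity_apply _ (mp hB)]
  have hMn : ∀ D : Eu N → ℝ≥0∞, Measurable D → ∀ n : ℕ,
      ∫ x, x ^ n ∂(M D) = (∫⁻ y, D y * ENNReal.ofReal (p y ^ (n + 1))).toReal := by
    intro D mD n
    have hpos : 0 ≤ᵐ[M D] fun x : ℝ => x ^ n := by
      refine (ae_map_iff mp.aemeasurable (measurableSet_le (by fun_prop) (by fun_prop))).2 ?_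
      exact Eventually.of_forall fun y => pow_nonneg (p0 y).le n
    rw [integral_eq_lintegral_of_nonneg_ae hpos (by fun_prop), lintegral_map (by fun_prop) mp,
      lintegral_withDensity_eq_lintegral_mul _ (by fun_prop) (by fun_prop)]
    congr 1
    refine lintegral_congr fun y => ?_
    simp only [Pi.mul_apply]
    rw [mul_assoc, ← ENNReal.ofReal_mul (p0 y).le, pow_succ']
  have hM01 : ∀ D : Eu N → ℝ≥0∞, ∀ᵐ x ∂(M D), x ∈ Icc (0 : ℝ) 1 := by
    intro D
    refine (ae_map_iff mp.aemeasurable measurableSet_Icc).2 ?_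
    exact Eventually.of_forall fun y => ⟨(p0 y).le, p1 y⟩
  have h1 : ∫⁻ y, D₁ y * ENNReal.ofReal (p y) = ∫⁻ y, D₂ y * ENNReal.ofReal (p y) := by
    simpa using h 0
  have f1 : IsFiniteMeasure (M D₁) := ⟨by
    rw [hMl _ m₁ _ MeasurableSet.univ]; simpa using hfin.lt_top⟩
  have f2 : IsFiniteMeasure (M D₂) := ⟨by
    rw [hMl _ m₂ _ MeasurableSet.univ]; simpa [← h1] using hfin.lt_top⟩
  have hMM : M D₁ = M D₂ := measure_ext_of_moments (hM01 _) (hM01 _) fun n => by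
    rw [hMn _ m₁, hMn _ m₂, h n]
  set e : Eu N := EuclideanSpace.single ⟨0, by omega⟩ 1 with he
  set q : ℝ → Eu N := fun x => Real.sqrt (-Real.log x) • e with hq
  have mq : Measurable q := by fun_prop
  have hqp : ∀ y, ‖q (p y)‖ = ‖y‖ := by
    intro y
    simp only [hq, hp, Real.log_exp, neg_neg, norm_smul, he]
    simp
  have key : ∀ {A B : Eu N → ℝ≥0∞}, Measurable A → Measurable B →
      (∀ x y, ‖x‖ = ‖y‖ → A x = A y) → (∀ x y, ‖x‖ = ‖y‖ → B x = B y) → M A = M B →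
      ∫⁻ y, A y * ENNReal.ofReal (p y) ≠ ⊤ → ∀ᵐ y, B y ≤ A y := by
    intro A B mA mB rA rB hAB hA
    set S : Set ℝ := {x | A (q x) < B (q x)} with hS
    have mS : MeasurableSet S := measurableSet_lt (by fun_prop) (by fun_prop)
    have hpS : p ⁻¹' S = {y | A y < B y} := by
      ext y
      simp only [hS, mem_preimage, mem_ofPred_eq]
      rw [rA _ _ (hqp y), rB _ _ (hqp y)]
    have heq : ∫⁻ y in p ⁻¹' S, A y * ENNReal.ofReal (p y) =
        ∫⁻ y in p ⁻¹' S, B y * ENNReal.ofReal (p y) := by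
      rw [← hMl _ mA _ mS, ← hMl _ mB _ mS, hAB]
    have hz : volume (p ⁻¹' S) = 0 := by
      by_contra hne
      refine heq.not_lt (setLIntegral_strict_mono (mp mS) hne (by fun_prop)
        (ne_top_of_le_ne_top hA (setLIntegral_le_lintegral _ _)) ?_)
      refine Eventually.of_forall fun y hy => ?_
      rw [hpS] at hy
      exact ENNReal.mul_lt_mul_left (by simpa using p0 y) ofReal_ne_top hy
    rw [hpS] at hz
    rw [ae_iff]
    simpa using hz
  filter_upwards [key m₁ m₂ r₁ r₂ hMM hfin, key m₂ m₁ r₂ r₁ hMM.symm (h1 ▸ hfin)] with y ha hb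
  exact le_antisymm hb ha

theorem exists_isometry {N : ℕ} {x y : Eu N} (h : ‖x‖ = ‖y‖) :
    ∃ A : Eu N ≃ₗᵢ[ℝ] Eu N, A x = y :=
  ⟨Submodule.reflection (ℝ ∙ (x - y))ᗮ, Submodule.reflection_sub h⟩

theorem cv_radial {N : ℕ} {k f : Eu N → ℝ≥0∞} (hk : ∀ x y, ‖x‖ = ‖y‖ → k x = k y)
    (hf : ∀ x y, ‖x‖ = ‖y‖ → f x = f y) {x y : Eu N} (h : ‖x‖ = ‖y‖) : cv k f x = cv k f y := by
  obtain ⟨A, rfl⟩ := exists_isometry h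
  unfold cv
  rw [← A.measurePreserving.lintegral_comp_emb A.toHomeomorph.measurableEmbedding
    (fun z => k (A x - z) * f z)]
  refine lintegral_congr fun z => ?_
  rw [← map_sub, hk _ _ (A.norm_map (x - z)), hf _ _ (A.norm_map z)]

theorem mix_radial {N : ℕ} (S : Set ℝ) (a : ℝ → ℝ≥0∞) (x y : Eu N) (h : ‖x‖ = ‖y‖) :
    mix N S a x = mix N S a y := by
  simp [mix, hk, h]

theorem green_add_cv_ae {N : ℕ} (hN : 2 ≤ N) {s : ℝ} (hs : s ∈ Ioo (0 : ℝ) 1) {r : ℝ}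
    (hr : 0 < r) : (fun y : Eu N => green N s r y +
      cv (mix N (Ioi 0) (rieszW s)) (etaE N s r) y) =ᵐ[volume] mix N (Ioi 0) (rieszW s) := by
  have mΦ := measurable_mix (N := N) (S := Ioi 0) (measurable_rieszW s)
  have hexp : ∀ (D : Eu N → ℝ≥0∞) (n : ℕ),
      ∫⁻ y, D y * ENNReal.ofReal (Real.exp (-‖y‖ ^ 2) ^ (n + 1)) =
      ENNReal.ofReal ((4 * Real.pi * (1 / (4 * (n + 1)))) ^ ((N : ℝ) / 2)) *
        ∫⁻ y, D y * hk N (1 / (4 * (n + 1))) y := by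
    intro D n
    rw [← lintegral_const_mul' _ _ ofReal_ne_top]
    refine lintegral_congr fun y => ?_
    have hpi := Real.pi_pos
    rw [mul_left_comm, hk, ← ENNReal.ofReal_mul (by positivity), ← mul_assoc,
      ← Real.rpow_add (by positivity), add_neg_cancel, Real.rpow_zero, one_mul, ← Real.exp_nat_mul]
    congr 4
    push_cast
    field_simp
  have ht : ∀ n : ℕ, (0 : ℝ) < 1 / (4 * (n + 1)) := fun n => by positivity
  refine (ae_eq_of_radial hN mΦ (by have := measurable_cv mΦ (measurable_etaE N s r); fun_prop)
    (mix_radial _ _) (fun x y h => ?_) ?_ fun n => ?_).symm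
  · rw [cv_radial (mix_radial _ _) (fun x y h => by simp [etaE, eta, h]) h]
    simp [green, h]
  · have := hexp (mix N (Ioi 0) (rieszW s)) 0
    simp only [zero_add, pow_one] at this
    rw [this]
    exact (ENNReal.mul_lt_top ofReal_lt_top (lintegral_riesz_mul_hk_lt_top hN hs (ht 0))).ne
  · rw [hexp, hexp, lintegral_green_add_mul_hk hN hs hr (ht n)]

/-- The representation of the Riesz potential at the centre of a ball. -/
theorem lintegral_green_mul_add {N : ℕ} (hN : 2 ≤ N) {s : ℝ} (hs : s ∈ Ioo (0 : ℝ) 1) {r : ℝ}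
    (hr : 0 < r) {f : Eu N → ℝ≥0∞} (hf : Measurable f) :
    (∫⁻ y, green N s r y * f y) +
      ∫⁻ y, etaE N s r y * cv (mix N (Ioi 0) (rieszW s)) f y =
    cv (mix N (Ioi 0) (rieszW s)) f 0 := by
  have mΦ := measurable_mix (N := N) (S := Ioi 0) (measurable_rieszW s)
  rw [cv_zero (mix_neg _ _), ← lintegral_cv_mul (mix_neg _ _) mΦ hf (by fun_prop),
    ← lintegral_add_left (by fun_prop)]
  refine lintegral_congr_ae ?_
  filter_upwards [green_add_cv_ae hN hs hr] with y hy
  rw [← hy, add_mul]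

/-- The kernel of the fractional Laplacian. -/
noncomputable def lk (N : ℕ) (s : ℝ) (h : Eu N) : ℝ := CNs N s / ‖h‖ ^ ((N : ℝ) + 2 * s)

/-- The truncated kernel of the fractional Laplacian. -/
noncomputable def tk (N : ℕ) (s δ : ℝ) (h : Eu N) : ℝ≥0∞ := mix N (Ioi δ) (levyW s) h

theorem CNs_pos {N : ℕ} (hN : 2 ≤ N) {s : ℝ} (hs : s ∈ Ioo (0 : ℝ) 1) : 0 < CNs N s := by
  have hs0 := hs.1
  have h1 : 0 < Real.Gamma (1 - s) := Real.Gamma_pos_of_pos (by linarith [hs.2])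
  have h2 : 0 < Real.Gamma ((N : ℝ) / 2 + s) := Real.Gamma_pos_of_pos (by positivity)
  have := Real.pi_pos
  unfold CNs
  positivity

theorem lk_nonneg {N : ℕ} (hN : 2 ≤ N) {s : ℝ} (hs : s ∈ Ioo (0 : ℝ) 1) (h : Eu N) :
    0 ≤ lk N s h := by
  have := (CNs_pos hN hs).le
  unfold lk
  positivity

@[fun_prop]
theorem measurable_lk (N : ℕ) (s : ℝ) : Measurable (lk N s) := by
  unfold lk
  fun_prop

@[fun_prop]
theorem measurable_tk (N : ℕ) (s δ : ℝ) : Measurable (tk N s δ) :=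
  measurable_mix (by fun_prop)

theorem tk_zero {N : ℕ} (hN : 2 ≤ N) {s : ℝ} (hs : s ∈ Ioo (0 : ℝ) 1) {h : Eu N} (hh : h ≠ 0) :
    tk N s 0 h = ENNReal.ofReal (lk N s h) := by
  have hs0 := hs.1
  have h1 : 0 < Real.Gamma (1 - s) := Real.Gamma_pos_of_pos (by linarith [hs.2])
  have h2 : 0 < Real.Gamma ((N : ℝ) / 2 + s) := Real.Gamma_pos_of_pos (by positivity)
  have hpi := Real.pi_pos
  have hn : 0 < ‖h‖ := norm_pos_iff.2 hh
  unfold tk mix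
  rw [lintegral_Ioi_comp_inv]
  have e : ∀ b ∈ Ioi (0 : ℝ), ENNReal.ofReal (1 / (4 * b ^ 2)) *
      (levyW s (1 / (4 * b)) * hk N (1 / (4 * b)) h) =
      ENNReal.ofReal (s / Real.Gamma (1 - s) * 4 ^ s * Real.pi ^ (-((N : ℝ) / 2))) *
      ENNReal.ofReal (b ^ ((N : ℝ) / 2 + s - 1) * Real.exp (-(‖h‖ ^ 2 * b))) := by
    intro b hb
    have hb0 : (0 : ℝ) < b := hb
    rw [levyW, hk, ← ENNReal.ofReal_mul (by positivity), ← ENNReal.ofReal_mul (by positivity),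
      ← ENNReal.ofReal_mul (by positivity)]
    congr 1
    rw [show ‖h‖ ^ 2 / (4 * (1 / (4 * b))) = ‖h‖ ^ 2 * b by field_simp,
      show 4 * Real.pi * (1 / (4 * b)) = Real.pi / b by field_simp,
      Real.div_rpow hpi.le hb0.le, one_div (4 * b), Real.inv_rpow (by positivity),
      ← Real.rpow_neg (by positivity), show -(-1 - s) = s + 1 by ring,
      Real.rpow_add_one (by positivity), Real.mul_rpow (by positivity) hb0.le,
      Real.rpow_neg hb0.le, Real.rpow_sub_one hb0.ne', Real.rpow_add hb0]
    have := (Real.rpow_pos_of_pos hb0 ((N : ℝ) / 2)).ne'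
    field_simp
  rw [setLIntegral_congr_fun measurableSet_Ioi e, lintegral_const_mul' _ _ ofReal_ne_top,
    lintegral_Ioi_rpow_mul_exp (by positivity) (by positivity),
    ← ENNReal.ofReal_mul (by positivity), lk, CNs]
  congr 1
  rw [one_div, Real.inv_rpow (by positivity), ← Real.rpow_natCast, ← Real.rpow_mul hn.le,
    show ((2 : ℕ) : ℝ) * ((N : ℝ) / 2 + s) = N + 2 * s by push_cast; ring, Real.rpow_neg hpi.le]
  have := (Real.rpow_pos_of_pos hn ((N : ℝ) + 2 * s)).ne'
  have := (Real.rpow_pos_of_pos hpi ((N : ℝ) / 2)).ne'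
  field_simp

theorem tk_toReal_le {N : ℕ} (hN : 2 ≤ N) {s : ℝ} (hs : s ∈ Ioo (0 : ℝ) 1) {δ : ℝ} (hδ : 0 ≤ δ)
    {h : Eu N} (hh : h ≠ 0) : (tk N s δ h).toReal ≤ lk N s h := by
  refine ENNReal.toReal_le_of_le_ofReal (lk_nonneg hN hs h) ?_
  rw [← tk_zero hN hs hh]
  exact lintegral_mono_set (Ioi_subset_Ioi hδ)

theorem tendsto_tk {N : ℕ} (hN : 2 ≤ N) {s : ℝ} (hs : s ∈ Ioo (0 : ℝ) 1) {h : Eu N}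
    (hh : h ≠ 0) : Tendsto (fun δ => (tk N s δ h).toReal) (nhdsWithin 0 (Ioi 0))
      (nhds (lk N s h)) := by
  have hfin : tk N s 0 h ≠ ⊤ := by rw [tk_zero hN hs hh]; exact ofReal_ne_top
  have hl : (tk N s 0 h).toReal = lk N s h := by
    rw [tk_zero hN hs hh, ENNReal.toReal_ofReal (lk_nonneg hN hs h)]
  rw [← hl]
  refine (ENNReal.tendsto_toReal hfin).comp ?_
  have e : ∀ δ, 0 < δ → tk N s δ h = ∫⁻ τ in Ioi 0, (Ioi δ).indicator
      (fun τ => levyW s τ * hk N τ h) τ := by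
    intro δ hδ
    rw [setLIntegral_indicator measurableSet_Ioi, inter_eq_left.2 (Ioi_subset_Ioi hδ.le)]
    rfl
  have : Tendsto (fun δ => ∫⁻ τ in Ioi 0, (Ioi δ).indicator
      (fun τ => levyW s τ * hk N τ h) τ) (nhdsWithin 0 (Ioi 0)) (nhds (tk N s 0 h)) := by
    refine tendsto_lintegral_filter_of_dominated_convergence (fun τ => levyW s τ * hk N τ h)
      (Eventually.of_forall fun δ => Measurable.indicator (by fun_prop) measurableSet_Ioi)
      (Eventually.of_forall fun δ => Eventually.of_forall fun τ => indicator_le_self _ _ τ)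
      hfin ?_
    filter_upwards [ae_restrict_mem measurableSet_Ioi] with τ hτ
    refine tendsto_const_nhds.congr' ?_
    filter_upwards [mem_nhdsWithin_of_mem_nhds (Iio_mem_nhds (mem_Ioi.1 hτ))] with δ hδ
    rw [indicator_of_mem (by exact hδ)]
  refine this.congr' ?_
  filter_upwards [self_mem_nhdsWithin] with δ hδ
  exact (e δ hδ).symm

theorem lintegral_mix {N : ℕ} {S : Set ℝ} (hS : MeasurableSet S) (hS0 : S ⊆ Ioi 0)
    {a : ℝ → ℝ≥0∞} (ha : Measurable a) : ∫⁻ y, mix N S a y = ∫⁻ τ in S, a τ := by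
  unfold mix
  rw [lintegral_lintegral_swap (by fun_prop)]
  refine setLIntegral_congr_fun hS fun τ hτ => ?_
  rw [lintegral_const_mul _ (by fun_prop), lintegral_hk (hS0 hτ), mul_one]

theorem lintegral_tk {N : ℕ} {s : ℝ} (hs : s ∈ Ioo (0 : ℝ) 1) {δ : ℝ} (hδ : 0 < δ) :
    ∫⁻ y : Eu N, tk N s δ y = ENNReal.ofReal (δ ^ (-s) / Real.Gamma (1 - s)) := by
  unfold tk
  rw [lintegral_mix measurableSet_Ioi (Ioi_subset_Ioi hδ.le) (by fun_prop), lintegral_levyW hs hδ]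

/-- The approximate identity attached to the truncated kernel. -/
noncomputable def ai (N : ℕ) (s δ : ℝ) (h : Eu N) : ℝ≥0∞ := mix N (Ioi 0) (thetaW s δ) h

@[fun_prop]
theorem measurable_ai (N : ℕ) (s δ : ℝ) : Measurable (ai N s δ) :=
  measurable_mix (by fun_prop)

theorem lintegral_ai {N : ℕ} {s : ℝ} (hs : s ∈ Ioo (0 : ℝ) 1) {δ : ℝ} (hδ : 0 < δ) :
    ∫⁻ y : Eu N, ai N s δ y = 1 := by
  unfold ai
  rw [lintegral_mix measurableSet_Ioi subset_rfl (by fun_prop), lintegral_thetaW hs hδ]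

theorem lintegral_hk_mul {N : ℕ} {T : ℝ} (hT : 0 < T) (φ : Eu N → ℝ≥0∞) (hφ : Measurable φ) :
    ∫⁻ h, hk N T h * φ h = ∫⁻ h, hk N 1 h * φ (Real.sqrt T • h) := by
  have hT' : 0 < Real.sqrt T := Real.sqrt_pos.2 hT
  have hm := Measure.map_addHaar_smul (volume : Measure (Eu N)) hT'.ne'
  have h1 : ∫⁻ h, hk N T (Real.sqrt T • h) * φ (Real.sqrt T • h) =
      ENNReal.ofReal |(Real.sqrt T ^ N)⁻¹| * ∫⁻ h, hk N T h * φ h := by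
    rw [← lintegral_map (f := fun h => hk N T h * φ h) (by fun_prop) (measurable_const_smul _), hm,
      lintegral_smul_measure]
    simp
  have h2 : ∀ h : Eu N, hk N T (Real.sqrt T • h) =
      ENNReal.ofReal |(Real.sqrt T ^ N)⁻¹| * hk N 1 h := by
    intro h
    have hpi := Real.pi_pos
    rw [hk, hk, ← ENNReal.ofReal_mul (by positivity), norm_smul, mul_pow, Real.norm_eq_abs, sq_abs,
      Real.sq_sqrt hT.le, abs_of_pos (by positivity), ← mul_assoc]
    congr 2
    · rw [Real.mul_rpow (by positivity) hT.le, Real.sqrt_eq_rpow, ← Real.rpow_natCast,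
        ← Real.rpow_mul hT.le, ← Real.rpow_neg hT.le]
      rw [mul_one, mul_comm]
      congr 2
      ring
    · field_simp
  simp_rw [h2, mul_assoc] at h1
  rw [lintegral_const_mul' _ _ ofReal_ne_top] at h1
  refine ((ENNReal.mul_right_inj ?_ ofReal_ne_top).1 h1).symm
  simp only [ne_eq, ENNReal.ofReal_eq_zero, not_le]
  positivity

theorem lintegral_ai_mul {N : ℕ} {s : ℝ} (hs : s ∈ Ioo (0 : ℝ) 1) {δ : ℝ} (hδ : 0 < δ)
    (φ : Eu N → ℝ≥0∞) (hφ : Measurable φ) :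
    ∫⁻ h, ai N s δ h * φ h = ∫⁻ T in Ioi 0, thetaW s 1 T *
      ∫⁻ h, hk N 1 h * φ (Real.sqrt (δ * T) • h) := by
  have h1 : 0 < Real.Gamma (1 - s) := Real.Gamma_pos_of_pos (by linarith [hs.2])
  have hG : 0 < Real.Gamma s := Real.Gamma_pos_of_pos hs.1
  have e0 : ∫⁻ h, ai N s δ h * φ h = ∫⁻ T in Ioi 0, thetaW s δ T * ∫⁻ h, hk N T h * φ h := by
    have := cv_mix (N := N) (S := Ioi 0) (measurable_thetaW s δ) hφ 0
    rw [cv_zero (mix_neg _ _)] at this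
    simp_rw [cv_zero (hk_neg _)] at this
    exact this
  rw [e0, lintegral_Ioi_comp_mul _ hδ, ← lintegral_const_mul' _ _ ofReal_ne_top]
  refine setLIntegral_congr_fun measurableSet_Ioi fun T hT => ?_
  have hT0 : (0 : ℝ) < T := hT
  rw [lintegral_hk_mul (by positivity) φ hφ, ← mul_assoc]
  congr 1
  rw [thetaW, thetaW, ← ENNReal.ofReal_mul hδ.le]
  congr 1
  rw [show δ * T - δ = δ * (T - 1) by ring, show (0 : ℝ) = δ * 0 by ring,
    ← mul_max_of_nonneg _ _ hδ.le, Real.mul_rpow hδ.le hT0.le,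
    Real.mul_rpow hδ.le (le_max_right _ _), Real.rpow_neg hδ.le, Real.one_rpow]
  have := (Real.rpow_pos_of_pos hδ s).ne'
  simp only [mul_zero]
  field_simp

theorem tendsto_lintegral_ai_mul {N : ℕ} {s : ℝ} (hs : s ∈ Ioo (0 : ℝ) 1) {φ : Eu N → ℝ≥0∞}
    (hφ : Measurable φ) {M : ℝ≥0∞} (hM : M ≠ ⊤) (hφM : ∀ h, φ h ≤ M)
    (hφ0 : Tendsto φ (nhds 0) (nhds 0)) :
    Tendsto (fun δ => ∫⁻ h, ai N s δ h * φ h) (nhdsWithin 0 (Ioi 0)) (nhds 0) := by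
  have key : Tendsto (fun δ => ∫⁻ T in Ioi 0, thetaW s 1 T *
      ∫⁻ h, hk N 1 h * φ (Real.sqrt (δ * T) • h)) (nhdsWithin 0 (Ioi 0))
      (nhds (∫⁻ T in Ioi (0 : ℝ), 0)) := by
    have bd : ∀ c : ℝ, ∫⁻ h, hk N 1 h * φ (c • h) ≤ M := by
      intro c
      calc ∫⁻ h, hk N 1 h * φ (c • h) ≤ ∫⁻ h, hk N 1 h * M :=
            lintegral_mono fun h => by gcongr; exact hφM _
        _ = M := by rw [lintegral_mul_const' _ _ hM, lintegral_hk one_pos, one_mul]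
    refine tendsto_lintegral_filter_of_dominated_convergence (fun T => thetaW s 1 T * M)
      (Eventually.of_forall fun δ => ?_)
      (Eventually.of_forall fun δ => Eventually.of_forall fun T => ?_) ?_ ?_
    · have : Measurable fun T : ℝ => ∫⁻ h, hk N 1 h * φ (Real.sqrt (δ * T) • h) :=
        Measurable.lintegral_prod_right'
          (f := fun q : ℝ × Eu N => hk N 1 q.2 * φ (Real.sqrt (δ * q.1) • q.2)) (by fun_prop)
      fun_prop
    · gcongr
      exact bd _
    · rw [lintegral_mul_const' _ _ hM, lintegral_thetaW hs one_pos, one_mul]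
      exact hM
    · refine Eventually.of_forall fun T => ?_
      rw [← mul_zero (thetaW s 1 T)]
      refine ENNReal.Tendsto.const_mul ?_ (Or.inr ofReal_ne_top)
      rw [← lintegral_zero (α := Eu N) (μ := volume)]
      refine tendsto_lintegral_filter_of_dominated_convergence (fun h => hk N 1 h * M)
        (Eventually.of_forall fun δ => by fun_prop)
        (Eventually.of_forall fun δ => Eventually.of_forall fun h => by gcongr; exact hφM _) ?_
        (Eventually.of_forall fun h => ?_)
      · rw [lintegral_mul_const' _ _ hM, lintegral_hk one_pos, one_mul]
        exact hM
      · rw [← mul_zero (hk N 1 h)]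
        refine ENNReal.Tendsto.const_mul (hφ0.comp ?_) (Or.inr ofReal_ne_top)
        have : Tendsto (fun δ => Real.sqrt (δ * T) • h) (nhds 0) (nhds (Real.sqrt (0 * T) • h)) :=
          Continuous.tendsto (by fun_prop) 0
        simp only [zero_mul, Real.sqrt_zero, zero_smul] at this
        exact this.mono_left nhdsWithin_le_nhds
  rw [lintegral_zero] at key
  refine key.congr' ?_
  filter_upwards [self_mem_nhdsWithin] with δ hδ
  exact (lintegral_ai_mul hs hδ φ hφ).symm

theorem green_mul_add_cv_ai {N : ℕ} (hN : 2 ≤ N) {s : ℝ} (hs : s ∈ Ioo (0 : ℝ) 1) {r : ℝ}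
    (hr : 0 < r) {δ : ℝ} (hδ : 0 < δ) {f : Eu N → ℝ≥0∞} (hf : Measurable f)
    (hfin : cv (mix N (Ioi 0) (rieszW s)) f 0 ≠ ⊤) :
    ENNReal.ofReal (δ ^ (-s) / Real.Gamma (1 - s)) * (∫⁻ y, green N s r y * f y) +
        ∫⁻ y, etaE N s r y * cv (ai N s δ) f y =
      (∫⁻ y, green N s r y * cv (tk N s δ) f y) + cv (ai N s δ) f 0 := by
  have mt : Measurable (cv (tk N s δ) f) := measurable_cv (by fun_prop) hf
  have mθ : Measurable (cv (ai N s δ) f) := measurable_cv (by fun_prop) hf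
  have mΦ := measurable_mix (N := N) (S := Ioi 0) (measurable_rieszW s)
  have a := lintegral_green_mul_add hN hs hr hf
  have b := lintegral_green_mul_add hN hs hr mt
  have c : ∀ y, cv (mix N (Ioi 0) (rieszW s)) (cv (tk N s δ) f) y + cv (ai N s δ) f y =
      ENNReal.ofReal (δ ^ (-s) / Real.Gamma (1 - s)) * cv (mix N (Ioi 0) (rieszW s)) f y :=
    fun y => cv_rieszW_levyW hs hδ hf y
  set m := ENNReal.ofReal (δ ^ (-s) / Real.Gamma (1 - s)) with hm
  have a' : m * (∫⁻ y, green N s r y * f y) +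
      ((∫⁻ y, etaE N s r y * cv (mix N (Ioi 0) (rieszW s)) (cv (tk N s δ) f) y) +
        ∫⁻ y, etaE N s r y * cv (ai N s δ) f y) =
      cv (mix N (Ioi 0) (rieszW s)) (cv (tk N s δ) f) 0 + cv (ai N s δ) f 0 := by
    rw [c, ← a, mul_add, ← lintegral_add_left (by
      have := measurable_cv mΦ mt; fun_prop)]
    congr 1
    rw [← lintegral_const_mul' m _ ofReal_ne_top]
    refine lintegral_congr fun y => ?_
    rw [← mul_add, c]
    ring
  set X := ∫⁻ y, etaE N s r y * cv (mix N (Ioi 0) (rieszW s)) (cv (tk N s δ) f) y with hX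
  have hXfin : X ≠ ⊤ := by
    have h1 : X ≤ cv (mix N (Ioi 0) (rieszW s)) (cv (tk N s δ) f) 0 := by
      rw [← b]; exact le_add_self
    have h2 : cv (mix N (Ioi 0) (rieszW s)) (cv (tk N s δ) f) 0 ≤
        m * cv (mix N (Ioi 0) (rieszW s)) f 0 := by
      rw [← c]; exact le_self_add
    exact ne_top_of_le_ne_top (ENNReal.mul_ne_top ofReal_ne_top hfin) (h1.trans h2)
  rw [← b] at a'
  refine (ENNReal.add_right_inj hXfin).1 ?_
  calc _ = _ := by ring
    _ = _ := a'
    _ = _ := by ring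

theorem cv_le {N : ℕ} {k f : Eu N → ℝ≥0∞} {M : ℝ≥0∞} (hM : M ≠ ⊤) (hf : ∀ y, f y ≤ M) (x : Eu N) :
    cv k f x ≤ (∫⁻ y, k y) * M := by
  calc cv k f x ≤ ∫⁻ y, k (x - y) * M := lintegral_mono fun y => by gcongr; exact hf y
    _ = (∫⁻ y, k y) * M := by
      rw [lintegral_mul_const' _ _ hM, lintegral_sub_left_eq_self k x]

theorem cv_rieszW_ne_top {N : ℕ} (hN : 2 ≤ N) {s : ℝ} (hs : s ∈ Ioo (0 : ℝ) 1)
    {f : Eu N → ℝ≥0∞} (hf : Measurable f) {M : ℝ≥0∞} (hM : M ≠ ⊤) (hfM : ∀ y, f y ≤ M)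
    (hint : ∫⁻ y, f y ≠ ⊤) (x : Eu N) : cv (mix N (Ioi 0) (rieszW s)) f x ≠ ⊤ := by
  rw [cv_mix (by fun_prop) hf]
  refine (lintegral_rieszW_lt_top hs (A := M) (B := (∫⁻ y, f y).toReal) hM (fun τ hτ => ?_)
    fun τ hτ => ?_).ne
  · refine (cv_le hM hfM x).trans ?_
    rw [lintegral_hk hτ, one_mul]
  · have hτ0 : 0 < τ := by linarith
    calc cv (hk N τ) f x ≤ ∫⁻ y, ENNReal.ofReal (τ⁻¹) * f y := by
          refine lintegral_mono fun y => ?_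
          gcongr
          refine (hk_le τ hτ0 _).trans (ENNReal.ofReal_le_ofReal ?_)
          simpa using rpow_le_inv hN hτ
      _ = ENNReal.ofReal ((∫⁻ y, f y).toReal * τ⁻¹) := by
          rw [lintegral_const_mul' _ _ ofReal_ne_top, ENNReal.ofReal_mul toReal_nonneg,
            ENNReal.ofReal_toReal hint, mul_comm]

theorem toReal_lintegral_mul_sub {α : Type*} [MeasurableSpace α] {μ : Measure α}
    {w P Q : α → ℝ≥0∞} (mw : Measurable w) (mP : Measurable P) (mQ : Measurable Q)
    (hP : ∫⁻ x, w x * P x ∂μ ≠ ⊤) (hQ : ∫⁻ x, w x * Q x ∂μ ≠ ⊤) :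
    (∫⁻ x, w x * P x ∂μ).toReal - (∫⁻ x, w x * Q x ∂μ).toReal =
      ∫ x, (w x).toReal * ((P x).toReal - (Q x).toReal) ∂μ := by
  rw [← integral_toReal (by fun_prop) (ae_lt_top (by fun_prop) hP),
    ← integral_toReal (by fun_prop) (ae_lt_top (by fun_prop) hQ),
    ← integral_sub (integrable_toReal_of_lintegral_ne_top (by fun_prop) hP)
      (integrable_toReal_of_lintegral_ne_top (by fun_prop) hQ)]
  simp only [ENNReal.toReal_mul, mul_sub]

/-- Real-valued convolution with an extended nonnegative kernel. -/
noncomputable def cvR {N : ℕ} (k : Eu N → ℝ≥0∞) (v : Eu N → ℝ) (z : Eu N) : ℝ :=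
  ∫ y, (k (z - y)).toReal * v y

theorem toReal_ofReal_sub (a : ℝ) :
    (ENNReal.ofReal a).toReal - (ENNReal.ofReal (-a)).toReal = a := by
  rw [ENNReal.toReal_ofReal', ENNReal.toReal_ofReal']
  rcases le_total a 0 with h | h
  · rw [max_eq_right h, max_eq_left (by linarith)]; ring
  · rw [max_eq_left h, max_eq_right (by linarith)]; ring

theorem toReal_cv_sub {N : ℕ} {k : Eu N → ℝ≥0∞} (mk : Measurable k) (hk : ∫⁻ y, k y ≠ ⊤)
    {v : Eu N → ℝ} (hv : Measurable v) {B : ℝ} (hB : ∀ y, |v y| ≤ B) (z : Eu N) :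
    (cv k (fun y => ENNReal.ofReal (v y)) z).toReal -
      (cv k (fun y => ENNReal.ofReal (-v y)) z).toReal = cvR k v z := by
  have h1 : ∀ y, ENNReal.ofReal (v y) ≤ ENNReal.ofReal B := fun y =>
    ENNReal.ofReal_le_ofReal ((le_abs_self _).trans (hB y))
  have h2 : ∀ y, ENNReal.ofReal (-v y) ≤ ENNReal.ofReal B := fun y =>
    ENNReal.ofReal_le_ofReal ((neg_le_abs _).trans (hB y))
  have hfin := ENNReal.mul_ne_top hk (ofReal_ne_top (r := B))
  unfold cv
  rw [toReal_lintegral_mul_sub (by fun_prop) (by fun_prop) (by fun_prop)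
    (ne_top_of_le_ne_top hfin (cv_le ofReal_ne_top h1 z))
    (ne_top_of_le_ne_top hfin (cv_le ofReal_ne_top h2 z))]
  simp only [toReal_ofReal_sub]
  rfl

theorem lintegral_mul_le {α : Type*} [MeasurableSpace α] {μ : Measure α} {w P : α → ℝ≥0∞}
    {M : ℝ≥0∞} (hM : M ≠ ⊤) (hP : ∀ x, P x ≤ M) : ∫⁻ x, w x * P x ∂μ ≤ (∫⁻ x, w x ∂μ) * M := by
  rw [← lintegral_mul_const' _ _ hM]
  exact lintegral_mono fun x => by gcongr; exact hP x

theorem green_mul_add_cvR_ai {N : ℕ} (hN : 2 ≤ N) {s : ℝ} (hs : s ∈ Ioo (0 : ℝ) 1) {r : ℝ}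
    (hr : 0 < r) {δ : ℝ} (hδ : 0 < δ) {v : Eu N → ℝ} (hv : Measurable v) {B : ℝ}
    (hB : ∀ y, |v y| ≤ B) (hint : Integrable v) :
    δ ^ (-s) / Real.Gamma (1 - s) * (∫ y, (green N s r y).toReal * v y) +
        ∫ y, (etaE N s r y).toReal * cvR (ai N s δ) v y =
      (∫ y, (green N s r y).toReal * cvR (tk N s δ) v y) + cvR (ai N s δ) v 0 := by
  have hΓ : 0 < Real.Gamma (1 - s) := Real.Gamma_pos_of_pos (by linarith [hs.2])
  have key : ∀ w : Eu N → ℝ, Measurable w → (∀ y, |w y| ≤ B) → Integrable w →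
      let f : Eu N → ℝ≥0∞ := fun y => ENNReal.ofReal (w y)
      Measurable f ∧
      (∫⁻ y, green N s r y * f y) ≠ ⊤ ∧
      (∫⁻ y, etaE N s r y * cv (ai N s δ) f y) ≠ ⊤ ∧
      (∫⁻ y, green N s r y * cv (tk N s δ) f y) ≠ ⊤ ∧
      cv (ai N s δ) f 0 ≠ ⊤ ∧
      δ ^ (-s) / Real.Gamma (1 - s) * (∫⁻ y, green N s r y * f y).toReal +
        (∫⁻ y, etaE N s r y * cv (ai N s δ) f y).toReal =
      (∫⁻ y, green N s r y * cv (tk N s δ) f y).toReal + (cv (ai N s δ) f 0).toReal := by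
    intro w mw hw iw f
    have mf : Measurable f := by fun_prop
    have hf : ∀ y, f y ≤ ENNReal.ofReal B := fun y =>
      ENNReal.ofReal_le_ofReal ((le_abs_self _).trans (hw y))
    have hfi : ∫⁻ y, f y ≠ ⊤ := by
      refine ne_top_of_le_ne_top iw.2.ne (lintegral_mono fun y => ?_)
      rw [← ofReal_norm]
      exact ENNReal.ofReal_le_ofReal (le_abs_self _)
    have h := green_mul_add_cv_ai hN hs hr hδ mf
      (cv_rieszW_ne_top hN hs mf ofReal_ne_top hf hfi 0)
    have hai : ∀ y, cv (ai N s δ) f y ≤ ENNReal.ofReal B := fun y => by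
      simpa [lintegral_ai hs hδ] using cv_le (k := ai N s δ) ofReal_ne_top hf y
    have htk : ∀ y, cv (tk N s δ) f y ≤
        ENNReal.ofReal (δ ^ (-s) / Real.Gamma (1 - s)) * ENNReal.ofReal B := fun y => by
      simpa [lintegral_tk hs hδ] using cv_le (k := tk N s δ) ofReal_ne_top hf y
    have f1 : (∫⁻ y, green N s r y * f y) ≠ ⊤ := by
      refine ne_top_of_le_ne_top ?_ (lintegral_mul_le ofReal_ne_top hf)
      rw [lintegral_green hN hs hr]
      finiteness
    have f2 : (∫⁻ y, etaE N s r y * cv (ai N s δ) f y) ≠ ⊤ := by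
      refine ne_top_of_le_ne_top ?_ (lintegral_mul_le ofReal_ne_top hai)
      rw [lintegral_etaE hN hs hr]
      finiteness
    have f3 : (∫⁻ y, green N s r y * cv (tk N s δ) f y) ≠ ⊤ := by
      refine ne_top_of_le_ne_top ?_ (lintegral_mul_le (by finiteness) htk)
      rw [lintegral_green hN hs hr]
      finiteness
    have f4 : cv (ai N s δ) f 0 ≠ ⊤ := ne_top_of_le_ne_top ofReal_ne_top (hai 0)
    refine ⟨mf, f1, f2, f3, f4, ?_⟩
    rw [← ENNReal.toReal_add f3 f4, ← h, ENNReal.toReal_add (by finiteness) f2,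
      ENNReal.toReal_mul, ENNReal.toReal_ofReal (by positivity)]
  obtain ⟨p0, p1, p2, p3, p4, p5⟩ := key v hv hB hint
  obtain ⟨q0, q1, q2, q3, q4, q5⟩ := key (fun y => -v y) hv.neg (by simpa using hB) hint.neg
  have mai : Measurable (ai N s δ) := by fun_prop
  have mtk : Measurable (tk N s δ) := by fun_prop
  have e1 := toReal_lintegral_mul_sub (measurable_green N s r) p0 q0 p1 q1
  have e2 := toReal_lintegral_mul_sub (measurable_etaE N s r) (measurable_cv mai p0)
    (measurable_cv mai q0) p2 q2
  have e3 := toReal_lintegral_mul_sub (measurable_green N s r) (measurable_cv mtk p0)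
    (measurable_cv mtk q0) p3 q3
  simp only [toReal_ofReal_sub] at e1
  simp only [toReal_cv_sub mai (by rw [lintegral_ai hs hδ]; exact one_ne_top) hv hB] at e2
  simp only [toReal_cv_sub mtk (by rw [lintegral_tk hs hδ]; exact ofReal_ne_top) hv hB] at e3
  rw [← e1, ← e2, ← e3,
    ← toReal_cv_sub mai (by rw [lintegral_ai hs hδ]; exact one_ne_top) hv hB]
  linarith

/-- The symmetric second difference. -/
def sd {N : ℕ} (v : Eu N → ℝ) (z h : Eu N) : ℝ := 2 * v z - v (z + h) - v (z - h)

theorem integrable_toReal_mul {N : ℕ} {k : Eu N → ℝ≥0∞} (mk : Measurable k) (hk : ∫⁻ y, k y ≠ ⊤)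
    {v : Eu N → ℝ} (hv : AEStronglyMeasurable v) {B : ℝ} (hB : ∀ y, |v y| ≤ B) :
    Integrable fun h => (k h).toReal * v h :=
  (integrable_toReal_of_lintegral_ne_top mk.aemeasurable hk).mul_bdd hv
    (Eventually.of_forall hB)

theorem cvR_eq {N : ℕ} (k : Eu N → ℝ≥0∞) (v : Eu N → ℝ) (z : Eu N) :
    cvR k v z = ∫ h, (k h).toReal * v (z - h) := by
  unfold cvR
  rw [← integral_sub_left_eq_self _ volume z]
  simp

theorem cvR_eq_add {N : ℕ} {k : Eu N → ℝ≥0∞} (hk : ∀ y, k (-y) = k y) (v : Eu N → ℝ) (z : Eu N) :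
    cvR k v z = ∫ h, (k h).toReal * v (z + h) := by
  rw [cvR_eq, ← integral_neg_eq_self]
  simp [hk]

theorem measurable_cvR {N : ℕ} {k : Eu N → ℝ≥0∞} (mk : Measurable k) (hk : ∫⁻ y, k y ≠ ⊤)
    {v : Eu N → ℝ} (hv : Measurable v) {B : ℝ} (hB : ∀ y, |v y| ≤ B) : Measurable (cvR k v) := by
  have : cvR k v = fun z => (cv k (fun y => ENNReal.ofReal (v y)) z).toReal -
      (cv k (fun y => ENNReal.ofReal (-v y)) z).toReal :=
    funext fun z => (toReal_cv_sub mk hk hv hB z).symm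
  rw [this]
  exact (measurable_cv mk (by fun_prop)).ennreal_toReal.sub
    (measurable_cv mk (by fun_prop)).ennreal_toReal

theorem integral_toReal_eq {N : ℕ} {k : Eu N → ℝ≥0∞} (mk : Measurable k) (hk : ∫⁻ y, k y ≠ ⊤) :
    ∫ y, (k y).toReal = (∫⁻ y, k y).toReal :=
  integral_toReal mk.aemeasurable (ae_lt_top mk hk)

theorem mul_sub_cvR {N : ℕ} {k : Eu N → ℝ≥0∞} (mk : Measurable k) (hk : ∫⁻ y, k y ≠ ⊤)
    (hk' : ∀ y, k (-y) = k y) {v : Eu N → ℝ} (hv : Measurable v) {B : ℝ} (hB : ∀ y, |v y| ≤ B)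
    (z : Eu N) : (∫⁻ y, k y).toReal * v z - cvR k v z =
      1 / 2 * ∫ h, (k h).toReal * sd v z h := by
  have i1 := integrable_toReal_mul mk hk (v := fun h => v (z + h))
    (hv.comp (measurable_const_add z)).aestronglyMeasurable (fun y => hB _)
  have i2 := integrable_toReal_mul mk hk (v := fun h => v (z - h))
    (hv.comp (measurable_const_sub z)).aestronglyMeasurable (fun y => hB _)
  have i0 := (integrable_toReal_of_lintegral_ne_top mk.aemeasurable hk).mul_const (2 * v z)
  have e : ∀ h, (k h).toReal * sd v z h = (k h).toReal * (2 * v z) -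
      (k h).toReal * v (z + h) - (k h).toReal * v (z - h) := fun h => by unfold sd; ring
  simp_rw [e]
  rw [integral_sub (by exact i0.sub i1) i2, integral_sub i0 i1, ← cvR_eq, ← cvR_eq_add hk',
    integral_mul_const, integral_toReal_eq mk hk]
  ring

theorem tendsto_cvR_ai {N : ℕ} {s : ℝ} (hs : s ∈ Ioo (0 : ℝ) 1) {v : Eu N → ℝ}
    (hv : Continuous v) {B : ℝ} (hB : ∀ y, |v y| ≤ B) (z : Eu N) :
    Tendsto (fun δ => cvR (ai N s δ) v z) (nhdsWithin 0 (Ioi 0)) (nhds (v z)) := by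
  have h0 := tendsto_lintegral_ai_mul (N := N) hs
    (φ := fun h => ENNReal.ofReal |v (z - h) - v z|) (by fun_prop) (M := ENNReal.ofReal (B + B))
    ofReal_ne_top (fun h => ENNReal.ofReal_le_ofReal
      ((abs_sub _ _).trans (add_le_add (hB _) (hB _)))) (by
      have : Tendsto (fun h => ENNReal.ofReal |v (z - h) - v z|) (nhds 0)
        (nhds (ENNReal.ofReal |v (z - 0) - v z|)) :=
      (ENNReal.continuous_ofReal.comp (by fun_prop)).tendsto 0
      simpa using this)
  have h1 := (ENNReal.tendsto_toReal zero_ne_top).comp h0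
  rw [toReal_zero] at h1
  rw [tendsto_iff_norm_sub_tendsto_zero]
  refine squeeze_zero' (Eventually.of_forall fun _ => norm_nonneg _) ?_ h1
  filter_upwards [self_mem_nhdsWithin] with δ hδ
  have mai := measurable_ai N s δ
  have hfin : ∫⁻ h, ai N s δ h ≠ ⊤ := by rw [lintegral_ai hs hδ]; exact one_ne_top
  have e : cvR (ai N s δ) v z - v z = ∫ h, (ai N s δ h).toReal * (v (z - h) - v z) := by
    simp_rw [mul_sub]
    rw [integral_sub (integrable_toReal_mul mai hfin (by fun_prop) fun y => hB _)
      ((integrable_toReal_of_lintegral_ne_top mai.aemeasurable hfin).mul_const _),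
      ← cvR_eq, integral_mul_const, integral_toReal_eq mai hfin, lintegral_ai hs hδ]
    simp
  rw [e]
  refine (norm_integral_le_lintegral_norm _).trans (le_of_eq ?_)
  simp only [Function.comp_apply]
  congr 1
  refine lintegral_congr_ae ?_
  filter_upwards [ae_lt_top mai hfin] with h hh
  rw [norm_mul, ENNReal.ofReal_mul (norm_nonneg _), Real.norm_of_nonneg toReal_nonneg,
    ENNReal.ofReal_toReal hh.ne, Real.norm_eq_abs]

theorem abs_cvR_le {N : ℕ} {k : Eu N → ℝ≥0∞} (mk : Measurable k) (hk : ∫⁻ y, k y ≠ ⊤)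
    {v : Eu N → ℝ} {B : ℝ} (hB : ∀ y, |v y| ≤ B) (z : Eu N) :
    |cvR k v z| ≤ (∫⁻ y, k y).toReal * B := by
  rw [cvR_eq, ← integral_toReal_eq mk hk, ← integral_mul_const, ← Real.norm_eq_abs]
  refine norm_integral_le_of_norm_le
    ((integrable_toReal_of_lintegral_ne_top mk.aemeasurable hk).mul_const _)
    (Eventually.of_forall fun h => ?_)
  rw [norm_mul, Real.norm_of_nonneg toReal_nonneg]
  gcongr
  exact hB _

theorem mean_value_of_continuous {N : ℕ} (hN : 2 ≤ N) {s : ℝ} (hs : s ∈ Ioo (0 : ℝ) 1) {r : ℝ}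
    (hr : 0 < r) {v : Eu N → ℝ} (hv : Continuous v) {B : ℝ} (hB : ∀ y, |v y| ≤ B)
    (hint : Integrable v) {w : Eu N → ℝ}
    (hw : ∀ z, ‖z‖ < r → ∀ h, |sd v z h| ≤ w h) (hwi : Integrable fun h => lk N s h * w h) :
    v 0 = (∫ y, (etaE N s r y).toReal * v y) +
      ∫ z, (green N s r z).toReal * (1 / 2 * ∫ h, lk N s h * sd v z h) := by
  have hΓ : 0 < Real.Gamma (1 - s) := Real.Gamma_pos_of_pos (by linarith [hs.2])
  have hnt : Nontrivial (Eu N) := by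
    have : Nonempty (Fin N) := ⟨⟨0, by omega⟩⟩
    infer_instance
  have hne : ∀ᵐ h : Eu N, h ≠ 0 := Measure.ae_ne volume 0
  have mG := measurable_green N s r
  have mη := measurable_etaE N s r
  have fG : ∫⁻ y, green N s r y ≠ ⊤ := by rw [lintegral_green hN hs hr]; exact ofReal_ne_top
  have fη : ∫⁻ y, etaE N s r y ≠ ⊤ := by rw [lintegral_etaE hN hs hr]; exact one_ne_top
  have iG := integrable_toReal_of_lintegral_ne_top mG.aemeasurable fG
  have iη := integrable_toReal_of_lintegral_ne_top mη.aemeasurable fη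
  have fai : ∀ δ, 0 < δ → ∫⁻ h, ai N s δ h ≠ ⊤ := fun δ hδ => by
    rw [lintegral_ai hs hδ]; exact one_ne_top
  have ftk : ∀ δ, 0 < δ → ∫⁻ h, tk N s δ h ≠ ⊤ := fun δ hδ => by
    rw [lintegral_tk hs hδ]; exact ofReal_ne_top
  have etk : ∀ δ, 0 < δ → (∫⁻ h : Eu N, tk N s δ h).toReal = δ ^ (-s) / Real.Gamma (1 - s) :=
    fun δ hδ => by rw [lintegral_tk hs hδ, ENNReal.toReal_ofReal (by positivity)]
  have id : ∀ δ, 0 < δ → ∫ z, (green N s r z).toReal *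
      (1 / 2 * ∫ h, (tk N s δ h).toReal * sd v z h) =
      cvR (ai N s δ) v 0 - ∫ y, (etaE N s r y).toReal * cvR (ai N s δ) v y := by
    intro δ hδ
    have mtk := measurable_tk N s δ
    have h1 := green_mul_add_cvR_ai hN hs hr hδ hv.measurable hB hint
    rw [← etk δ hδ, ← integral_const_mul] at h1
    simp_rw [← mul_sub_cvR mtk (ftk δ hδ) (mix_neg _ _) hv.measurable hB, mul_sub]
    rw [integral_sub _ (integrable_toReal_mul mG fG
      (measurable_cvR mtk (ftk δ hδ) hv.measurable hB).aestronglyMeasurable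
      (abs_cvR_le mtk (ftk δ hδ) hB))]
    · simp_rw [mul_left_comm (_ : ℝ) (ENNReal.toReal (∫⁻ y, _))]
      linarith
    · simp_rw [mul_left_comm (_ : ℝ) (ENNReal.toReal (∫⁻ y, _))]
      exact (integrable_toReal_mul mG fG (by fun_prop) hB).const_mul _
  have bw : ∀ z, ‖z‖ < r → ∀ δ, 0 < δ →
      ∀ᵐ h, ‖(tk N s δ h).toReal * sd v z h‖ ≤ lk N s h * w h := by
    intro z hz δ hδ
    filter_upwards [hne] with h hh
    rw [norm_mul, Real.norm_of_nonneg toReal_nonneg]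
    exact mul_le_mul (tk_toReal_le hN hs hδ.le hh) (hw z hz h) (norm_nonneg _) (lk_nonneg hN hs h)
  have lim1 : ∀ z, ‖z‖ < r → Tendsto (fun δ => ∫ h, (tk N s δ h).toReal * sd v z h)
      (nhdsWithin 0 (Ioi 0)) (nhds (∫ h, lk N s h * sd v z h)) := by
    intro z hz
    refine tendsto_integral_filter_of_dominated_convergence _ ?_ ?_ hwi ?_
    · refine Eventually.of_forall fun δ => ?_
      have := measurable_tk N s δ
      have : Measurable fun h => sd v z h := by unfold sd; fun_prop
      exact Measurable.aestronglyMeasurable (by fun_prop)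
    · filter_upwards [self_mem_nhdsWithin] with δ hδ
      exact bw z hz δ hδ
    · filter_upwards [hne] with h hh
      exact (tendsto_tk hN hs hh).mul_const _
  have lim2 : Tendsto (fun δ => ∫ z, (green N s r z).toReal *
      (1 / 2 * ∫ h, (tk N s δ h).toReal * sd v z h)) (nhdsWithin 0 (Ioi 0))
      (nhds (∫ z, (green N s r z).toReal * (1 / 2 * ∫ h, lk N s h * sd v z h))) := by
    refine tendsto_integral_filter_of_dominated_convergence
      (fun z => (green N s r z).toReal * (1 / 2 * ∫ h, lk N s h * w h)) ?_ ?_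
      (iG.mul_const _) ?_
    · filter_upwards [self_mem_nhdsWithin] with δ hδ
      have mtk := measurable_tk N s δ
      simp_rw [← mul_sub_cvR mtk (ftk δ hδ) (mix_neg _ _) hv.measurable hB]
      have := measurable_cvR mtk (ftk δ hδ) hv.measurable hB
      exact Measurable.aestronglyMeasurable (by fun_prop)
    · filter_upwards [self_mem_nhdsWithin] with δ hδ
      refine Eventually.of_forall fun z => ?_
      rw [norm_mul, Real.norm_of_nonneg toReal_nonneg]
      rcases lt_or_ge ‖z‖ r with hz | hz
      · rw [norm_mul, Real.norm_of_nonneg (by norm_num)]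
        gcongr
        exact norm_integral_le_of_norm_le hwi (bw z hz δ hδ)
      · simp [green_eq_zero hr.le hz]
    · refine Eventually.of_forall fun z => ?_
      rcases lt_or_ge ‖z‖ r with hz | hz
      · exact ((lim1 z hz).const_mul _).const_mul _
      · simp [green_eq_zero hr.le hz]
  have lim3 : Tendsto (fun δ => ∫ y, (etaE N s r y).toReal * cvR (ai N s δ) v y)
      (nhdsWithin 0 (Ioi 0)) (nhds (∫ y, (etaE N s r y).toReal * v y)) := by
    refine tendsto_integral_filter_of_dominated_convergence
      (fun y => (etaE N s r y).toReal * B) ?_ ?_ (iη.mul_const _) ?_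
    · filter_upwards [self_mem_nhdsWithin] with δ hδ
      have := measurable_cvR (measurable_ai N s δ) (fai δ hδ) hv.measurable hB
      exact Measurable.aestronglyMeasurable (by fun_prop)
    · filter_upwards [self_mem_nhdsWithin] with δ hδ
      refine Eventually.of_forall fun y => ?_
      rw [norm_mul, Real.norm_of_nonneg toReal_nonneg]
      gcongr
      have := abs_cvR_le (measurable_ai N s δ) (fai δ hδ) hB y
      rwa [lintegral_ai hs hδ, toReal_one, one_mul] at this
    · exact Eventually.of_forall fun y => (tendsto_cvR_ai hs hv hB y).const_mul _
  have lim4 := (tendsto_cvR_ai hs hv hB 0).sub lim3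
  have := tendsto_nhds_unique lim2 (lim4.congr' (by
    filter_upwards [self_mem_nhdsWithin] with δ hδ
    exact (id δ hδ).symm))
  linarith

theorem nontrivial_Eu {N : ℕ} (hN : 2 ≤ N) : Nontrivial (Eu N) := by
  have : Nonempty (Fin N) := ⟨⟨0, by omega⟩⟩
  infer_instance

theorem integrable_lk_mul {N : ℕ} (hN : 2 ≤ N) {s : ℝ} (hs : s ∈ Ioo (0 : ℝ) 1) {β d : ℝ}
    (hβ : 2 * s < β) (hd : 0 < d) (C M : ℝ) :
    Integrable fun h : Eu N => lk N s h * if ‖h‖ ≤ d then C * ‖h‖ ^ β else M := by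
  have := nontrivial_Eu hN
  unfold lk
  rw [integrable_fun_norm_addHaar volume (f := fun y : ℝ => CNs N s / y ^ ((N : ℝ) + 2 * s) *
    if y ≤ d then C * y ^ β else M), ← Ioc_union_Ioi_eq_Ioi hd.le, finrank_euclideanSpace_fin]
  have hp : ∀ y : ℝ, 0 < y → y ^ (N - 1) = y ^ ((N : ℝ) - 1) := fun y hy => by
    rw [← Nat.cast_pred (by omega), Real.rpow_natCast]
  refine IntegrableOn.union ?_ ?_
  · have h1 : IntegrableOn (fun y : ℝ => CNs N s * C * y ^ (β - 2 * s - 1)) (Ioc 0 d) := by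
      have := intervalIntegral.intervalIntegrable_rpow' (a := 0) (b := d) (r := β - 2 * s - 1)
        (by linarith)
      exact (this.1).const_mul _
    refine h1.congr_fun (fun y hy => ?_) measurableSet_Ioc
    have hy0 : 0 < y := hy.1
    simp only [hy.2, if_true, smul_eq_mul, hp y hy0]
    rw [show β - 2 * s - 1 = (N : ℝ) - 1 + β - (N + 2 * s) by ring, Real.rpow_sub hy0,
      Real.rpow_add hy0]
    ring
  · have h1 : IntegrableOn (fun y : ℝ => CNs N s * M * y ^ (-1 - 2 * s)) (Ioi d) :=
      (integrableOn_Ioi_rpow_of_lt (by linarith [hs.1]) hd).const_mul _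
    refine h1.congr_fun (fun y hy => ?_) measurableSet_Ioi
    have hy0 : 0 < y := hd.trans hy
    simp only [not_le.2 (mem_Ioi.1 hy), if_false, smul_eq_mul, hp y hy0]
    rw [show -1 - 2 * s = (N : ℝ) - 1 - (N + 2 * s) by ring, Real.rpow_sub hy0]
    ring

theorem lk_neg {N : ℕ} (s : ℝ) (h : Eu N) : lk N s (-h) = lk N s h := by simp [lk]

theorem lintegral_etaE_mul_of_continuous {N : ℕ} (hN : 2 ≤ N) {s : ℝ} (hs : s ∈ Ioo (0 : ℝ) 1)
    {r : ℝ} (hr : 0 < r) {ρ : ℝ} (hρ : 0 < ρ) {v : Eu N → ℝ} (hv : Continuous v)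
    (hv0 : ∀ y, 0 ≤ v y) {B : ℝ} (hB : ∀ y, v y ≤ B) (hint : Integrable v)
    (hz : ∀ y, ‖y‖ ≤ r + ρ → v y = 0) :
    ∫⁻ y, etaE N s r y * ENNReal.ofReal (v y) =
      ∫⁻ y, green N s r y * cv (fun h => ENNReal.ofReal (lk N s h))
        (fun y => ENNReal.ofReal (v y)) y := by
  have hB' : ∀ y, |v y| ≤ B := fun y => by rw [abs_of_nonneg (hv0 y)]; exact hB y
  have hB0 : 0 ≤ B := (hv0 0).trans (hB 0)
  set w : Eu N → ℝ := fun h => if ‖h‖ ≤ ρ then 0 * ‖h‖ ^ (2 : ℝ) else B + B with hw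
  have hwi : Integrable fun h => lk N s h * w h :=
    integrable_lk_mul hN hs (by linarith [hs.2]) hρ _ _
  have mG := measurable_green N s r
  have mη := measurable_etaE N s r
  have ml := measurable_lk N s
  have fG : ∫⁻ y, green N s r y ≠ ⊤ := by rw [lintegral_green hN hs hr]; exact ofReal_ne_top
  have vz : ∀ z, ‖z‖ < r → v z = 0 := fun z hz' => hz z (by linarith)
  have vadd : ∀ z, ‖z‖ < r → ∀ h, v (z + h) + v (z - h) ≤ w h := by
    intro z hz' h
    simp only [hw]
    split_ifs with hh
    · rw [hz _ ((norm_add_le _ _).trans (by linarith)),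
        hz _ ((norm_sub_le _ _).trans (by linarith))]
      simp
    · exact add_le_add (hB _) (hB _)
  have key := mean_value_of_continuous hN hs hr hv hB' hint (w := w) (fun z hz' h => by
    unfold sd
    rw [vz z hz', show 2 * 0 - v (z + h) - v (z - h) = -(v (z + h) + v (z - h)) by ring, abs_neg,
      abs_of_nonneg (add_nonneg (hv0 _) (hv0 _))]
    exact vadd z hz' h) hwi
  rw [vz 0 (by simpa using hr)] at key
  have mcv : Measurable (cv (fun h => ENNReal.ofReal (lk N s h))
      (fun y => ENNReal.ofReal (v y))) := measurable_cv (by fun_prop) (by fun_prop)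
  have bcv : ∀ z, ‖z‖ < r → cv (fun h => ENNReal.ofReal (lk N s h))
      (fun y => ENNReal.ofReal (v y)) z ≤ ∫⁻ h, ENNReal.ofReal (lk N s h * w h) := by
    intro z hz'
    unfold cv
    rw [← lintegral_sub_left_eq_self _ z]
    refine lintegral_mono fun h => ?_
    simp only [_root_.sub_sub_cancel]
    rw [← ENNReal.ofReal_mul (lk_nonneg hN hs h)]
    refine ENNReal.ofReal_le_ofReal (mul_le_mul_of_nonneg_left ?_ (lk_nonneg hN hs h))
    linarith [vadd z hz' h, hv0 (z + h)]
  have fK : ∫⁻ h, ENNReal.ofReal (lk N s h * w h) ≠ ⊤ := by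
    rw [← ofReal_integral_eq_lintegral_ofReal hwi]
    · exact ofReal_ne_top
    · refine Eventually.of_forall fun h => mul_nonneg (lk_nonneg hN hs h) ?_
      simp only [hw]
      split_ifs <;> linarith
  have esd : ∀ z, ‖z‖ < r → 1 / 2 * ∫ h, lk N s h * sd v z h =
      -(cv (fun h => ENNReal.ofReal (lk N s h)) (fun y => ENNReal.ofReal (v y)) z).toReal := by
    intro z hz'
    have m1 : Measurable fun h => v (z - h) := by fun_prop
    have m2 : Measurable fun h => v (z + h) := by fun_prop
    have i1 : Integrable fun h => lk N s h * v (z - h) := by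
      refine hwi.mono' (by fun_prop) (Eventually.of_forall fun h => ?_)
      rw [Real.norm_of_nonneg (mul_nonneg (lk_nonneg hN hs h) (hv0 _))]
      exact mul_le_mul_of_nonneg_left (by linarith [vadd z hz' h, hv0 (z + h)])
        (lk_nonneg hN hs h)
    have i2 : Integrable fun h => lk N s h * v (z + h) := by
      refine i1.comp_neg.congr (Eventually.of_forall fun h => ?_)
      simp [lk_neg]
    have e1 : ∫ h, lk N s h * v (z + h) = ∫ h, lk N s h * v (z - h) := by
      rw [← integral_neg_eq_self]
      simp [lk_neg, sub_eq_add_neg]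
    have e2 : ∀ h, lk N s h * sd v z h = -(lk N s h * v (z + h)) - lk N s h * v (z - h) := by
      intro h
      rw [sd, vz z hz']
      ring
    simp_rw [e2]
    rw [integral_sub (by exact i2.neg) i1, integral_neg, e1, ← integral_sub_left_eq_self _ volume z]
    simp only [_root_.sub_sub_cancel]
    rw [integral_eq_lintegral_of_nonneg_ae
      (Eventually.of_forall fun h => mul_nonneg (lk_nonneg hN hs _) (hv0 _)) (by
        have : Measurable fun h => lk N s (z - h) := by fun_prop
        exact Measurable.aestronglyMeasurable (by fun_prop))]
    simp_rw [ENNReal.ofReal_mul (lk_nonneg hN hs _)]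
    rw [cv]
    ring
  have hle : ∀ z, green N s r z * cv (fun h => ENNReal.ofReal (lk N s h))
      (fun y => ENNReal.ofReal (v y)) z ≤
      green N s r z * ∫⁻ h, ENNReal.ofReal (lk N s h * w h) := by
    intro z
    rcases lt_or_ge ‖z‖ r with hz' | hz'
    · gcongr
      exact bcv z hz'
    · simp [green_eq_zero hr.le hz']
  have f2 : ∫⁻ y, green N s r y * cv (fun h => ENNReal.ofReal (lk N s h))
        (fun y => ENNReal.ofReal (v y)) y ≠ ⊤ := by
    refine ne_top_of_le_ne_top ?_ (lintegral_mono hle)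
    rw [lintegral_mul_const' _ _ fK]
    finiteness
  have f1 : ∫⁻ y, etaE N s r y * ENNReal.ofReal (v y) ≠ ⊤ := by
    refine ne_top_of_le_ne_top ?_ (lintegral_mul_le (M := ENNReal.ofReal B) ofReal_ne_top
      fun y => ENNReal.ofReal_le_ofReal (hB y))
    rw [lintegral_etaE hN hs hr]
    finiteness
  rw [← ENNReal.toReal_eq_toReal_iff' f1 f2,
    ← integral_toReal (by fun_prop) (ae_lt_top (by fun_prop) f1),
    ← integral_toReal (by fun_prop) (ae_lt_top (by fun_prop) f2)]
  simp only [ENNReal.toReal_mul, ENNReal.toReal_ofReal (hv0 _)]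
  have e3 : ∀ z, (green N s r z).toReal * (1 / 2 * ∫ h, lk N s h * sd v z h) =
      -((green N s r z).toReal * (cv (fun h => ENNReal.ofReal (lk N s h))
        (fun y => ENNReal.ofReal (v y)) z).toReal) := by
    intro z
    rcases lt_or_ge ‖z‖ r with hz' | hz'
    · rw [esd z hz']
      ring
    · simp [green_eq_zero hr.le hz']
  simp_rw [e3] at key
  rw [integral_neg] at key
  linarith

theorem lintegral_etaE_mul {N : ℕ} (hN : 2 ≤ N) {s : ℝ} (hs : s ∈ Ioo (0 : ℝ) 1)
    {r : ℝ} (hr : 0 < r) {ρ : ℝ} (hρ : 0 < ρ) {g : Eu N → ℝ≥0∞} (mg : Measurable g)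
    (hz : ∀ y, ‖y‖ ≤ r + ρ → g y = 0) :
    ∫⁻ y, etaE N s r y * g y =
      ∫⁻ y, green N s r y * cv (fun h => ENNReal.ofReal (lk N s h)) g y := by
  have mG := measurable_green N s r
  have mη := measurable_etaE N s r
  have ml : Measurable fun h : Eu N => ENNReal.ofReal (lk N s h) := by fun_prop
  have el : ∀ h : Eu N, ENNReal.ofReal (lk N s (-h)) = ENNReal.ofReal (lk N s h) := fun h => by
    rw [lk_neg]
  have mcv := measurable_cv ml mG
  set χ : Eu N → ℝ := fun y => min 1 (max (‖y‖ - (r + ρ)) 0) * Real.exp (-‖y‖ ^ 2) with hχ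
  have cχ : Continuous χ := by fun_prop
  have χ0 : ∀ y, 0 ≤ χ y := fun y => by positivity
  have χle : ∀ y, χ y ≤ Real.exp (-‖y‖ ^ 2) := fun y =>
    mul_le_of_le_one_left (Real.exp_pos _).le (min_le_left _ _)
  have χ1 : ∀ y, χ y ≤ 1 := fun y => (χle y).trans (Real.exp_le_one_iff.2 (by
    have := sq_nonneg ‖y‖
    linarith))
  have χz : ∀ y, ‖y‖ ≤ r + ρ → χ y = 0 := fun y hy => by
    simp [hχ, max_eq_right (sub_nonpos.2 hy)]
  have χpos : ∀ y, r + ρ < ‖y‖ → 0 < χ y := fun y hy => by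
    have : 0 < ‖y‖ - (r + ρ) := sub_pos.2 hy
    positivity
  have iχ : Integrable χ := by
    have h := GaussianFourier.integrable_cexp_neg_mul_sq_norm_add (V := Eu N) (b := 1) (by simp) 0 0
    refine h.norm.mono' cχ.aestronglyMeasurable (Eventually.of_forall fun y => ?_)
    rw [Real.norm_of_nonneg (χ0 y), Complex.norm_exp]
    refine (χle y).trans (le_of_eq ?_)
    congr 1
    simp [← Complex.ofReal_pow]
  set μ := (volume : Measure (Eu N)).withDensity fun y => etaE N s r y * ENNReal.ofReal (χ y)
  set ν := (volume : Measure (Eu N)).withDensity fun y =>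
    cv (fun h => ENNReal.ofReal (lk N s h)) (green N s r) y * ENNReal.ofReal (χ y)
  have m1 : Measurable fun y => etaE N s r y * ENNReal.ofReal (χ y) := by fun_prop
  have m2 : Measurable fun y =>
    cv (fun h => ENNReal.ofReal (lk N s h)) (green N s r) y * ENNReal.ofReal (χ y) := by fun_prop
  have hfin : IsFiniteMeasure μ := by
    refine isFiniteMeasure_withDensity ?_
    refine ne_top_of_le_ne_top ?_ (lintegral_mul_le (M := ENNReal.ofReal 1) ofReal_ne_top
      fun y => ENNReal.ofReal_le_ofReal (χ1 y))
    rw [lintegral_etaE hN hs hr]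
    finiteness
  have hμν : μ = ν := by
    refine ext_of_forall_lintegral_eq_of_IsFiniteMeasure fun f => ?_
    have mf : Measurable fun y => (f y : ℝ≥0∞) := by
      have := f.continuous
      fun_prop
    obtain ⟨B, hfB⟩ : ∃ B : ℝ, ∀ y, (f y : ℝ) ≤ B :=
      ⟨_, fun y => NNReal.coe_le_coe.2 (BoundedContinuousFunction.NNReal.upper_bound f y)⟩
    have hB0 : 0 ≤ B := (NNReal.coe_nonneg _).trans (hfB 0)
    rw [lintegral_withDensity_eq_lintegral_mul _ m1 mf,
      lintegral_withDensity_eq_lintegral_mul _ m2 mf]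
    have cf : Continuous fun y => (f y : ℝ) := NNReal.continuous_coe.comp f.continuous
    have h := lintegral_etaE_mul_of_continuous hN hs hr hρ (v := fun y => χ y * f y)
      (cχ.mul cf) (fun y => mul_nonneg (χ0 y) (NNReal.coe_nonneg _)) (B := 1 * B)
      (fun y => mul_le_mul (χ1 y) (hfB y) (NNReal.coe_nonneg _) zero_le_one)
      (iχ.mul_bdd cf.aestronglyMeasurable (c := B) (Eventually.of_forall fun y => by
        simpa using hfB y))
      (fun y hy => by simp [χz y hy])
    rw [← lintegral_cv_mul el ml (by fun_prop) mG] at h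
    simp only [ENNReal.ofReal_mul (χ0 _), ENNReal.ofReal_coe_nnreal, ← mul_assoc] at h
    exact h
  have hg : ∀ y, g y = ENNReal.ofReal (χ y) * (g y / ENNReal.ofReal (χ y)) := by
    intro y
    rcases le_or_gt ‖y‖ (r + ρ) with h | h
    · simp [hz y h]
    · rw [ENNReal.mul_div_cancel (by simpa using χpos y h) ofReal_ne_top]
  have mq : Measurable fun y => g y / ENNReal.ofReal (χ y) := by fun_prop
  have h1 := lintegral_withDensity_eq_lintegral_mul volume m1 mq
  have h2 := lintegral_withDensity_eq_lintegral_mul volume m2 mq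
  simp only [Pi.mul_apply, mul_assoc, ← hg] at h1 h2
  rw [← h1, ← lintegral_cv_mul el ml mg mG, ← h2]
  exact congrArg (fun m => ∫⁻ y, g y / ENNReal.ofReal (χ y) ∂m) hμν

theorem eta_nonneg {N : ℕ} (hN : 2 ≤ N) {s : ℝ} (hs : s ∈ Ioo (0 : ℝ) 1) {r : ℝ} (hr : 0 < r)
    (y : Eu N) : 0 ≤ eta N s r y := by
  unfold eta
  split_ifs with h
  · have hpi := Real.pi_pos
    have h1 : 0 < Real.sin (Real.pi * s) :=
      Real.sin_pos_of_pos_of_lt_pi (mul_pos hpi hs.1) (by nlinarith [hs.2])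
    have hN0 : (0 : ℝ) < N := by positivity
    have h2 := Real.Gamma_pos_of_pos (half_pos hN0)
    have h3 : 0 ≤ ‖y‖ ^ 2 - r ^ 2 := by nlinarith
    have : 0 < cK N s := by unfold cK; positivity
    positivity
  · rfl

theorem toReal_etaE {N : ℕ} (hN : 2 ≤ N) {s : ℝ} (hs : s ∈ Ioo (0 : ℝ) 1) {r : ℝ} (hr : 0 < r)
    (y : Eu N) : (etaE N s r y).toReal = eta N s r y :=
  ENNReal.toReal_ofReal (eta_nonneg hN hs hr y)

theorem gammaMV_nonneg {N : ℕ} {s : ℝ} (hs : s ∈ Ioo (0 : ℝ) 1) {r : ℝ} (hr : 0 < r) :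
    0 ≤ gammaMV N s r := by
  have hs0 := hs.1
  have h1 : 0 < Real.Gamma (1 + s) := Real.Gamma_pos_of_pos (by linarith)
  have h2 : 0 < Real.Gamma (((N : ℝ) + 2 * s) / 2) := Real.Gamma_pos_of_pos (by positivity)
  have h3 : 0 ≤ Real.Gamma ((N : ℝ) / 2) := Real.Gamma_nonneg_of_nonneg (by positivity)
  unfold gammaMV
  positivity

theorem integrable_green {N : ℕ} (hN : 2 ≤ N) {s : ℝ} (hs : s ∈ Ioo (0 : ℝ) 1) {r : ℝ}
    (hr : 0 < r) : Integrable fun y : Eu N => (green N s r y).toReal :=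
  integrable_toReal_of_lintegral_ne_top (measurable_green N s r).aemeasurable
    (by rw [lintegral_green hN hs hr]; exact ofReal_ne_top)

theorem integral_green {N : ℕ} (hN : 2 ≤ N) {s : ℝ} (hs : s ∈ Ioo (0 : ℝ) 1) {r : ℝ}
    (hr : 0 < r) : ∫ y : Eu N, (green N s r y).toReal = gammaMV N s r := by
  rw [integral_toReal_eq (measurable_green N s r)
    (by rw [lintegral_green hN hs hr]; exact ofReal_ne_top), lintegral_green hN hs hr,
    ENNReal.toReal_ofReal (gammaMV_nonneg hs hr)]

theorem integrable_green_mul {N : ℕ} (hN : 2 ≤ N) {s : ℝ} (hs : s ∈ Ioo (0 : ℝ) 1) {r : ℝ}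
    (hr : 0 < r) {F : Eu N → ℝ} (hF : ContinuousOn F (Metric.closedBall 0 r)) :
    Integrable fun y => (green N s r y).toReal * F y := by
  have hsup : (Function.support fun y => (green N s r y).toReal * F y) ⊆
      Metric.closedBall 0 r := by
    intro y hy
    by_contra h
    refine hy ?_
    rw [mem_closedBall_zero_iff, not_le] at h
    simp [green_eq_zero hr.le h.le]
  rw [← integrableOn_iff_integrable_of_support_subset hsup]
  exact (integrable_green hN hs hr).integrableOn.mul_continuousOn hF (isCompact_closedBall _ _)

theorem exists_integral_green_mul_eq {N : ℕ} (hN : 2 ≤ N) {s : ℝ} (hs : s ∈ Ioo (0 : ℝ) 1) {r : ℝ}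
    (hr : 0 < r) {F : Eu N → ℝ} (hF : ContinuousOn F (Metric.closedBall 0 r)) :
    ∃ z ∈ Metric.closedBall (0 : Eu N) r,
      ∫ y, (green N s r y).toReal * F y = gammaMV N s r * F z := by
  have hne : (Metric.closedBall (0 : Eu N) r).Nonempty := ⟨0, Metric.mem_closedBall_self hr.le⟩
  obtain ⟨a, ha, hamin⟩ := (isCompact_closedBall (0 : Eu N) r).exists_isMinOn hne hF
  obtain ⟨b, hb, hbmax⟩ := (isCompact_closedBall (0 : Eu N) r).exists_isMaxOn hne hF
  have hi := integrable_green_mul hN hs hr hF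
  have hout : ∀ y, y ∉ Metric.closedBall (0 : Eu N) r → green N s r y = 0 := fun y hy => by
    rw [mem_closedBall_zero_iff, not_le] at hy
    exact green_eq_zero hr.le hy.le
  have h1 : gammaMV N s r * F a ≤ ∫ y, (green N s r y).toReal * F y := by
    rw [← integral_green hN hs hr, ← integral_mul_const]
    refine integral_mono ((integrable_green hN hs hr).mul_const _) hi fun y => ?_
    by_cases hy : y ∈ Metric.closedBall (0 : Eu N) r
    · exact mul_le_mul_of_nonneg_left (hamin hy) toReal_nonneg
    · simp [hout y hy]
  have h2 : ∫ y, (green N s r y).toReal * F y ≤ gammaMV N s r * F b := by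
    rw [← integral_green hN hs hr, ← integral_mul_const]
    refine integral_mono hi ((integrable_green hN hs hr).mul_const _) fun y => ?_
    by_cases hy : y ∈ Metric.closedBall (0 : Eu N) r
    · exact mul_le_mul_of_nonneg_left (hbmax hy) toReal_nonneg
    · simp [hout y hy]
  obtain ⟨z, hz, hzeq⟩ := (convex_closedBall (0 : Eu N) r).isPreconnected.intermediate_value ha hb
    (hF.const_mul (gammaMV N s r)) ⟨h1, h2⟩
  exact ⟨z, hz, hzeq.symm⟩

theorem exists_lk_le {N : ℕ} (hN : 2 ≤ N) {s : ℝ} (hs : s ∈ Ioo (0 : ℝ) 1) {r d : ℝ}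
    (hr : 0 < r) (hd : 0 < d) : ∃ K : ℝ, 0 ≤ K ∧ ∀ z y : Eu N, ‖z‖ ≤ r → r + d ≤ ‖y‖ →
      lk N s (z - y) ≤ K / (1 + ‖y‖ ^ ((N : ℝ) + 2 * s)) := by
  have hs0 := hs.1
  have hC := CNs_pos hN hs
  set p := (N : ℝ) + 2 * s with hp
  have hp0 : 0 < p := by positivity
  set κ := d / (r + d) with hκ
  have hκ0 : 0 < κ := by positivity
  refine ⟨CNs N s * ((1 + ((r + d) ^ p)⁻¹) * (κ ^ p)⁻¹), by positivity, fun z y hz hy => ?_⟩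
  have hrd : 0 < r + d := by positivity
  have hy0 : 0 < ‖y‖ := hrd.trans_le hy
  have h1 : κ * ‖y‖ ≤ ‖z - y‖ := by
    have : ‖y‖ - ‖z‖ ≤ ‖z - y‖ := by rw [norm_sub_rev]; exact norm_sub_norm_le y z
    have h2 : κ * ‖y‖ ≤ ‖y‖ - r := by
      rw [hκ, div_mul_eq_mul_div, div_le_iff₀ hrd]
      nlinarith
    linarith
  have hzy : 0 < ‖z - y‖ := (by positivity : 0 < κ * ‖y‖).trans_le h1
  have h2 : κ ^ p * ‖y‖ ^ p ≤ ‖z - y‖ ^ p := by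
    rw [← Real.mul_rpow hκ0.le hy0.le]
    exact Real.rpow_le_rpow (by positivity) h1 hp0.le
  have h3 : (r + d) ^ p ≤ ‖y‖ ^ p := Real.rpow_le_rpow hrd.le hy hp0.le
  have h4 : 1 + ‖y‖ ^ p ≤ (1 + ((r + d) ^ p)⁻¹) * ‖y‖ ^ p := by
    have : 1 ≤ ((r + d) ^ p)⁻¹ * ‖y‖ ^ p := by
      rw [← div_eq_inv_mul, one_le_div (by positivity)]
      exact h3
    linarith
  rw [lk, mul_div_assoc, div_eq_mul_inv]
  refine mul_le_mul_of_nonneg_left ?_ hC.le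
  rw [inv_le_comm₀ (by positivity) (by positivity), inv_div, div_le_iff₀ (by positivity)]
  calc 1 + ‖y‖ ^ p ≤ (1 + ((r + d) ^ p)⁻¹) * ‖y‖ ^ p := h4
    _ = (κ ^ p * ‖y‖ ^ p) * ((1 + ((r + d) ^ p)⁻¹) * (κ ^ p)⁻¹) := by field_simp
    _ ≤ ‖z - y‖ ^ p * ((1 + ((r + d) ^ p)⁻¹) * (κ ^ p)⁻¹) := by gcongr

theorem continuousOn_integral_sd {N : ℕ} (hN : 2 ≤ N) {s : ℝ} (hs : s ∈ Ioo (0 : ℝ) 1) {r : ℝ}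
    {v : Eu N → ℝ} (hv : Continuous v) {w : Eu N → ℝ}
    (hw : ∀ z, ‖z‖ ≤ r → ∀ h, |sd v z h| ≤ w h) (hwi : Integrable fun h => lk N s h * w h) :
    ContinuousOn (fun z => 1 / 2 * ∫ h, lk N s h * sd v z h) (Metric.closedBall 0 r) := by
  refine ContinuousOn.const_mul (continuousOn_of_dominated (bound := fun h => lk N s h * w h)
    (fun z hz => ?_) (fun z hz => Eventually.of_forall fun h => ?_) hwi
    (Eventually.of_forall fun h => ?_)) _
  · have : Measurable fun h => sd v z h := by unfold sd; fun_prop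
    exact Measurable.aestronglyMeasurable (by fun_prop)
  · rw [norm_mul, Real.norm_of_nonneg (lk_nonneg hN hs h)]
    exact mul_le_mul_of_nonneg_left (hw z (mem_closedBall_zero_iff.1 hz) h) (lk_nonneg hN hs h)
  · refine Continuous.continuousOn ?_
    unfold sd
    fun_prop

theorem continuousAt_lk {N : ℕ} (s : ℝ) {h : Eu N} (hh : h ≠ 0) : ContinuousAt (lk N s) h := by
  have hn : 0 < ‖h‖ := norm_pos_iff.2 hh
  unfold lk
  refine ContinuousAt.div (by fun_prop) ?_ (Real.rpow_pos_of_pos hn _).ne'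
  exact ContinuousAt.rpow (by fun_prop) (by fun_prop) (Or.inl hn.ne')

theorem exists_norm_lk_mul_le {N : ℕ} (hN : 2 ≤ N) {s : ℝ} (hs : s ∈ Ioo (0 : ℝ) 1) {r d : ℝ}
    (hr : 0 < r) (hd : 0 < d) {w : Eu N → ℝ}
    (hw0 : ∀ y, ‖y‖ ≤ r + d → w y = 0) :
    ∃ K : ℝ, 0 ≤ K ∧ ∀ z y : Eu N, ‖z‖ ≤ r →
    ‖lk N s (z - y) * w y‖ ≤ K * (|w y| / (1 + ‖y‖ ^ ((N : ℝ) + 2 * s))) := by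
  obtain ⟨K, hK0, hK⟩ := exists_lk_le (N := N) hN hs hr hd
  refine ⟨K, hK0, fun z y hz => ?_⟩
  rcases le_total ‖y‖ (r + d) with h | h
  · simp [hw0 y h]
  · rw [norm_mul, Real.norm_of_nonneg (lk_nonneg hN hs _), Real.norm_eq_abs]
    calc lk N s (z - y) * |w y| ≤ K / (1 + ‖y‖ ^ ((N : ℝ) + 2 * s)) * |w y| :=
          mul_le_mul_of_nonneg_right (hK z y hz h) (abs_nonneg _)
      _ = _ := by ring

theorem continuousOn_integral_lk_mul {N : ℕ} (hN : 2 ≤ N) {s : ℝ} (hs : s ∈ Ioo (0 : ℝ) 1) {r d : ℝ}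
    (hr : 0 < r) (hd : 0 < d) {w : Eu N → ℝ} (mw : Measurable w)
    (hw0 : ∀ y, ‖y‖ ≤ r + d → w y = 0)
    (hwi : Integrable fun y => |w y| / (1 + ‖y‖ ^ ((N : ℝ) + 2 * s))) :
    ContinuousOn (fun z => ∫ y, lk N s (z - y) * w y) (Metric.closedBall 0 r) := by
  obtain ⟨K, hK0, hK⟩ := exists_norm_lk_mul_le hN hs hr hd hw0
  refine continuousOn_of_dominated (fun z hz => ?_)
    (fun z hz => Eventually.of_forall fun y => hK z y (mem_closedBall_zero_iff.1 hz))
    (hwi.const_mul K) (Eventually.of_forall fun y => ?_)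
  · have : Measurable fun y => lk N s (z - y) := by fun_prop
    exact Measurable.aestronglyMeasurable (by fun_prop)
  · rcases le_or_gt ‖y‖ (r + d) with h | h
    · simp only [hw0 y h, mul_zero]
      exact continuousOn_const
    · intro z hz
      have hne : z - y ≠ 0 := by
        rw [sub_ne_zero]
        rintro rfl
        linarith [mem_closedBall_zero_iff.1 hz]
      have := (continuousAt_lk s hne).comp (f := fun z => z - y) (by fun_prop)
      exact (this.mul continuousAt_const).continuousWithinAt

theorem integral_etaE_mul_tail {N : ℕ} (hN : 2 ≤ N) {s : ℝ} (hs : s ∈ Ioo (0 : ℝ) 1) {r d : ℝ}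
    (hr : 0 < r) (hd : 0 < d) {w : Eu N → ℝ} (mw : Measurable w)
    (hw0 : ∀ y, ‖y‖ ≤ r + d → w y = 0)
    (hwi : Integrable fun y => |w y| / (1 + ‖y‖ ^ ((N : ℝ) + 2 * s))) :
    Integrable (fun y => (etaE N s r y).toReal * w y) ∧
    ∫ y, (etaE N s r y).toReal * w y =
      ∫ z, (green N s r z).toReal * ∫ y, lk N s (z - y) * w y := by
  obtain ⟨K, hK0, hK⟩ := exists_norm_lk_mul_le hN hs hr hd hw0
  have mG := measurable_green N s r
  have mη := measurable_etaE N s r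
  have ml : Measurable fun h : Eu N => ENNReal.ofReal (lk N s h) := by fun_prop
  set I := ∫⁻ y, ENNReal.ofReal (K * (|w y| / (1 + ‖y‖ ^ ((N : ℝ) + 2 * s)))) with hI
  have hIfin : I ≠ ⊤ := by
    rw [hI, ← ofReal_integral_eq_lintegral_ofReal (hwi.const_mul K)
      (Eventually.of_forall fun y => by positivity)]
    exact ofReal_ne_top
  have key : ∀ g : Eu N → ℝ, Measurable g → (∀ y, g y ≤ |w y|) →
      (∀ y, ‖y‖ ≤ r + d → g y = 0) →
      (∀ z, ‖z‖ ≤ r → cv (fun h => ENNReal.ofReal (lk N s h)) (fun y => ENNReal.ofReal (g y)) z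
        ≤ I) ∧
      ∫⁻ y, etaE N s r y * ENNReal.ofReal (g y) = ∫⁻ y, green N s r y *
        cv (fun h => ENNReal.ofReal (lk N s h)) (fun y => ENNReal.ofReal (g y)) y ∧
      ∫⁻ y, etaE N s r y * ENNReal.ofReal (g y) ≠ ⊤ := by
    intro g mg hg hg0
    have b1 : ∀ z, ‖z‖ ≤ r → cv (fun h => ENNReal.ofReal (lk N s h))
        (fun y => ENNReal.ofReal (g y)) z ≤ I := by
      intro z hz
      refine lintegral_mono fun y => ?_
      rw [← ENNReal.ofReal_mul (lk_nonneg hN hs _)]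
      refine ENNReal.ofReal_le_ofReal (le_trans ?_ (hK z y hz))
      rw [norm_mul, Real.norm_of_nonneg (lk_nonneg hN hs _), Real.norm_eq_abs]
      exact mul_le_mul_of_nonneg_left (hg y) (lk_nonneg hN hs _)
    have e := lintegral_etaE_mul hN hs hr hd (g := fun y => ENNReal.ofReal (g y)) (by fun_prop)
      (fun y hy => by simp [hg0 y hy])
    refine ⟨b1, e, ?_⟩
    rw [e]
    refine ne_top_of_le_ne_top ?_ (lintegral_mono (g := fun z => green N s r z * I) fun z => ?_)
    · rw [lintegral_mul_const' _ _ hIfin, lintegral_green hN hs hr]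
      finiteness
    · rcases lt_or_ge ‖z‖ r with hz | hz
      · exact mul_le_mul_right (b1 z hz.le) _
      · simp [green_eq_zero hr.le hz]
  obtain ⟨p1, p2, p3⟩ := key w mw (fun y => le_abs_self _) hw0
  obtain ⟨q1, q2, q3⟩ := key (fun y => -w y) (by fun_prop) (fun y => neg_le_abs _)
    (fun y hy => by simp [hw0 y hy])
  obtain ⟨-, -, a3⟩ := key (fun y => |w y|) (by fun_prop) (fun y => le_rfl)
    (fun y hy => by simp [hw0 y hy])
  have mcv : ∀ g : Eu N → ℝ, Measurable g → Measurable
      (cv (fun h => ENNReal.ofReal (lk N s h)) (fun y => ENNReal.ofReal (g y))) :=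
    fun g mg => measurable_cv ml (by fun_prop)
  refine ⟨?_, ?_⟩
  · have := integrable_toReal_of_lintegral_ne_top (by fun_prop) a3
    refine this.mono' (Measurable.aestronglyMeasurable (by fun_prop))
      (Eventually.of_forall fun y => ?_)
    rw [ENNReal.toReal_mul, ENNReal.toReal_ofReal (abs_nonneg _), norm_mul,
      Real.norm_of_nonneg toReal_nonneg, Real.norm_eq_abs]
  · have e1 := toReal_lintegral_mul_sub mη (P := fun y => ENNReal.ofReal (w y))
      (Q := fun y => ENNReal.ofReal (-w y)) (by fun_prop) (by fun_prop) p3 q3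
    simp only [toReal_ofReal_sub] at e1
    rw [← e1, p2, q2, toReal_lintegral_mul_sub mG (mcv _ mw) (mcv (fun y => -w y) (by fun_prop))
      (by rwa [← p2]) (by rwa [← q2])]
    refine integral_congr_ae (Eventually.of_forall fun z => ?_)
    rcases lt_or_ge ‖z‖ r with hz | hz
    · simp only
      congr 1
      unfold cv
      rw [toReal_lintegral_mul_sub (by fun_prop) (by fun_prop) (by fun_prop)
        (ne_top_of_le_ne_top hIfin (p1 z hz.le)) (ne_top_of_le_ne_top hIfin (q1 z hz.le))]
      simp only [toReal_ofReal_sub, ENNReal.toReal_ofReal (lk_nonneg hN hs _)]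
    · simp [green_eq_zero hr.le hz]

/-- The kernel `lk` truncated to `{ε ≤ ‖h‖}`. -/
noncomputable def lkTrunc (N : ℕ) (s ε : ℝ) (h : Eu N) : ℝ≥0∞ :=
  if ε ≤ ‖h‖ then ENNReal.ofReal (lk N s h) else 0

theorem measurable_lkTrunc (N : ℕ) (s ε : ℝ) : Measurable (lkTrunc N s ε) :=
  Measurable.ite (measurableSet_le measurable_const measurable_norm) (by fun_prop)
    measurable_const

theorem lkTrunc_neg {N : ℕ} (s ε : ℝ) (h : Eu N) : lkTrunc N s ε (-h) = lkTrunc N s ε h := by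
  simp [lkTrunc, lk_neg]

theorem toReal_lkTrunc {N : ℕ} (hN : 2 ≤ N) {s : ℝ} (hs : s ∈ Ioo (0 : ℝ) 1) (ε : ℝ) (h : Eu N) :
    (lkTrunc N s ε h).toReal = if ε ≤ ‖h‖ then lk N s h else 0 := by
  unfold lkTrunc
  split_ifs
  · exact ENNReal.toReal_ofReal (lk_nonneg hN hs h)
  · simp

theorem lintegral_lkTrunc_ne_top {N : ℕ} (hN : 2 ≤ N) {s : ℝ} (hs : s ∈ Ioo (0 : ℝ) 1) {ε : ℝ}
    (hε : 0 < ε) : ∫⁻ h, lkTrunc N s ε h ≠ ⊤ := by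
  have i := integrable_lk_mul hN hs (β := 2 * s + 1) (by linarith) (half_pos hε) 0 1
  refine ne_top_of_le_ne_top i.2.ne (lintegral_mono fun h => ?_)
  unfold lkTrunc
  split_ifs with h1
  · dsimp only
    rw [if_neg (by linarith), mul_one, Real.enorm_of_nonneg (lk_nonneg hN hs h)]
  · exact zero_le

theorem tendsto_integral_lkTrunc_mul_sub {N : ℕ} (hN : 2 ≤ N) {s : ℝ} (hs : s ∈ Ioo (0 : ℝ) 1)
    {v : Eu N → ℝ} (hv : Measurable v) {B : ℝ} (hB : ∀ y, |v y| ≤ B) {b : Eu N → ℝ} {z : Eu N}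
    (hb : ∀ h, |sd v z h| ≤ b h) (hbi : Integrable fun h => lk N s h * b h) :
    Tendsto (fun ε => ∫ y, (lkTrunc N s ε (z - y)).toReal * (v z - v y))
      (nhdsWithin 0 (Ioi 0)) (nhds (1 / 2 * ∫ h, lk N s h * sd v z h)) := by
  have := nontrivial_Eu hN
  have e : ∀ ε > 0, ∫ y, (lkTrunc N s ε (z - y)).toReal * (v z - v y) =
      1 / 2 * ∫ h, (lkTrunc N s ε h).toReal * sd v z h := by
    intro ε hε
    have mk := measurable_lkTrunc N s ε
    have hk := lintegral_lkTrunc_ne_top hN hs hε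
    rw [← mul_sub_cvR mk hk (lkTrunc_neg s ε) hv hB, cvR_eq, ← integral_toReal_eq mk hk,
      ← integral_mul_const, ← integral_sub, ← integral_sub_left_eq_self _ volume z]
    · simp [mul_sub]
    · exact (integrable_toReal_of_lintegral_ne_top mk.aemeasurable hk).mul_const _
    · exact integrable_toReal_mul mk hk (v := fun h => v (z - h))
        (hv.comp (measurable_const_sub z)).aestronglyMeasurable (fun y => hB _)
  refine Tendsto.congr' (eventually_nhdsWithin_of_forall fun ε hε => (e ε hε).symm)
    (Tendsto.const_mul _ ?_)
  have msd : Measurable fun h => sd v z h := by unfold sd; fun_prop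
  refine tendsto_integral_filter_of_dominated_convergence _ (Eventually.of_forall fun ε => ?_)
    (Eventually.of_forall fun ε => Eventually.of_forall fun h => ?_) hbi ?_
  · have mk := measurable_lkTrunc N s ε
    exact Measurable.aestronglyMeasurable (by fun_prop)
  · rw [toReal_lkTrunc hN hs, norm_mul, Real.norm_eq_abs, Real.norm_eq_abs]
    have hl := lk_nonneg hN hs h
    have hb0 := (abs_nonneg _).trans (hb h)
    split_ifs
    · rw [abs_of_nonneg hl]
      exact mul_le_mul_of_nonneg_left (hb h) hl
    · simpa using mul_nonneg hl hb0
  · filter_upwards [Measure.ae_ne volume (0 : Eu N)] with h hh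
    refine tendsto_const_nhds.congr' ?_
    filter_upwards [nhdsWithin_le_nhds (Iio_mem_nhds (norm_pos_iff.2 hh))] with ε hε
    rw [toReal_lkTrunc hN hs, if_pos (le_of_lt hε)]

theorem hasFracLap_of_decomposition {N : ℕ} (hN : 2 ≤ N) {s : ℝ} (hs : s ∈ Ioo (0 : ℝ) 1)
    {r d : ℝ} (hd : 0 < d) {U v : Eu N → ℝ}
    (hv : Measurable v) {B : ℝ} (hB : ∀ y, |v y| ≤ B) (hUv : ∀ y, ‖y‖ ≤ r + d → v y = U y)
    {b : Eu N → ℝ} {z : Eu N} (hz : ‖z‖ ≤ r)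
    (hb : ∀ h, |sd v z h| ≤ b h) (hbi : Integrable fun h => lk N s h * b h)
    (hi : Integrable fun y => lk N s (z - y) * (U y - v y)) :
    HasFracLap N s U z
      ((1 / 2 * ∫ h, lk N s h * sd v z h) - ∫ y, lk N s (z - y) * (U y - v y)) := by
  refine ((tendsto_integral_lkTrunc_mul_sub hN hs hv hB hb hbi).sub_const _).congr' ?_
  filter_upwards [self_mem_nhdsWithin, nhdsWithin_le_nhds (Iio_mem_nhds hd)] with ε hε hεd
  have hε0 : 0 < ε := hε
  have hεd' : ε < d := hεd
  have mk := measurable_lkTrunc N s ε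
  have hk := lintegral_lkTrunc_ne_top hN hs hε0
  have i1 : Integrable fun y => (lkTrunc N s ε (z - y)).toReal * (v z - v y) := by
    have j1 := integrable_toReal_mul mk hk (v := fun h => v z - v (z - h))
      (hv.comp (measurable_const_sub z) |>.const_sub _).aestronglyMeasurable (B := B + B)
      (fun y => (abs_sub _ _).trans (add_le_add (hB _) (hB _)))
    simpa using j1.comp_sub_left z
  rw [← integral_sub i1 hi, ← integral_const_mul,
    ← integral_indicator Metric.isOpen_ball.measurableSet.compl]
  refine integral_congr_ae (Eventually.of_forall fun y => ?_)
  simp only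
  rw [toReal_lkTrunc hN hs]
  by_cases h : ε ≤ ‖z - y‖
  · rw [indicator_of_mem (by simpa [dist_eq_norm, norm_sub_rev y z] using h), if_pos h,
      hUv z (by linarith)]
    unfold lk
    ring
  · have h2 : ‖y‖ ≤ r + d := by
      have : ‖y‖ ≤ ‖z‖ + ‖z - y‖ := by simpa using norm_sub_le z (z - y)
      linarith
    rw [indicator_of_notMem (by simpa [dist_eq_norm, norm_sub_rev y z] using h), if_neg h,
      hUv y h2]
    simp

theorem exists_continuous_hasCompactSupport_eq {N : ℕ} {ρ R : ℝ} (hρ : ρ < R) {U : Eu N → ℝ}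
    (hU : ContinuousOn U (Metric.closedBall 0 R)) :
    ∃ v : Eu N → ℝ, Continuous v ∧ HasCompactSupport v ∧ ∀ y, ‖y‖ ≤ ρ → v y = U y := by
  obtain ⟨g, hg⟩ := ContinuousMap.exists_restrict_eq
    (Metric.isClosed_closedBall (x := (0 : Eu N)) (ε := R)) ⟨_, hU.domRestrict⟩
  refine ⟨fun y => max 0 (min 1 ((R - ‖y‖) / (R - ρ))) * g y, by fun_prop,
    HasCompactSupport.intro (isCompact_closedBall (0 : Eu N) R) fun y hy => ?_, fun y hy => ?_⟩
  · have hy' : R < ‖y‖ := by simpa using hy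
    rw [max_eq_left, zero_mul]
    exact (min_le_right _ _).trans
      (div_nonpos_of_nonpos_of_nonneg (by linarith) (by linarith))
  · have e : g y = U y := congrArg (fun f => f ⟨y, by simpa using hy.trans hρ.le⟩) hg
    dsimp only
    rw [min_eq_left ((one_le_div (by linarith)).2 (by linarith)), max_eq_right zero_le_one,
      one_mul, e]

theorem exists_mean_value {N : ℕ} (hN : 2 ≤ N) {s : ℝ} (hs : s ∈ Ioo (0 : ℝ) 1)
    {r d : ℝ} (hr : 0 < r) (hd : 0 < d) {U : Eu N → ℝ} (mU : Measurable U)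
    (hU : ContinuousOn U (Metric.closedBall 0 (r + 2 * d)))
    (hUi : Integrable fun y => |U y| / (1 + ‖y‖ ^ ((N : ℝ) + 2 * s)))
    {β C : ℝ} (hβ : 2 * s < β) (hC : ∀ z h, ‖z‖ ≤ r → ‖h‖ ≤ d → |sd U z h| ≤ C * ‖h‖ ^ β) :
    ∃ z ∈ Metric.closedBall (0 : Eu N) r, ∃ L, HasFracLap N s U z L ∧
      Integrable (fun y => eta N s r y * U y) ∧
      U 0 = (∫ y, eta N s r y * U y) + gammaMV N s r * L := by
  obtain ⟨v, cv, sv, hvU⟩ := exists_continuous_hasCompactSupport_eq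
    (show r + d < r + 2 * d by linarith) hU
  obtain ⟨B, hB⟩ := cv.bounded_above_of_compact_support sv
  simp only [Real.norm_eq_abs] at hB
  have iv : Integrable v := cv.integrable_of_hasCompactSupport sv
  have hs0 := hs.1
  have ivw : Integrable fun y => |v y| / (1 + ‖y‖ ^ ((N : ℝ) + 2 * s)) := by
    refine iv.abs.mono' (Measurable.aestronglyMeasurable (by fun_prop))
      (Eventually.of_forall fun y => ?_)
    have h0 : 0 ≤ ‖y‖ ^ ((N : ℝ) + 2 * s) := by positivity
    rw [Real.norm_of_nonneg (by positivity)]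
    exact div_le_self (abs_nonneg _) (by linarith)
  set w : Eu N → ℝ := fun y => U y - v y with hw
  have mw : Measurable w := by fun_prop
  have hw0 : ∀ y, ‖y‖ ≤ r + d → w y = 0 := fun y hy => by simp [hw, hvU y hy]
  have hwi : Integrable fun y => |w y| / (1 + ‖y‖ ^ ((N : ℝ) + 2 * s)) := by
    refine (hUi.add ivw).mono' (Measurable.aestronglyMeasurable (by fun_prop))
      (Eventually.of_forall fun y => ?_)
    rw [Real.norm_of_nonneg (by positivity), Pi.add_apply, ← add_div]
    gcongr
    exact abs_sub _ _
  set b : Eu N → ℝ := fun h => if ‖h‖ ≤ d then C * ‖h‖ ^ β else 4 * B with hbdef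
  have hb : ∀ z, ‖z‖ ≤ r → ∀ h, |sd v z h| ≤ b h := by
    intro z hz h
    simp only [hbdef]
    split_ifs with hh
    · have e : sd v z h = sd U z h := by
        unfold sd
        rw [hvU z (by linarith), hvU _ ((norm_add_le _ _).trans (by linarith)),
          hvU _ ((norm_sub_le _ _).trans (by linarith))]
      rw [e]
      exact hC z h hz hh
    · have h1 := abs_le.1 (hB z)
      have h2 := abs_le.1 (hB (z + h))
      have h3 := abs_le.1 (hB (z - h))
      unfold sd
      rw [abs_le]
      constructor <;> linarith
  have hbi : Integrable fun h => lk N s h * b h := integrable_lk_mul hN hs hβ hd C (4 * B)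
  have hlw : ∀ z, ‖z‖ ≤ r → Integrable fun y => lk N s (z - y) * w y := by
    intro z hz
    obtain ⟨K, -, hK⟩ := exists_norm_lk_mul_le hN hs hr hd hw0
    refine (hwi.const_mul K).mono' ?_ (Eventually.of_forall fun y => hK z y hz)
    have : Measurable fun y => lk N s (z - y) := by fun_prop
    exact Measurable.aestronglyMeasurable (by fun_prop)
  have c1 := continuousOn_integral_sd hN hs cv hb hbi
  have c2 := continuousOn_integral_lk_mul hN hs hr hd mw hw0 hwi
  obtain ⟨z, hz, hzF⟩ := exists_integral_green_mul_eq hN hs hr (c1.sub c2)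
  have hz' : ‖z‖ ≤ r := by simpa using hz
  obtain ⟨iηw, eηw⟩ := integral_etaE_mul_tail hN hs hr hd mw hw0 hwi
  have iηv : Integrable fun y => (etaE N s r y).toReal * v y :=
    integrable_toReal_mul (measurable_etaE N s r)
      (by rw [lintegral_etaE hN hs hr]; exact one_ne_top) cv.aestronglyMeasurable hB
  have hsum : (fun y => eta N s r y * U y) =
      fun y => (etaE N s r y).toReal * v y + (etaE N s r y).toReal * w y := by
    funext y
    rw [toReal_etaE hN hs hr]
    simp only [hw]
    ring
  have hmv := mean_value_of_continuous hN hs hr cv hB iv (fun z hz => hb z hz.le) hbi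
  refine ⟨z, hz, _, hasFracLap_of_decomposition hN hs hd cv.measurable hB hvU hz'
    (hb z hz') hbi (hlw z hz'), ?_, ?_⟩
  · rw [hsum]
    exact iηv.add iηw
  · rw [hsum, integral_add iηv iηw, eηw, ← hvU 0 (by simp; linarith), hmv]
    simp only [Pi.sub_apply, mul_sub] at hzF
    rw [integral_sub (by exact integrable_green_mul hN hs hr c1)
      (integrable_green_mul hN hs hr c2)] at hzF
    rw [mul_sub, ← hzF]
    ring

theorem exists_abs_sd_le {N : ℕ} {s : ℝ} (hs : 0 < s) {Ω : Set (Eu N)} {u : Eu N → ℝ}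
    (hu : MemC2sEps N s Ω u) {x : Eu N} {r d : ℝ} (hK : Metric.closedBall x (r + d) ⊆ Ω) :
    ∃ β C : ℝ, 2 * s < β ∧
      ∀ z h, z ∈ Metric.closedBall x r → ‖h‖ ≤ d → |sd u z h| ≤ C * ‖h‖ ^ β := by
  obtain ⟨α, hα, -, hor⟩ := hu.2 _ hK (isCompact_closedBall _ _)
  have hball : ∀ z h : Eu N, z ∈ Metric.closedBall x r → ‖h‖ ≤ d →
      Metric.closedBall z ‖h‖ ⊆ Metric.closedBall x (r + d) := fun z h hz hh =>
    Metric.closedBall_subset_closedBall' (by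
      have := Metric.mem_closedBall.1 hz
      linarith)
  have hadd : ∀ z h : Eu N, z + h ∈ Metric.closedBall z ‖h‖ := fun z h => by simp
  have hsub : ∀ z h : Eu N, z - h ∈ Metric.closedBall z ‖h‖ := fun z h => by simp
  have hself : ∀ z h : Eu N, z ∈ Metric.closedBall z ‖h‖ := fun z h => by simp
  rcases hor with ⟨-, C, hC⟩ | ⟨hβ, hdiff, C, hC⟩
  · refine ⟨2 * s + α, 2 * C, by linarith, fun z h hz hh => ?_⟩
    have hb := hball z h hz hh
    have e1 := hC.dist_le (hb (hself z h)) (hb (hadd z h))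
    have e2 := hC.dist_le (hb (hself z h)) (hb (hsub z h))
    rw [Real.coe_toNNReal _ (by linarith)] at e1 e2
    simp only [dist_self_add_right, dist_self_sub_right, Real.dist_eq] at e1 e2
    calc |sd u z h| = |(u z - u (z + h)) + (u z - u (z - h))| := by unfold sd; ring_nf
      _ ≤ _ := (abs_add_le _ _).trans (by linarith)
  · refine ⟨2 * s + α, 2 * C, by linarith, fun z h hz hh => ?_⟩
    have hb := hball z h hz hh
    have hder : ∀ y ∈ Metric.closedBall z ‖h‖,
        ‖fderiv ℝ u y - fderiv ℝ u z‖ ≤ C * ‖h‖ ^ (2 * s + α - 1) := by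
      intro y hy
      have e := hC.dist_le (hb hy) (hb (hself z h))
      rw [Real.coe_toNNReal _ (by linarith), dist_eq_norm] at e
      refine e.trans ?_
      gcongr
      exact hy
    have taylor : ∀ y ∈ Metric.closedBall z ‖h‖,
        ‖u y - u z - fderiv ℝ u z (y - z)‖ ≤ C * ‖h‖ ^ (2 * s + α - 1) * ‖y - z‖ :=
      fun y hy => (convex_closedBall z ‖h‖).norm_image_sub_le_of_norm_hasFDerivWithin_le'
        (fun y hy => (hdiff y (hb hy)).hasFDerivAt.hasFDerivWithinAt) hder (hself z h) hy
    have e1 := taylor _ (hadd z h)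
    have e2 := taylor _ (hsub z h)
    have e3 : ‖h‖ ^ (2 * s + α) = ‖h‖ ^ (2 * s + α - 1) * ‖h‖ := by
      rw [← Real.rpow_add_one' (norm_nonneg _) (by linarith), sub_add_cancel]
    have e4 : z - h - z = -h := by abel
    rw [add_sub_cancel_left, Real.norm_eq_abs] at e1
    rw [e4, map_neg, norm_neg, Real.norm_eq_abs] at e2
    calc |sd u z h| = |(u (z + h) - u z - fderiv ℝ u z h) +
          (u (z - h) - u z - -fderiv ℝ u z h)| := by unfold sd; rw [← abs_neg]; ring_nf
      _ ≤ _ := (abs_add_le _ _).trans (by rw [e3]; linarith)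

theorem integrable_div_comp_sub_left {N : ℕ} {s : ℝ} (hs : 0 < s) {u : Eu N → ℝ}
    (hmeas : Measurable u) (hint : Integrable fun y => |u y| / (1 + ‖y‖ ^ ((N : ℝ) + 2 * s)))
    (x : Eu N) : Integrable fun y => |u (x - y)| / (1 + ‖y‖ ^ ((N : ℝ) + 2 * s)) := by
  set p := (N : ℝ) + 2 * s with hp
  have hp0 : 0 < p := by positivity
  refine ((hint.comp_sub_left x).const_mul (1 + (1 + ‖x‖) ^ p * 2 ^ p)).mono'
    (Measurable.aestronglyMeasurable (by fun_prop)) (Eventually.of_forall fun y => ?_)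
  rw [Real.norm_of_nonneg (by positivity), ← mul_div_assoc, div_le_div_iff₀ (by positivity)
    (by positivity)]
  have key : 1 + ‖x - y‖ ^ p ≤ (1 + (1 + ‖x‖) ^ p * 2 ^ p) * (1 + ‖y‖ ^ p) := by
    have hx := norm_nonneg x
    have h1 : ‖x - y‖ ≤ (1 + ‖x‖) * 2 * max 1 ‖y‖ := by
      have h2 := le_max_left 1 ‖y‖
      have h3 := le_max_right 1 ‖y‖
      nlinarith [norm_sub_le x y]
    have h2 : max 1 ‖y‖ ^ p ≤ 1 + ‖y‖ ^ p := by
      have : 0 ≤ ‖y‖ ^ p := by positivity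
      rcases max_cases 1 ‖y‖ with ⟨h, -⟩ | ⟨h, -⟩ <;> rw [h]
      · simpa using this
      · linarith
    have h3 : ‖x - y‖ ^ p ≤ (1 + ‖x‖) ^ p * 2 ^ p * (1 + ‖y‖ ^ p) := by
      calc ‖x - y‖ ^ p ≤ ((1 + ‖x‖) * 2 * max 1 ‖y‖) ^ p := by gcongr
        _ = (1 + ‖x‖) ^ p * 2 ^ p * max 1 ‖y‖ ^ p := by
          rw [Real.mul_rpow (by positivity) (by positivity), Real.mul_rpow (by positivity)
            (by positivity)]
        _ ≤ _ := by gcongr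
    have : 0 ≤ ‖y‖ ^ p := by positivity
    linarith
  calc _ ≤ |u (x - y)| * ((1 + (1 + ‖x‖) ^ p * 2 ^ p) * (1 + ‖y‖ ^ p)) := by gcongr
    _ = _ := by ring

theorem hasFracLap_comp_sub_left {N : ℕ} {s : ℝ} {u : Eu N → ℝ} {x z : Eu N} {L : ℝ}
    (h : HasFracLap N s (fun y => u (x - y)) z L) : HasFracLap N s u (x - z) L := by
  refine h.congr fun ε => ?_
  rw [← integral_indicator Metric.isOpen_ball.measurableSet.compl,
    ← integral_indicator Metric.isOpen_ball.measurableSet.compl,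
    ← integral_sub_left_eq_self _ volume x]
  congr 2
  funext y
  have e : ‖x - z - y‖ = ‖z - (x - y)‖ := by rw [← norm_neg]; congr 1; abel
  simp only [indicator, mem_compl_iff, Metric.mem_ball, dist_eq_norm, _root_.sub_sub_cancel, e,
    norm_sub_rev _ z, norm_sub_rev _ (x - z)]

end FracMV

/-- **Mean value formula for the fractional Laplacian**: if `u ∈ C^{2s+ε}(Ω)` and
`∫ |u(y)|/(1+|y|^{N+2s}) dy < ∞`, then for any closed ball `B̄_r(x) ⊆ Ω` there is
`z ∈ B̄_r(x)` with `u(x) = ∫_{ℝ^N∖B_r} η_r(y)·u(x−y) dy + γ(N,s,r)·(−Δ)^s u(z)`. -/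
theorem fractional_mean_value (N : ℕ) (hN : 2 ≤ N) (s : ℝ) (hs : s ∈ Set.Ioo (0 : ℝ) 1)
    (Ω : Set (EuclideanSpace ℝ (Fin N))) (hΩ : IsOpen Ω)
    (u : EuclideanSpace ℝ (Fin N) → ℝ) (hmeas : Measurable u)
    (hint : Integrable (fun y => |u y| / (1 + ‖y‖ ^ ((N : ℝ) + 2 * s))))
    (hu : MemC2sEps N s Ω u)
    (x : EuclideanSpace ℝ (Fin N)) (hx : x ∈ Ω) (r : ℝ) (hr : 0 < r)
    (hball : Metric.closedBall x r ⊆ Ω) :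
    ∃ z ∈ Metric.closedBall x r, ∃ L : ℝ, HasFracLap N s u z L ∧
      IntegrableOn (fun y => eta N s r y * u (x - y))
        (Metric.ball (0 : EuclideanSpace ℝ (Fin N)) r)ᶜ ∧
      u x = (∫ y in (Metric.ball (0 : EuclideanSpace ℝ (Fin N)) r)ᶜ, eta N s r y * u (x - y))
          + gammaMV N s r * L := by
  obtain ⟨δ, hδ, hδΩ⟩ := (isCompact_closedBall x r).exists_cthickening_subset_open hΩ hball
  rw [cthickening_closedBall hδ.le hr.le] at hδΩ
  have hd : 0 < δ / 2 := half_pos hδ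
  have hK : Metric.closedBall x (r + 2 * (δ / 2)) ⊆ Ω := by
    rwa [show r + 2 * (δ / 2) = δ + r by ring]
  obtain ⟨β, C, hβ, hC⟩ := FracMV.exists_abs_sd_le hs.1 hu (r := r) (d := δ / 2)
    ((Metric.closedBall_subset_closedBall (by linarith)).trans hK)
  have hmem : ∀ {y : EuclideanSpace ℝ (Fin N)} {ρ : ℝ}, y ∈ Metric.closedBall 0 ρ →
      x - y ∈ Metric.closedBall x ρ := fun {y ρ} hy => by simpa [dist_eq_norm] using hy
  obtain ⟨z, hz, L, hL, hi, e⟩ := FracMV.exists_mean_value hN hs hr hd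
    (U := fun y => u (x - y)) (by fun_prop)
    ((hu.1.mono hK).comp (by fun_prop) fun y hy => hmem hy)
    (FracMV.integrable_div_comp_sub_left hs.1 hmeas hint x) hβ (C := C) fun z h hz hh => by
      have e : FracMV.sd (fun y => u (x - y)) z h = FracMV.sd u (x - z) h := by
        unfold FracMV.sd
        simp only [show x - (z + h) = x - z - h by abel, show x - (z - h) = x - z + h by abel]
        ring
      rw [e]
      exact hC _ h (hmem (by simpa using hz)) hh
  refine ⟨x - z, hmem hz, L, FracMV.hasFracLap_comp_sub_left hL, hi.integrableOn, ?_⟩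
  rw [setIntegral_eq_integral_of_forall_compl_eq_zero, ← e, sub_zero]
  intro y hy
  have hy' : ‖y‖ < r := by simpa using hy
  simp [eta, hy'.le.not_gt]
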